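/- The vector bundle ρ : Π_{V,D•;V²} → L^s_{V¹,D¹} × L_{V²,D²} has fiber dimension Σ_{h∈H} ν¹_{h'}ν²_{h''} + Σ_{i∈I} d¹_i ν²_i + Σ_{i∈I} ν¹_i d²_i − Σ_{i∈I} ν¹_i ν²_i, where ν^a = dim V^a and d^a = dim D^a; consequently, Π_{V,D•;V²} is pure-dimensional of dimension (1/2)·dim E(V,D) − Σ_{i∈I} ν¹_i ν²_i. -/

import Mathlib

noncomputable section
open scoped Classical

/-- The algebra of polynomial functions on a complex vector space `M`: the
subalgebra of `M → ℂ` generated by the linear functionals. -/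
def polyFuns (M : Type) [AddCommGroup M] [Module ℂ M] : Subalgebra ℂ (M → ℂ) :=
  Algebra.adjoin ℂ (Set.range fun l : Module.Dual ℂ M => (l : M → ℂ))

/-- The Zariski topology on a complex vector space `M`: generated by the
complements of zero sets of polynomial functions. -/
def zariski (M : Type) [AddCommGroup M] [Module ℂ M] : TopologicalSpace M :=
  TopologicalSpace.generateFrom {u | ∃ P ∈ polyFuns M, u = {x : M | P x ≠ 0}}

/-- The subspace (Zariski) topology on a subset `S ⊆ M`. -/
def subTop {M : Type} [AddCommGroup M] [Module ℂ M] (S : Set M) :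
    TopologicalSpace S :=
  TopologicalSpace.induced Subtype.val (zariski M)

/-- The set of irreducible components of a subset `S ⊆ M` for the Zariski topology. -/
def zIrr {M : Type} [AddCommGroup M] [Module ℂ M] (S : Set M) : Set (Set S) :=
  @irreducibleComponents S (subTop S)

/-- The dimension (topological Krull dimension for the Zariski topology) of a
subset `S ⊆ M`. -/
def zDim {M : Type} [AddCommGroup M] [Module ℂ M] (S : Set M) : WithBot ℕ∞ :=
  @topologicalKrullDim S (subTop S)

/-- The dimension of a subset `C` of `S ⊆ M` (e.g. an irreducible component). -/
def zDimC {M : Type} [AddCommGroup M] [Module ℂ M] {S : Set M} (C : Set S) :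
    WithBot ℕ∞ :=
  @topologicalKrullDim C (TopologicalSpace.induced Subtype.val (subTop S))

/-- The number of irreducible components of a product `S × T` (with the product of
the Zariski subspace topologies). -/
def zIrrProdCount {M M' : Type} [AddCommGroup M] [Module ℂ M]
    [AddCommGroup M'] [Module ℂ M'] (S : Set M) (T : Set M') : ℕ :=
  (@irreducibleComponents (S × T) (@instTopologicalSpaceProd _ _ (subTop S) (subTop T))).ncard

variable {I H : Type} [Fintype I] [DecidableEq I] [Fintype H]

/-- The `I`-graded vector space with dimension vector `ν`. -/
abbrev Vec (ν : I → ℕ) : Type := (i : I) → (Fin (ν i) → ℂ)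

/-- The projection onto the `i`-th graded piece of `Vec ν`. -/
def pr (ν : I → ℕ) (i : I) : Module.End ℂ (Vec ν) :=
  (LinearMap.single ℂ (fun j => Fin (ν j) → ℂ) i).comp (LinearMap.proj i)

variable (s t : H → I) (bar : H → H) (eps : H → ℤ)

/-- A family `x : H → End(Vec ν)` is a graded representation of the graph:
each `x h` is supported on the block from piece `s h` to piece `t h`. -/
def gradedX (ν : I → ℕ) (x : H → Module.End ℂ (Vec ν)) : Prop :=
  ∀ h, pr ν (t h) ∘ₗ x h ∘ₗ pr ν (s h) = x h

/-- Nilpotency of a representation of the graph `Γ`. -/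
def NilpGraph {ν : I → ℕ} (x : H → Module.End ℂ (Vec ν)) : Prop :=
  ∃ n : ℕ, ∀ l : List H, l.length = n → (l.map x).prod = 0

/-- Lusztig's nilpotent variety `Λ_V`: graded representations satisfying the
moment map equation `Σ_{h''=i} ε(h) x_h x_{h̄} = 0` which are nilpotent. -/
def ΛV (ν : I → ℕ) : Set (H → Module.End ℂ (Vec ν)) :=
  {x | gradedX s t ν x ∧ (∑ h : H, eps h • (x h * x (bar h))) = 0 ∧ NilpGraph x}

/-- A graded homomorphism between graded vector spaces. -/
def gradedHom (ν μ : I → ℕ) (q : Vec ν →ₗ[ℂ] Vec μ) : Prop :=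
  ∀ i, pr μ i ∘ₗ q = q ∘ₗ pr ν i

/-- The variety `L_{V,D} = Λ_V × Hom(V,D)`. -/
def LSet (ν μ : I → ℕ) :
    Set ((H → Module.End ℂ (Vec ν)) × (Vec ν →ₗ[ℂ] Vec μ)) :=
  {X | X.1 ∈ ΛV s t bar eps ν ∧ gradedHom ν μ X.2}

/-- The stable (open) subvariety `L^s_{V,D}`: the locus where all the maps
`X(i) = q_i ⊕ ⊕_{h'=i} x_h` are injective. -/
def LsSet (ν μ : I → ℕ) :
    Set ((H → Module.End ℂ (Vec ν)) × (Vec ν →ₗ[ℂ] Vec μ)) :=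
  {X | X ∈ LSet s t bar eps ν μ ∧
    ∀ (i : I) (u : Vec ν), pr ν i u = u → X.2 u = 0 →
      (∀ h, s h = i → X.1 h u = 0) → u = 0}

/-- The framing space `D = D² ⊕ D¹`. -/
abbrev Dsp (μ2 μ1 : I → ℕ) : Type := Vec μ2 × Vec (I := I) μ1

/-- The grading projections on `D`. -/
def eD (μ2 μ1 : I → ℕ) (i : I) : Module.End ℂ (Dsp μ2 μ1) :=
  (pr μ2 i).prodMap (pr μ1 i)

/-- The ambient linear space containing `E(V,D)`: triples `(x, p, q)`. -/
abbrev Msp (ν μ2 μ1 : I → ℕ) : Type :=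
  (H → Module.End ℂ (Vec ν)) × (Dsp μ2 μ1 →ₗ[ℂ] Vec ν) × (Vec ν →ₗ[ℂ] Dsp μ2 μ1)

/-- `D² ⊆ D` as a subspace. -/
def D2sub (μ2 μ1 : I → ℕ) : Submodule ℂ (Dsp μ2 μ1) :=
  LinearMap.range (LinearMap.inl ℂ (Vec μ2) (Vec (I := I) μ1))

/-- The maps of the framed quiver attached to a triple `X = (x,p,q)`, acting on
`V ⊕ D`; used to formulate nilpotency of `X` as a framed representation. -/
def edgeMap {ν μ2 μ1 : I → ℕ} (X : Msp (H := H) ν μ2 μ1) :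
    H ⊕ (I ⊕ I) → Module.End ℂ (Vec ν × Dsp μ2 μ1) :=
  Sum.elim (fun h => (X.1 h).prodMap 0)
    (Sum.elim
      (fun i => (LinearMap.inl ℂ (Vec ν) (Dsp μ2 μ1)) ∘ₗ
        (X.2.1 ∘ₗ eD μ2 μ1 i) ∘ₗ (LinearMap.snd ℂ (Vec ν) (Dsp μ2 μ1)))
      (fun i => (LinearMap.inr ℂ (Vec ν) (Dsp μ2 μ1)) ∘ₗ
        (eD μ2 μ1 i ∘ₗ X.2.2) ∘ₗ (LinearMap.fst ℂ (Vec ν) (Dsp μ2 μ1))))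

/-- Nilpotency of `X = (x,p,q)` as a representation of the framed graph. -/
def NilpFramed {ν μ2 μ1 : I → ℕ} (X : Msp (H := H) ν μ2 μ1) : Prop :=
  ∃ n : ℕ, ∀ l : List (H ⊕ (I ⊕ I)), l.length = n →
    (l.map (edgeMap X)).prod = 0

/-- `x`-invariance of a subspace. -/
def xInv {ν : I → ℕ} (x : H → Module.End ℂ (Vec ν)) (U : Submodule ℂ (Vec ν)) : Prop :=
  ∀ h, ∀ v ∈ U, x h v ∈ U

/-- The smallest `x`-invariant subspace containing `S` (written `S̄`). -/
def invClosure {ν : I → ℕ} (x : H → Module.End ℂ (Vec ν)) (S : Submodule ℂ (Vec ν)) :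
    Submodule ℂ (Vec ν) :=
  sInf {U | S ≤ U ∧ xInv x U}

/-- The largest `x`-invariant subspace contained in `S` (written `S̲`). -/
def invCore {ν : I → ℕ} (x : H → Module.End ℂ (Vec ν)) (S : Submodule ℂ (Vec ν)) :
    Submodule ℂ (Vec ν) :=
  sSup {U | U ≤ S ∧ xInv x U}

/-- The tensor product variety `Π_{V,D•}` (for the two-step flag `D ⊇ D² ⊇ 0`):
nilpotent graded solutions `X = (x,p,q)` of the moment map equation with
`closure of p(D) ⊆ core of q⁻¹(D²)` and `p(D²) = 0`. -/
def PiSet (ν μ2 μ1 : I → ℕ) : Set (Msp (H := H) ν μ2 μ1) :=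
  {X | gradedX s t ν X.1 ∧
    (∀ i, pr ν i ∘ₗ X.2.1 = X.2.1 ∘ₗ eD μ2 μ1 i) ∧
    (∀ i, eD μ2 μ1 i ∘ₗ X.2.2 = X.2.2 ∘ₗ pr ν i) ∧
    (∑ h : H, eps h • (X.1 h * X.1 (bar h))) = X.2.1 ∘ₗ X.2.2 ∧
    NilpFramed X ∧
    invClosure X.1 (LinearMap.range X.2.1) ≤
      invCore X.1 (Submodule.comap X.2.2 (D2sub μ2 μ1)) ∧
    (∀ d ∈ D2sub μ2 μ1, X.2.1 d = 0)}

/-- The subspace `V² ⊆ V` (the last `ν2 i` coordinates in each graded piece). -/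
def V2sub (ν1 ν2 : I → ℕ) : Submodule ℂ (Vec fun i => ν1 i + ν2 i) where
  carrier := {v | ∀ (i : I) (k : Fin (ν1 i + ν2 i)), (k : ℕ) < ν1 i → v i k = 0}
  add_mem' := by intro a b ha hb i k hk; simp [ha i k hk, hb i k hk]
  zero_mem' := by intro i k hk; rfl
  smul_mem' := by intro c a ha i k hk; simp [ha i k hk]

/-- The inclusion `V¹ → V` (first coordinates). -/
def emb1 (ν1 ν2 : I → ℕ) : Vec ν1 →ₗ[ℂ] Vec fun i => ν1 i + ν2 i where
  toFun u i k := if h : (k : ℕ) < ν1 i then u i ⟨(k : ℕ), h⟩ else 0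
  map_add' := by intro u v; funext i k; by_cases h : (k : ℕ) < ν1 i <;> simp [h]
  map_smul' := by intro c u; funext i k; by_cases h : (k : ℕ) < ν1 i <;> simp [h]

/-- The projection `V → V¹`. -/
def proj1 (ν1 ν2 : I → ℕ) : (Vec fun i => ν1 i + ν2 i) →ₗ[ℂ] Vec ν1 where
  toFun v i k := v i (Fin.castLE (Nat.le_add_right _ _) k)
  map_add' _ _ := rfl
  map_smul' _ _ := rfl

/-- The inclusion `V² → V` (last coordinates). -/
def emb2 (ν1 ν2 : I → ℕ) : Vec ν2 →ₗ[ℂ] Vec fun i => ν1 i + ν2 i where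
  toFun u i k :=
    if h : ν1 i ≤ (k : ℕ) then u i ⟨(k : ℕ) - ν1 i, by have hk : (k : ℕ) < ν1 i + ν2 i := k.isLt; omega⟩ else 0
  map_add' := by intro u v; funext i k; by_cases h : ν1 i ≤ (k : ℕ) <;> simp [h]
  map_smul' := by intro c u; funext i k; by_cases h : ν1 i ≤ (k : ℕ) <;> simp [h]

/-- The projection `V → V²`. -/
def proj2 (ν1 ν2 : I → ℕ) : (Vec fun i => ν1 i + ν2 i) →ₗ[ℂ] Vec ν2 where
  toFun v i k := v i (Fin.natAdd (ν1 i) k)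
  map_add' _ _ := rfl
  map_smul' _ _ := rfl

/-- The stratum `Π_{V,D•;V²}` of the tensor product variety where the largest
`x`-invariant subspace of `q⁻¹(D²)` equals `V²`. -/
def PiSetV2 (ν1 ν2 μ2 μ1 : I → ℕ) :
    Set (Msp (H := H) (fun i => ν1 i + ν2 i) μ2 μ1) :=
  {X | X ∈ PiSet s t bar eps (fun i => ν1 i + ν2 i) μ2 μ1 ∧
    invCore X.1 (Submodule.comap X.2.2 (D2sub μ2 μ1)) = V2sub ν1 ν2}

/-- The map `ρ : Π_{V,D•;V²} → L^s_{V¹,D¹} × L_{V²,D²}`, `X ↦ (X¹, X²)`, given by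
the induced representations on `V¹ = V/V²` and on `V²`. -/
def ρmap (ν1 ν2 μ2 μ1 : I → ℕ) (X : Msp (H := H) (fun i => ν1 i + ν2 i) μ2 μ1) :
    ((H → Module.End ℂ (Vec ν1)) × (Vec ν1 →ₗ[ℂ] Vec μ1)) ×
      ((H → Module.End ℂ (Vec ν2)) × (Vec ν2 →ₗ[ℂ] Vec μ2)) :=
  ((fun h => proj1 ν1 ν2 ∘ₗ X.1 h ∘ₗ emb1 ν1 ν2,
      (LinearMap.snd ℂ (Vec μ2) (Vec μ1)) ∘ₗ X.2.2 ∘ₗ emb1 ν1 ν2),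
   (fun h => proj2 ν1 ν2 ∘ₗ X.1 h ∘ₗ emb2 ν1 ν2,
      (LinearMap.fst ℂ (Vec μ2) (Vec μ1)) ∘ₗ X.2.2 ∘ₗ emb2 ν1 ν2))

section ZariskiGeometry

open TopologicalSpace Topology

section Chains

/-- Every nonempty open set meets the smallest member of some chain of length `d` of
irreducible closed subsets. -/
def HasChains (X : Type*) [TopologicalSpace X] (d : ℕ) : Prop :=
  ∀ U : Set X, IsOpen U → U.Nonempty →
    ∃ p : LTSeries (IrreducibleCloseds X), p.length = d ∧ ((p.head : Set X) ∩ U).Nonempty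

variable {X Y P : Type*} [TopologicalSpace X] [TopologicalSpace Y] [TopologicalSpace P]

theorem HasChains.le_krullDim {d : ℕ} (h : HasChains X d) [Nonempty X] :
    (d : WithBot ℕ∞) ≤ topologicalKrullDim X := by
  obtain ⟨p, hp, -⟩ := h Set.univ isOpen_univ Set.univ_nonempty
  exact hp ▸ Order.LTSeries.length_le_krullDim p

theorem HasChains.of_unique [Subsingleton X] : HasChains X 0 := by
  rintro U - ⟨x, hx⟩
  have : ({x} : Set X) = Set.univ := Set.eq_univ_of_forall fun y => Subsingleton.elim _ _
  exact ⟨RelSeries.singleton _ ⟨{x}, isIrreducible_singleton, this ▸ isClosed_univ⟩, rfl, x, rfl, hx⟩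

/-- If every nonempty open set of `X` meets the image of a space with chains under an
inducing map, then `X` has chains. -/
theorem HasChains.of_inducing {d : ℕ} {J : Type*} {S : J → Type*}
    [∀ j, TopologicalSpace (S j)] (hS : ∀ j, HasChains (S j) d) (f : ∀ j, S j → X)
    (hf : ∀ j, IsInducing (f j)) (hcov : ∀ x, ∃ j, x ∈ Set.range (f j)) : HasChains X d := by
  rintro U hU ⟨x, hx⟩
  obtain ⟨j, y, rfl⟩ := hcov x
  obtain ⟨p, hp, z, hz, hzU⟩ := hS j (f j ⁻¹' U) (hU.preimage (hf j).continuous) ⟨y, hx⟩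
  refine ⟨p.map _ (IrreducibleCloseds.map_strictMono_of_isInducing (hf j)), hp, f j z, ?_, hzU⟩
  exact subset_closure ⟨z, hz, rfl⟩

theorem HasChains.of_openEmbedding {d : ℕ} (h : HasChains X d) {f : Y → X}
    (hf : IsOpenEmbedding f) : HasChains Y d := by
  intro U hU hne
  obtain ⟨p, hp, z, hz, u, hu, rfl⟩ := h (f '' U) (hf.isOpenMap U hU) (hne.image f)
  have hmem : ∀ i, (f ⁻¹' (p i : Set X)).Nonempty := fun i =>
    ⟨u, p.monotone (Fin.zero_le i) hz⟩
  let q : LTSeries {V : IrreducibleCloseds X | (f ⁻¹' (V : Set X)).Nonempty} :=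
    { length := p.length
      toFun := fun i => ⟨p i, hmem i⟩
      step := fun i => p.step i }
  refine ⟨q.map _ (IrreducibleCloseds.orderIsoOfIsOpenEmbedding f hf).symm.strictMono, hp,
    u, ?_, hu⟩
  exact hz

variable {fst : P → X} {snd : P → Y} {mk : X → Y → P}

theorem isIrreducible_prod (h1 : ∀ x y, fst (mk x y) = x) (h2 : ∀ x y, snd (mk x y) = y)
    (hmk : ∀ p, mk (fst p) (snd p) = p) (hx : ∀ y, Continuous fun x => mk x y)
    (hy : ∀ x, Continuous fun y => mk x y) {Z : Set X} {W : Set Y} (hZ : IsIrreducible Z)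
    (hW : IsIrreducible W) : IsIrreducible {p | fst p ∈ Z ∧ snd p ∈ W} := by
  obtain ⟨z, hz⟩ := hZ.nonempty
  obtain ⟨w, hw⟩ := hW.nonempty
  refine ⟨⟨mk z w, by simp [h1, h2, hz, hw]⟩, ?_⟩
  rintro u v hu hv ⟨a, ⟨ha1, ha2⟩, ha⟩ ⟨b, ⟨hb1, hb2⟩, hb⟩
  obtain ⟨c, hc, hcu, hcv⟩ := hZ.isPreirreducible _ _ (hu.preimage (hx (snd a)))
    (hv.preimage (hx (snd b))) ⟨fst a, ha1, by simpa [hmk] using ha⟩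
    ⟨fst b, hb1, by simpa [hmk] using hb⟩
  obtain ⟨e, he, heu, hev⟩ := hW.isPreirreducible _ _ (hu.preimage (hy c))
    (hv.preimage (hy c)) ⟨snd a, ha2, hcu⟩ ⟨snd b, hb2, hcv⟩
  exact ⟨mk c e, by simp [h1, h2, hc, he], heu, hev⟩

theorem HasChains.prod {d e : ℕ} (hX : HasChains X d) (hY : HasChains Y e)
    (hfst : Continuous fst) (hsnd : Continuous snd)
    (h1 : ∀ x y, fst (mk x y) = x) (h2 : ∀ x y, snd (mk x y) = y)
    (hmk : ∀ p, mk (fst p) (snd p) = p) (hx : ∀ y, Continuous fun x => mk x y)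
    (hy : ∀ x, Continuous fun y => mk x y) : HasChains P (d + e) := by
  rintro U hU ⟨a, ha⟩
  obtain ⟨p, hp, x, hxp, hxU⟩ := hX _ (hU.preimage (hx (snd a))) ⟨fst a, by simpa [hmk] using ha⟩
  obtain ⟨q, hq, y, hyq, hyU⟩ := hY _ (hU.preimage (hy x)) ⟨snd a, hxU⟩
  let F (A : IrreducibleCloseds X) (B : IrreducibleCloseds Y) : IrreducibleCloseds P :=
    ⟨{p | fst p ∈ A ∧ snd p ∈ B}, isIrreducible_prod h1 h2 hmk hx hy A.isIrreducible
      B.isIrreducible, (A.isClosed.preimage hfst).inter (B.isClosed.preimage hsnd)⟩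
  have hF : ∀ A B x y, mk x y ∈ F A B ↔ x ∈ A ∧ y ∈ B := fun A B x y => by
    change fst (mk x y) ∈ A ∧ snd (mk x y) ∈ B ↔ _
    rw [h1, h2]
  have hle : ∀ A B A' B', F A B ≤ F A' B' ↔ A ≤ A' ∧ B ≤ B' := by
    intro A B A' B'
    constructor
    · intro h
      obtain ⟨a, ha⟩ := A.isIrreducible.nonempty
      obtain ⟨b, hb⟩ := B.isIrreducible.nonempty
      exact ⟨fun c hc => ((hF _ _ _ _).1 (h ((hF A B c b).2 ⟨hc, hb⟩))).1,
        fun c hc => ((hF _ _ _ _).1 (h ((hF A B a c).2 ⟨ha, hc⟩))).2⟩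
    · rintro ⟨h, h'⟩ p ⟨hp, hp'⟩
      exact ⟨h hp, h' hp'⟩
  have m1 : ∀ B, StrictMono fun A => F A B := fun B A A' h => by
    simp only [lt_iff_le_not_ge, hle] at h ⊢
    tauto
  have m2 : ∀ A, StrictMono fun B => F A B := fun A B B' h => by
    simp only [lt_iff_le_not_ge, hle] at h ⊢
    tauto
  have hconn : RelSeries.last (p.map _ (m1 q.head)) = RelSeries.head (q.map _ (m2 p.last)) := rfl
  refine ⟨RelSeries.smash _ _ hconn, congrArg₂ (· + ·) hp hq, mk x y, ?_, hyU⟩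
  rw [RelSeries.head_smash]
  exact (hF _ _ _ _).2 ⟨hxp, hyq⟩

theorem HasChains.le_krullDim_component [NoetherianSpace X] {d : ℕ} (h : HasChains X d)
    {C : Set X} (hC : C ∈ irreducibleComponents X) : (d : WithBot ℕ∞) ≤ topologicalKrullDim C := by
  obtain ⟨U, hU, hne, hUC⟩ := NoetherianSpace.exists_isOpen_nonempty_subset_irreducibleComponent C hC
  have : Nonempty U := hne.to_subtype
  exact (h.of_openEmbedding hU.isOpenEmbedding_subtypeVal).le_krullDim.trans
    (IsEmbedding.inclusion hUC).isInducing.topologicalKrullDim_le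

end Chains

section ZariskiTopology

variable {M : Type} [AddCommGroup M] [Module ℂ M]

theorem isOpen_zariski {P : M → ℂ} (hP : P ∈ polyFuns M) : IsOpen[zariski M] {x | P x ≠ 0} :=
  GenerateOpen.basic _ ⟨P, hP, rfl⟩

theorem exists_poly_of_isOpen {U : Set M} (hU : IsOpen[zariski M] U) :
    ∀ x ∈ U, ∃ P ∈ polyFuns M, P x ≠ 0 ∧ {y | P y ≠ 0} ⊆ U := by
  induction hU with
  | basic u hu =>
    obtain ⟨P, hP, rfl⟩ := hu
    exact fun x hx => ⟨P, hP, hx, subset_rfl⟩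
  | univ => exact fun x _ => ⟨1, one_mem _, one_ne_zero, Set.subset_univ _⟩
  | inter u v _ _ hu hv =>
    rintro x ⟨hxu, hxv⟩
    obtain ⟨P, hP, hPx, hPu⟩ := hu x hxu
    obtain ⟨Q, hQ, hQx, hQv⟩ := hv x hxv
    exact ⟨P * Q, mul_mem hP hQ, mul_ne_zero hPx hQx,
      fun y hy => ⟨hPu (left_ne_zero_of_mul hy), hQv (right_ne_zero_of_mul hy)⟩⟩
  | sUnion T _ ih =>
    rintro x ⟨u, hu, hx⟩
    obtain ⟨P, hP, hPx, hPu⟩ := ih u hu x hx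
    exact ⟨P, hP, hPx, hPu.trans (Set.subset_sUnion_of_mem hu)⟩

theorem isOpen_subTop_iff {S : Set M} {U : Set S} :
    IsOpen[subTop S] U ↔ ∃ V, IsOpen[zariski M] V ∧ Subtype.val ⁻¹' V = U :=
  @isOpen_induced_iff _ _ (zariski M) _ _

theorem isOpen_subTop_of_forall {S : Set M} {U : Set S}
    (h : ∀ x ∈ U, ∃ P ∈ polyFuns M, P x ≠ 0 ∧ ∀ y : S, P y ≠ 0 → y ∈ U) :
    IsOpen[subTop S] U := by
  let _ := subTop S
  rw [isOpen_iff_forall_mem_open]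
  intro x hx
  obtain ⟨P, hP, hPx, hPU⟩ := h x hx
  exact ⟨Subtype.val ⁻¹' {y | P y ≠ 0}, hPU, isOpen_subTop_iff.2 ⟨_, isOpen_zariski hP, rfl⟩, hPx⟩

theorem exists_poly_of_isOpen_subTop {S : Set M} {U : Set S} (hU : IsOpen[subTop S] U) :
    ∀ x ∈ U, ∃ P ∈ polyFuns M, P x ≠ 0 ∧ ∀ y : S, P y ≠ 0 → y ∈ U := by
  obtain ⟨V, hV, rfl⟩ := isOpen_subTop_iff.1 hU
  intro x hx
  obtain ⟨P, hP, hPx, hPV⟩ := exists_poly_of_isOpen hV x hx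
  exact ⟨P, hP, hPx, fun y hy => hPV hy⟩

/-- The affine functions on `M`. -/
def affFuns (M : Type) [AddCommGroup M] [Module ℂ M] : Submodule ℂ (M → ℂ) :=
  1 ⊔ LinearMap.range (LinearMap.ltoFun ℂ M ℂ ℂ)

theorem one_le_affFuns : 1 ≤ affFuns M := le_sup_left

theorem dual_mem_affFuns (l : Module.Dual ℂ M) : (l : M → ℂ) ∈ affFuns M :=
  le_sup_right (a := (1 : Submodule ℂ (M → ℂ))) ⟨l, rfl⟩

theorem affFuns_pow_mono {k l : ℕ} (h : k ≤ l) : affFuns M ^ k ≤ affFuns M ^ l :=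
  pow_le_pow_right₀ one_le_affFuns h

theorem dual_mem_polyFuns (l : Module.Dual ℂ M) : (l : M → ℂ) ∈ polyFuns M :=
  Algebra.subset_adjoin ⟨l, rfl⟩

theorem affFuns_le_polyFuns : affFuns M ≤ (polyFuns M).toSubmodule := by
  refine sup_le ?_ ?_
  · rw [Submodule.one_le]
    exact one_mem (polyFuns M)
  · rintro _ ⟨l, rfl⟩
    exact dual_mem_polyFuns l

theorem affFuns_pow_le_polyFuns (k : ℕ) : affFuns M ^ k ≤ (polyFuns M).toSubmodule := by
  intro g hg
  induction hg using Submodule.pow_induction_on_left' with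
  | algebraMap r => exact algebraMap_mem (polyFuns M) r
  | add x y i _ _ hx hy => exact add_mem hx hy
  | mem_mul m hm i x _ hx => exact (polyFuns M).mul_mem (affFuns_le_polyFuns hm) hx

theorem exists_mem_affFuns_pow {P : M → ℂ} (hP : P ∈ polyFuns M) : ∃ k, P ∈ affFuns M ^ k := by
  induction hP using Algebra.adjoin_induction with
  | mem x hx =>
    obtain ⟨l, rfl⟩ := hx
    exact ⟨1, by simpa using dual_mem_affFuns l⟩
  | algebraMap r => exact ⟨0, by rw [pow_zero]; exact Submodule.algebraMap_mem r⟩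
  | add x y _ _ hx hy =>
    obtain ⟨a, ha⟩ := hx
    obtain ⟨b, hb⟩ := hy
    exact ⟨max a b, add_mem (affFuns_pow_mono (le_max_left _ _) ha)
      (affFuns_pow_mono (le_max_right _ _) hb)⟩
  | mul x y _ _ hx hy =>
    obtain ⟨a, ha⟩ := hx
    obtain ⟨b, hb⟩ := hy
    exact ⟨a + b, by rw [pow_add]; exact Submodule.mul_mem_mul ha hb⟩

variable [FiniteDimensional ℂ M]

instance finiteDimensional_affFuns_pow (k : ℕ) : FiniteDimensional ℂ (affFuns M ^ k :) := by
  refine Module.Finite.iff_fg.2 (Submodule.FG.pow (Submodule.FG.sup ?_ ?_) k)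
  · rw [Submodule.one_eq_span]
    exact Submodule.fg_span_singleton _
  · exact Module.Finite.iff_fg.1 inferInstance

instance finiteDimensional_affFuns : FiniteDimensional ℂ (affFuns M) := by
  have := finiteDimensional_affFuns_pow (M := M) 1
  rwa [pow_one] at this

theorem polyFuns_fg : (polyFuns M).FG := by
  obtain ⟨s, hs⟩ := Module.Finite.iff_fg.1 (finiteDimensional_affFuns (M := M))
  refine ⟨s, le_antisymm ?_ ?_⟩
  · refine Algebra.adjoin_le fun x hx => affFuns_le_polyFuns ?_
    rw [← hs]
    exact Submodule.subset_span hx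
  · refine Algebra.adjoin_le ?_
    rintro _ ⟨l, rfl⟩
    have := dual_mem_affFuns l
    rw [← hs] at this
    exact Algebra.span_le_adjoin _ _ this

/-- Evaluation of polynomial functions, as a map to the prime spectrum. -/
def evalSpec (M : Type) [AddCommGroup M] [Module ℂ M] (x : M) : PrimeSpectrum (polyFuns M) :=
  ⟨RingHom.ker ((Pi.evalRingHom (fun _ : M => ℂ) x).comp (polyFuns M).val.toRingHom),
    RingHom.ker_isPrime _⟩

theorem noetherianSpace_zariski : @NoetherianSpace M (zariski M) := by
  let _ := zariski M
  have : Algebra.FiniteType ℂ (polyFuns M) := (polyFuns M).fg_iff_finiteType.1 polyFuns_fg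
  have : IsNoetherianRing (polyFuns M) := Algebra.FiniteType.isNoetherianRing ℂ _
  refine IsInducing.noetherianSpace (i := evalSpec M) ⟨?_⟩
  rw [PrimeSpectrum.isTopologicalBasis_basic_opens.eq_generateFrom, induced_generateFrom_eq]
  change generateFrom _ = _
  congr 1
  ext u
  constructor
  · rintro ⟨P, hP, rfl⟩
    exact ⟨_, ⟨⟨P, hP⟩, rfl⟩, rfl⟩
  · rintro ⟨_, ⟨P, rfl⟩, rfl⟩
    exact ⟨P.1, P.2, rfl⟩

theorem noetherianSpace_subTop (S : Set M) : @NoetherianSpace S (subTop S) := by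
  let _ := zariski M
  have := noetherianSpace_zariski (M := M)
  exact IsInducing.subtypeVal.noetherianSpace

end ZariskiTopology

section Growth

variable {M : Type} [AddCommGroup M] [Module ℂ M]

/-- Restriction of functions to a subset. -/
def restr (S : Set M) : (M → ℂ) →ₗ[ℂ] (S → ℂ) := LinearMap.funLeft ℂ ℂ Subtype.val

/-- The dimension of the space of restrictions to `S` of polynomial functions of degree
at most `k`. -/
def hil (S : Set M) (k : ℕ) : ℕ := Module.finrank ℂ ((affFuns M ^ k).map (restr S))

variable [FiniteDimensional ℂ M]

theorem hil_mono_set {S T : Set M} (h : S ⊆ T) (k : ℕ) : hil S k ≤ hil T k := by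
  have : (affFuns M ^ k).map (restr S) =
      ((affFuns M ^ k).map (restr T)).map (LinearMap.funLeft ℂ ℂ (Set.inclusion h)) := by
    rw [← Submodule.map_comp]
    rfl
  rw [hil, this]
  exact Submodule.finrank_map_le _ _

theorem hil_mono (S : Set M) {k l : ℕ} (h : k ≤ l) : hil S k ≤ hil S l :=
  Submodule.finrank_mono (Submodule.map_mono (affFuns_pow_mono h))

theorem finrank_le_sum_of_injective {W : Type*} [AddCommGroup W] [Module ℂ W] {J : Type*} [Fintype J]
    {U : J → Type*} [∀ j, AddCommGroup (U j)] [∀ j, Module ℂ (U j)] (A : Submodule ℂ W)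
    (f : ∀ j, W →ₗ[ℂ] U j) (B : ∀ j, Submodule ℂ (U j)) [∀ j, FiniteDimensional ℂ (B j)]
    (hAB : ∀ j, ∀ w ∈ A, f j w ∈ B j) (hinj : ∀ w ∈ A, (∀ j, f j w = 0) → w = 0) :
    Module.finrank ℂ A ≤ ∑ j, Module.finrank ℂ (B j) := by
  let φ : A →ₗ[ℂ] ∀ j, B j :=
    LinearMap.pi fun j => ((f j).domRestrict A).codRestrict (B j) fun w => hAB j w w.2
  have hφ : Function.Injective φ := by
    refine (injective_iff_map_eq_zero φ).2 fun w hw => ?_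
    exact Subtype.ext (hinj w w.2 fun j => congrArg Subtype.val (congrFun hw j))
  rw [← Module.finrank_pi_fintype]
  exact LinearMap.finrank_le_finrank_of_injective hφ

theorem hil_iUnion_le {J : Type*} [Fintype J] (S : J → Set M) (k : ℕ) :
    hil (⋃ j, S j) k ≤ ∑ j, hil (S j) k := by
  refine finrank_le_sum_of_injective _
    (fun j => LinearMap.funLeft ℂ ℂ (Set.inclusion (Set.subset_iUnion S j))) _ ?_ ?_
  · rintro j _ ⟨g, hg, rfl⟩
    exact ⟨g, hg, rfl⟩
  · rintro w - h
    ext ⟨x, hx⟩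
    obtain ⟨j, hj⟩ := Set.mem_iUnion.1 hx
    exact congrFun (h j) ⟨x, hj⟩

theorem one_le_hil {S : Set M} (hS : S.Nonempty) (k : ℕ) : 1 ≤ hil S k := by
  rw [Nat.one_le_iff_ne_zero, hil, Ne, Submodule.finrank_eq_zero, ← Ne, Submodule.ne_bot_iff]
  obtain ⟨x, hx⟩ := hS
  exact ⟨restr S 1, ⟨1, Submodule.one_le.1 (one_le_pow₀ one_le_affFuns) , rfl⟩,
    fun h => one_ne_zero (congrFun h ⟨x, hx⟩)⟩

theorem hil_add_le {Z Z' : Set M} (hZ : Z ⊆ Z') (hirr : @IsPreirreducible M (zariski M) Z')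
    {a : ℕ} {f : M → ℂ} (hfa : f ∈ affFuns M ^ a) (hfZ : ∀ x ∈ Z, f x = 0)
    (hfZ' : ∃ x ∈ Z', f x ≠ 0) (k : ℕ) : hil Z' k + hil Z (k + a) ≤ hil Z' (k + a) := by
  let R := (affFuns M ^ (k + a)).map (restr Z')
  let A := (affFuns M ^ k).map (restr Z')
  let φ : R →ₗ[ℂ] (Z → ℂ) := (LinearMap.funLeft ℂ ℂ (Set.inclusion hZ)).domRestrict R
  have hrange : LinearMap.range φ = (affFuns M ^ (k + a)).map (restr Z) := by
    rw [LinearMap.range_domRestrict, ← Submodule.map_comp]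
    rfl
  have hmul : ∀ u ∈ A, restr Z' f * u ∈ R := by
    rintro _ ⟨g, hg, rfl⟩
    refine ⟨f * g, ?_, rfl⟩
    rw [add_comm, pow_add]
    exact Submodule.mul_mem_mul hfa hg
  let m0 : A →ₗ[ℂ] R :=
    ((LinearMap.mulLeft ℂ (restr Z' f)).domRestrict A).codRestrict R fun u => hmul u u.2
  have hm0 : ∀ u, φ (m0 u) = 0 := by
    intro u
    ext x
    change f x * _ = 0
    rw [hfZ x x.2, zero_mul]
  let m : A →ₗ[ℂ] LinearMap.ker φ := m0.codRestrict _ fun u => hm0 u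
  have hm : Function.Injective m := by
    refine (injective_iff_map_eq_zero m).2 ?_
    rintro ⟨_, g, hg, rfl⟩ hu
    have h0 : ∀ x ∈ Z', f x * g x = 0 := fun x hx =>
      congrFun (congrArg (fun w => (w : R).1) (congrArg Subtype.val hu)) ⟨x, hx⟩
    ext ⟨x, hx⟩
    change g x = 0
    by_contra hgx
    obtain ⟨y, hy, hyf, hyg⟩ := hirr _ _ (isOpen_zariski (affFuns_pow_le_polyFuns _ hfa))
      (isOpen_zariski (affFuns_pow_le_polyFuns _ hg)) hfZ' ⟨x, hx, hgx⟩
    exact mul_ne_zero hyf hyg (h0 y hy)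
  have h1 := LinearMap.finrank_range_add_finrank_ker φ
  have h2 := LinearMap.finrank_le_finrank_of_injective hm
  rw [hrange] at h1
  change Module.finrank ℂ A + Module.finrank ℂ _ ≤ Module.finrank ℂ R
  linarith

theorem choose_le_hil_last {S : Set M} (p : @LTSeries (@IrreducibleCloseds S (subTop S)) _) :
    ∃ r, 1 ≤ r ∧ ∀ m, (m + p.length).choose p.length ≤
      hil (Subtype.val '' (p.last : Set S)) (r * m) := by
  let _ := zariski M
  induction p using RelSeries.inductionOn' with
  | singleton Z =>
    refine ⟨1, le_rfl, fun m => ?_⟩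
    simpa using one_le_hil (Z.isIrreducible.nonempty.image _) _
  | snoc p Z hx ih =>
    obtain ⟨r, hr, ih⟩ := ih
    obtain ⟨hle, x, hxZ, hxp⟩ := Set.ssubset_iff_exists.1 (show (p.last : Set S) ⊂ Z from hx)
    obtain ⟨f, hf, hfx, hfp⟩ := exists_poly_of_isOpen_subTop
      (U := (p.last : Set S)ᶜ) p.last.isClosed.isOpen_compl x hxp
    obtain ⟨a, ha⟩ := exists_mem_affFuns_pow hf
    have hirr : IsPreirreducible (Subtype.val '' (Z : Set S)) :=
      (Z.isIrreducible.image _ continuous_subtype_val.continuousOn).isPreirreducible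
    have key := hil_add_le (Set.image_mono hle) hirr ha
      (by
        rintro _ ⟨y, hy, rfl⟩
        by_contra h
        exact hfp y h hy) ⟨x, ⟨x, hxZ, rfl⟩, hfx⟩
    refine ⟨max a r, le_max_of_le_right hr, fun m => ?_⟩
    rw [RelSeries.last_snoc, RelSeries.snoc_length]
    induction m with
    | zero => simpa using one_le_hil (Z.isIrreducible.nonempty.image _) _
    | succ m ihm =>
      have e1 : max a r * (m + 1) = max a r * m + (max a r - a) + a := by
        have := le_max_left a r
        rw [mul_add]; omega
      have h1 := key (max a r * m + (max a r - a))
      rw [← e1] at h1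
      have h2 := hil_mono (Subtype.val '' (Z : Set S)) (Nat.le_add_right (max a r * m) (max a r - a))
      have h3 := hil_mono (Subtype.val '' (p.last : Set S))
        (Nat.mul_le_mul_right (m + 1) (le_max_right a r))
      have h4 := ih (m + 1)
      have h5 : (m + 1 + (p.length + 1)).choose (p.length + 1) =
          (m + 1 + p.length).choose p.length + (m + (p.length + 1)).choose (p.length + 1) := by
        rw [← add_assoc, Nat.choose_succ_succ]
        congr 2
        ring
      omega

theorem length_le_of_choose_le {n d r C : ℕ}
    (h : ∀ m, (m + n).choose n ≤ C * (r * m + 1) ^ d) : n ≤ d := by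
  by_contra! hlt
  have h1 : ∀ m : ℕ, (m + 1) ≤ n.factorial * C * (r + 1) ^ d := by
    intro m
    have h2 : (m + 1) ^ n ≤ n.factorial * (m + n).choose n := by
      have := Nat.pow_succ_le_ascFactorial (m + 1) n
      rw [Nat.ascFactorial_eq_factorial_mul_choose] at this
      simpa [add_assoc] using this
    have h3 : (r * m + 1) ^ d ≤ ((r + 1) * (m + 1)) ^ d := Nat.pow_le_pow_left (by nlinarith) d
    have h4 : (m + 1) * (m + 1) ^ d ≤ (m + 1) ^ n := by
      rw [← pow_succ']
      exact Nat.pow_le_pow_right (by omega) hlt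
    rw [mul_pow] at h3
    have h5 : (m + 1) * (m + 1) ^ d ≤ n.factorial * C * (r + 1) ^ d * (m + 1) ^ d := by
      calc _ ≤ _ := h4.trans h2
        _ ≤ n.factorial * (C * (r * m + 1) ^ d) := Nat.mul_le_mul_left _ (h m)
        _ ≤ n.factorial * (C * ((r + 1) ^ d * (m + 1) ^ d)) := by gcongr
        _ = _ := by ring
    exact Nat.le_of_mul_le_mul_right h5 (by positivity)
  have := h1 (n.factorial * C * (r + 1) ^ d)
  omega

theorem zDim_le_of_hil_le {S : Set M} {C d : ℕ} (h : ∀ k, hil S k ≤ C * (k + 1) ^ d) :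
    zDim S ≤ d := by
  refine iSup_le fun p => ?_
  obtain ⟨r, -, hr⟩ := choose_le_hil_last p
  have : p.length ≤ d := length_le_of_choose_le fun m =>
    ((hr m).trans (hil_mono_set (Subtype.coe_image_subset _ _) _)).trans (h _)
  exact_mod_cast this

end Growth

section Regular

variable {M N N' : Type} [AddCommGroup M] [Module ℂ M] [AddCommGroup N] [Module ℂ N]
  [AddCommGroup N'] [Module ℂ N']

/-- The functions that are regular on `S`: locally on `S` they are quotients of polynomial
functions. -/
def regFuns (S : Set M) : Subalgebra ℂ (M → ℂ) where
  carrier := {g | ∀ x ∈ S, ∃ f ∈ polyFuns M, ∃ p ∈ polyFuns M,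
    f x ≠ 0 ∧ ∀ y ∈ S, f y * g y = p y}
  mul_mem' := by
    intro g g' hg hg' x hx
    obtain ⟨f, hf, p, hp, hfx, h⟩ := hg x hx
    obtain ⟨f', hf', p', hp', hfx', h'⟩ := hg' x hx
    refine ⟨f * f', (polyFuns M).mul_mem hf hf', p * p', (polyFuns M).mul_mem hp hp',
      mul_ne_zero hfx hfx', fun y hy => ?_⟩
    simp only [Pi.mul_apply, ← h y hy, ← h' y hy]
    ring
  add_mem' := by
    intro g g' hg hg' x hx
    obtain ⟨f, hf, p, hp, hfx, h⟩ := hg x hx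
    obtain ⟨f', hf', p', hp', hfx', h'⟩ := hg' x hx
    refine ⟨f * f', (polyFuns M).mul_mem hf hf', p * f' + f * p', (polyFuns M).add_mem
      ((polyFuns M).mul_mem hp hf') ((polyFuns M).mul_mem hf hp'),
      mul_ne_zero hfx hfx', fun y hy => ?_⟩
    simp only [Pi.mul_apply, Pi.add_apply, ← h y hy, ← h' y hy]
    ring
  algebraMap_mem' := fun c x _ => ⟨1, (polyFuns M).one_mem, _, (polyFuns M).algebraMap_mem c,
    one_ne_zero, fun y _ => by simp⟩

theorem polyFuns_le_regFuns (S : Set M) : polyFuns M ≤ regFuns S := fun g hg _ _ =>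
  ⟨1, (polyFuns M).one_mem, g, hg, one_ne_zero, fun y _ => by simp⟩

theorem regFuns_congr {S : Set M} {g g' : M → ℂ} (hg : g ∈ regFuns S) (h : ∀ x ∈ S, g x = g' x) :
    g' ∈ regFuns S := by
  intro x hx
  obtain ⟨f, hf, p, hp, hfx, h'⟩ := hg x hx
  exact ⟨f, hf, p, hp, hfx, fun y hy => h y hy ▸ h' y hy⟩

theorem regFuns_anti {S T : Set M} (h : S ⊆ T) : regFuns T ≤ regFuns S := by
  intro g hg x hx
  obtain ⟨f, hf, p, hp, hfx, h'⟩ := hg x (h hx)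
  exact ⟨f, hf, p, hp, hfx, fun y hy => h' y (h hy)⟩

theorem regFuns_inv {S : Set M} {g : M → ℂ} (hg : g ∈ regFuns S) (h0 : ∀ x ∈ S, g x ≠ 0) :
    (fun x => (g x)⁻¹) ∈ regFuns S := by
  intro x hx
  obtain ⟨f, hf, p, hp, hfx, h⟩ := hg x hx
  refine ⟨p, hp, f, hf, ?_, fun y hy => ?_⟩
  · rw [← h x hx]
    exact mul_ne_zero hfx (h0 x hx)
  · rw [← h y hy, mul_assoc, mul_inv_cancel₀ (h0 y hy), mul_one]

/-- A function that is regular near every point of `S` is regular on `S`. -/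
theorem regFuns_of_local {S : Set M} {g : M → ℂ}
    (h : ∀ x ∈ S, ∃ f ∈ regFuns S, f x ≠ 0 ∧ ∃ p ∈ regFuns S, ∀ y ∈ S, f y * g y = p y) :
    g ∈ regFuns S := by
  intro x hx
  obtain ⟨f, hf, hfx, p, hp, hfp⟩ := h x hx
  obtain ⟨u, hu, v, hv, hux, huv⟩ := hf x hx
  obtain ⟨w, hw, z, hz, hwx, hwz⟩ := hp x hx
  refine ⟨v * w, (polyFuns M).mul_mem hv hw, u * z, (polyFuns M).mul_mem hu hz, ?_, fun y hy => ?_⟩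
  · rw [Pi.mul_apply, ← huv x hx]
    exact mul_ne_zero (mul_ne_zero hux hfx) hwx
  · simp only [Pi.mul_apply, ← huv y hy, ← hwz y hy, ← hfp y hy]
    ring

/-- Regularity on `S` can be checked on a covering of `S` by relatively open subsets. -/
theorem regFuns_of_open {S : Set M} {g : M → ℂ}
    (h : ∀ x ∈ S, ∃ f ∈ regFuns S, f x ≠ 0 ∧ g ∈ regFuns {y | y ∈ S ∧ f y ≠ 0}) :
    g ∈ regFuns S := by
  intro x hx
  obtain ⟨f, hf, hfx, hg⟩ := h x hx
  obtain ⟨w, hw, z, hz, hwx, hwz⟩ := hf x hx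
  obtain ⟨u, hu, v, hv, hux, huv⟩ := hg x ⟨hx, hfx⟩
  refine ⟨u * z, (polyFuns M).mul_mem hu hz, v * z, (polyFuns M).mul_mem hv hz, ?_, fun y hy => ?_⟩
  · rw [Pi.mul_apply, ← hwz x hx]
    exact mul_ne_zero hux (mul_ne_zero hwx hfx)
  · by_cases hfy : f y = 0
    · simp [← hwz y hy, hfy]
    · simp only [Pi.mul_apply, ← huv y ⟨hy, hfy⟩]
      ring

/-- For a function regular on `S`, the locus in `S` where it does not vanish is open. -/
theorem exists_poly_of_regFuns {S : Set M} {g : M → ℂ} (hg : g ∈ regFuns S) {x : M} (hx : x ∈ S)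
    (h0 : g x ≠ 0) : ∃ P ∈ polyFuns M, P x ≠ 0 ∧ ∀ y ∈ S, P y ≠ 0 → g y ≠ 0 := by
  obtain ⟨f, hf, p, hp, hfx, h⟩ := hg x hx
  refine ⟨p, hp, ?_, fun y hy hpy hgy => ?_⟩
  · rw [← h x hx]
    exact mul_ne_zero hfx h0
  · rw [← h y hy, hgy, mul_zero] at hpy
    exact hpy rfl

/-- Maps between vector spaces whose coordinates are regular on `S`. -/
def RegMap (S : Set M) (φ : M → N) : Prop := ∀ l : Module.Dual ℂ N, (fun x => l (φ x)) ∈ regFuns S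

namespace RegMap

variable {S : Set M} {φ ψ : M → N}

theorem congr (h : RegMap S φ) (h' : ∀ x ∈ S, φ x = ψ x) : RegMap S ψ := fun l =>
  regFuns_congr (h l) fun x hx => by rw [h' x hx]

theorem anti {T : Set M} (h : RegMap T φ) (h' : S ⊆ T) : RegMap S φ := fun l =>
  regFuns_anti h' (h l)

theorem lin (S : Set M) (L : M →ₗ[ℂ] N) : RegMap S L := fun l =>
  polyFuns_le_regFuns S (dual_mem_polyFuns (l ∘ₗ L))

theorem id (S : Set M) : RegMap S fun x => x := lin S LinearMap.id

theorem const (S : Set M) (n : N) : RegMap S fun _ => n := fun l =>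
  (regFuns S).algebraMap_mem (l n)

theorem add (h : RegMap S φ) (h' : RegMap S ψ) : RegMap S fun x => φ x + ψ x := fun l =>
  regFuns_congr ((regFuns S).add_mem (h l) (h' l)) fun _ _ => (map_add l _ _).symm

theorem comp_lin (h : RegMap S φ) (L : N →ₗ[ℂ] N') : RegMap S fun x => L (φ x) := fun l =>
  h (l ∘ₗ L)

theorem neg (h : RegMap S φ) : RegMap S fun x => -φ x := h.comp_lin (-LinearMap.id)

theorem sub (h : RegMap S φ) (h' : RegMap S ψ) : RegMap S fun x => φ x - ψ x := by
  simpa only [sub_eq_add_neg] using h.add h'.neg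

theorem zsmul (h : RegMap S φ) (n : ℤ) : RegMap S fun x => n • φ x :=
  h.comp_lin (n • LinearMap.id)

theorem sum {J : Type*} {s : Finset J} {φ : J → M → N} (h : ∀ j ∈ s, RegMap S (φ j)) :
    RegMap S fun x => ∑ j ∈ s, φ j x := fun l => by
  have : (fun x => l (∑ j ∈ s, φ j x)) = ∑ j ∈ s, fun x => l (φ j x) := by
    ext x
    simp
  rw [this]
  exact (regFuns S).sum_mem fun j hj => h j hj l

theorem prodMk {χ : M → N'} (h : RegMap S φ) (h' : RegMap S χ) : RegMap S fun x => (φ x, χ x) := by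
  refine ((h.comp_lin (LinearMap.inl ℂ N N')).add (h'.comp_lin (LinearMap.inr ℂ N N'))).congr ?_
  simp

theorem fst {φ : M → N × N'} (h : RegMap S φ) : RegMap S fun x => (φ x).1 :=
  h.comp_lin (LinearMap.fst ℂ N N')

theorem snd {φ : M → N × N'} (h : RegMap S φ) : RegMap S fun x => (φ x).2 :=
  h.comp_lin (LinearMap.snd ℂ N N')

theorem pi {J : Type} [Fintype J] {N : J → Type} [∀ j, AddCommGroup (N j)] [∀ j, Module ℂ (N j)]
    {φ : M → ∀ j, N j} (h : ∀ j, RegMap S fun x => φ x j) : RegMap S φ := by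
  refine (RegMap.sum (s := Finset.univ) fun j _ => (h j).comp_lin (LinearMap.single ℂ N j)).congr ?_
  intro x _
  exact LinearMap.sum_single_apply _ _

theorem apply {J : Type} {N : J → Type} [∀ j, AddCommGroup (N j)] [∀ j, Module ℂ (N j)]
    {φ : M → ∀ j, N j} (h : RegMap S φ) (j : J) : RegMap S fun x => φ x j :=
  h.comp_lin (LinearMap.proj j)

theorem bilin [FiniteDimensional ℂ N] {N'' : Type} [AddCommGroup N''] [Module ℂ N'']
    {χ : M → N'} (h : RegMap S φ) (h' : RegMap S χ) (B : N →ₗ[ℂ] N' →ₗ[ℂ] N'') :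
    RegMap S fun x => B (φ x) (χ x) := fun l => by
  let b := Module.finBasis ℂ N
  have : (fun x => l (B (φ x) (χ x))) =
      ∑ i, (fun x => b.coord i (φ x)) * fun x => (l ∘ₗ B (b i)) (χ x) := by
    ext x
    conv_lhs => rw [← b.sum_repr (φ x)]
    simp only [map_sum, map_smul, LinearMap.sum_apply, LinearMap.smul_apply, smul_eq_mul]
    simp
  rw [this]
  exact (regFuns S).sum_mem fun i _ => (regFuns S).mul_mem (h _) (h' _)

theorem smul {g : M → ℂ} (hg : g ∈ regFuns S) (h : RegMap S φ) : RegMap S fun x => g x • φ x :=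
  fun l => by
    have : (fun x => l (g x • φ x)) = g * fun x => l (φ x) := by
      ext x
      simp
    rw [this]
    exact (regFuns S).mul_mem hg (h l)

theorem comp_poly (h : RegMap S φ) {P : N → ℂ} (hP : P ∈ polyFuns N) :
    (fun x => P (φ x)) ∈ regFuns S := by
  induction hP using Algebra.adjoin_induction with
  | mem _ hx =>
    obtain ⟨l, rfl⟩ := hx
    exact h l
  | algebraMap r => exact (regFuns S).algebraMap_mem r
  | add _ _ _ _ h1 h2 => exact (regFuns S).add_mem h1 h2
  | mul _ _ _ _ h1 h2 => exact (regFuns S).mul_mem h1 h2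

theorem comp_regFuns (h : RegMap S φ) {T : Set N} (hST : Set.MapsTo φ S T) {g : N → ℂ}
    (hg : g ∈ regFuns T) : (fun x => g (φ x)) ∈ regFuns S := by
  refine regFuns_of_local fun x hx => ?_
  obtain ⟨f, hf, p, hp, hfx, h'⟩ := hg (φ x) (hST hx)
  exact ⟨_, h.comp_poly hf, hfx, _, h.comp_poly hp, fun y hy => h' _ (hST hy)⟩

theorem comp {T : Set N} {χ : N → N'} (h' : RegMap T χ) (h : RegMap S φ) (hST : Set.MapsTo φ S T) :
    RegMap S fun x => χ (φ x) := fun l => h.comp_regFuns hST (h' l)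

theorem of_open (h : ∀ x ∈ S, ∃ f ∈ regFuns S, f x ≠ 0 ∧ RegMap {y | y ∈ S ∧ f y ≠ 0} φ) :
    RegMap S φ := fun l => regFuns_of_open fun x hx => by
  obtain ⟨f, hf, hfx, h'⟩ := h x hx
  exact ⟨f, hf, hfx, h' l⟩

/-- Composition of linear maps depending regularly on a parameter. -/
theorem lcomp {A B C : Type} [AddCommGroup A] [Module ℂ A] [AddCommGroup B] [Module ℂ B]
    [AddCommGroup C] [Module ℂ C] [FiniteDimensional ℂ A] [FiniteDimensional ℂ B]
    [FiniteDimensional ℂ C]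
    {f : M → B →ₗ[ℂ] C} {g : M → A →ₗ[ℂ] B} (hf : RegMap S f) (hg : RegMap S g) :
    RegMap S fun x => f x ∘ₗ g x :=
  hf.bilin hg (LinearMap.llcomp ℂ A B C)

theorem lapply {A B : Type} [AddCommGroup A] [Module ℂ A] [AddCommGroup B] [Module ℂ B]
    [FiniteDimensional ℂ A] [FiniteDimensional ℂ B]
    {f : M → A →ₗ[ℂ] B} {g : M → A} (hf : RegMap S f) (hg : RegMap S g) :
    RegMap S fun x => f x (g x) :=
  hf.bilin hg LinearMap.id

theorem det {A : Type} [AddCommGroup A] [Module ℂ A] [FiniteDimensional ℂ A]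
    {f : M → Module.End ℂ A} (hf : RegMap S f) : (fun x => LinearMap.det (f x)) ∈ regFuns S := by
  let b := Module.finBasis ℂ A
  have : (fun x => LinearMap.det (f x)) =
      ∑ σ : Equiv.Perm (Fin (Module.finrank ℂ A)), algebraMap ℂ (M → ℂ) (Equiv.Perm.sign σ : ℤ) *
        ∏ i, fun x => (LinearMap.toMatrix b b (f x)) (σ i) i := by
    ext x
    rw [← LinearMap.det_toMatrix b, Matrix.det_apply']
    simp
  rw [this]
  refine (regFuns S).sum_mem fun σ _ => (regFuns S).mul_mem ((regFuns S).algebraMap_mem _) ?_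
  exact (regFuns S).prod_mem fun i _ =>
    hf ((LinearMap.proj i ∘ₗ LinearMap.proj (σ i)) ∘ₗ (LinearMap.toMatrix b b).toLinearMap)

/-- If `B x` is a left inverse of a regular family of endomorphisms, then `B` is regular. -/
theorem of_mul_eq_one {A : Type} [AddCommGroup A] [Module ℂ A] [FiniteDimensional ℂ A]
    {f g : M → Module.End ℂ A} (hf : RegMap S f) (hgf : ∀ x ∈ S, g x * f x = 1) : RegMap S g := by
  let b := Module.finBasis ℂ A
  let F (x : M) := LinearMap.toMatrixAlgEquiv b (f x)
  have hinv : ∀ x ∈ S, g x = (LinearMap.toMatrixAlgEquiv b).symm ((F x).det⁻¹ • (F x).adjugate) := by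
    intro x hx
    rw [AlgEquiv.eq_symm_apply]
    have h1 : LinearMap.toMatrixAlgEquiv b (g x) * F x = 1 := by
      rw [← map_mul, hgf x hx, map_one]
    have h2 : IsUnit (F x).det := Matrix.isUnit_det_of_left_inverse h1
    have h3 := Matrix.inv_eq_left_inv h1
    rw [← h3, Matrix.inv_def, Ring.inverse_eq_inv']
  have hdet : (fun x => (F x).det) ∈ regFuns S := by
    convert hf.det using 2 with x
    exact LinearMap.det_toMatrix b _
  have hdet0 : ∀ x ∈ S, (F x).det ≠ 0 := by
    intro x hx
    have h1 : LinearMap.toMatrixAlgEquiv b (g x) * F x = 1 := by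
      rw [← map_mul, hgf x hx, map_one]
    exact (Matrix.isUnit_det_of_left_inverse h1).ne_zero
  have hadj : RegMap S fun x => (F x).adjugate := by
    refine RegMap.pi fun i => RegMap.pi fun j => ?_
    intro l
    have : (fun x => l ((F x).adjugate i j)) = algebraMap ℂ (M → ℂ) (l 1) *
        fun x => ((F x).updateRow j (Pi.single i 1)).det := by
      ext x
      simp [Matrix.adjugate_apply]
    rw [this]
    refine (regFuns S).mul_mem ((regFuns S).algebraMap_mem _) ?_
    have hrow : RegMap S fun x => Matrix.toLin b b ((F x).updateRow j (Pi.single i 1)) := by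
      refine RegMap.comp_lin (N := Matrix _ _ ℂ) ?_ (Matrix.toLin b b).toLinearMap
      refine RegMap.pi fun a => ?_
      by_cases ha : a = j
      · subst ha
        simpa using RegMap.const S _
      · simp only [Matrix.updateRow_ne ha]
        exact (hf.comp_lin (LinearMap.toMatrix b b).toLinearMap).apply a
    convert hrow.det using 2 with x
    rw [← LinearMap.det_toMatrix b, LinearMap.toMatrix_toLin]
  refine RegMap.congr ?_ fun x hx => (hinv x hx).symm
  exact (RegMap.smul (regFuns_inv hdet hdet0) hadj).comp_lin
    (N := Matrix _ _ ℂ) (LinearMap.toMatrixAlgEquiv b).symm.toLinearMap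

end RegMap

end Regular

section GoodSets

variable {M N : Type} [AddCommGroup M] [Module ℂ M] [AddCommGroup N] [Module ℂ N]
  [FiniteDimensional ℂ M] [FiniteDimensional ℂ N]

/-- The space of polynomial functions of degree at most `k` on `S` grows at most like `k ^ d`. -/
def HasGrowth (S : Set M) (d : ℕ) : Prop := ∃ C, ∀ k, hil S k ≤ C * (k + 1) ^ d

theorem HasGrowth.mono {S T : Set M} {d : ℕ} (h : HasGrowth T d) (hST : S ⊆ T) : HasGrowth S d := by
  obtain ⟨C, hC⟩ := h
  exact ⟨C, fun k => (hil_mono_set hST k).trans (hC k)⟩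

theorem HasGrowth.iUnion {J : Type*} [Finite J] {S : J → Set M} {d : ℕ}
    (h : ∀ j, HasGrowth (S j) d) : HasGrowth (⋃ j, S j) d := by
  have := Fintype.ofFinite J
  choose C hC using h
  refine ⟨∑ j, C j, fun k => (hil_iUnion_le S k).trans ?_⟩
  rw [Finset.sum_mul]
  exact Finset.sum_le_sum fun j _ => hC j k

theorem exists_finset_cover {S : Set M} {F : S → M → ℂ} (hF : ∀ x, F x ∈ polyFuns M)
    (hF0 : ∀ x, F x x ≠ 0) : ∃ t : Finset S, ∀ y ∈ S, ∃ x ∈ t, F x y ≠ 0 := by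
  let _ := subTop S
  have : NoetherianSpace S := noetherianSpace_subTop S
  have hU : ∀ x, {y : S | F x y ≠ 0} ∈ 𝓝 x := fun x =>
    (isOpen_subTop_iff.2 ⟨_, isOpen_zariski (hF x), rfl⟩).mem_nhds (hF0 x)
  obtain ⟨t, ht⟩ := CompactSpace.elim_nhds_subcover _ hU
  refine ⟨t, fun y hy => ?_⟩
  have : (⟨y, hy⟩ : S) ∈ ⋃ x ∈ t, {y : S | F x y ≠ 0} := ht ▸ trivial
  simpa using this

omit [FiniteDimensional ℂ M] in
theorem exists_common_denominator {S : Set M} {x : M} (hx : x ∈ S) (s : Finset (M → ℂ))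
    (hs : ∀ g ∈ s, g ∈ regFuns S) : ∃ f ∈ polyFuns M, f x ≠ 0 ∧ ∃ r, ∀ g ∈ s,
      ∃ p ∈ affFuns M ^ r, ∀ y ∈ S, f y * g y = p y := by
  induction s using Finset.induction_on with
  | empty => exact ⟨1, (polyFuns M).one_mem, one_ne_zero, 0, by simp⟩
  | insert g s hg ih =>
    obtain ⟨f, hf, hfx, r, hr⟩ := ih fun g hg => hs g (Finset.mem_insert_of_mem hg)
    obtain ⟨f', hf', p', hp', hfx', h'⟩ := hs g (Finset.mem_insert_self _ _) x hx
    obtain ⟨a, ha⟩ := exists_mem_affFuns_pow hf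
    obtain ⟨b, hb⟩ := exists_mem_affFuns_pow hf'
    obtain ⟨c, hc⟩ := exists_mem_affFuns_pow hp'
    refine ⟨f * f', (polyFuns M).mul_mem hf hf', mul_ne_zero hfx hfx', r + a + b + c, ?_⟩
    intro g' hg'
    rcases Finset.mem_insert.1 hg' with rfl | hg'
    · refine ⟨f * p', affFuns_pow_mono (k := a + c) (by omega) ?_, fun y hy => ?_⟩
      · rw [pow_add]
        exact Submodule.mul_mem_mul ha hc
      · simp only [Pi.mul_apply, ← h' y hy]
        ring
    · obtain ⟨p, hp, h⟩ := hr g' hg'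
      refine ⟨p * f', affFuns_pow_mono (k := r + b) (by omega) ?_, fun y hy => ?_⟩
      · rw [pow_add]
        exact Submodule.mul_mem_mul hp hb
      · simp only [Pi.mul_apply, ← h y hy]
        ring

omit [FiniteDimensional ℂ M] in
theorem exists_denominator {S : Set M} {φ : M → N} (hφ : RegMap S φ) {x : M} (hx : x ∈ S) :
    ∃ f ∈ polyFuns M, f x ≠ 0 ∧ ∃ r, ∀ k, ∀ g ∈ affFuns N ^ k,
      ∃ p ∈ affFuns M ^ (r * k), ∀ y ∈ S, f y ^ k * g (φ y) = p y := by
  obtain ⟨s, hs⟩ := Module.Finite.iff_fg.1 (finiteDimensional_affFuns (M := N))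
  obtain ⟨f, hf, hfx, r, hr⟩ := exists_common_denominator hx (s.image fun g y => g (φ y)) <| by
    intro g hg
    obtain ⟨g, hgs, rfl⟩ := Finset.mem_image.1 hg
    exact hφ.comp_poly (affFuns_le_polyFuns (hs ▸ Submodule.subset_span hgs))
  have h1 : ∀ g ∈ affFuns N, ∃ p ∈ affFuns M ^ r, ∀ y ∈ S, f y * g (φ y) = p y := by
    intro g hg
    rw [← hs] at hg
    induction hg using Submodule.span_induction with
    | mem g hg => exact hr _ (Finset.mem_image_of_mem _ hg)
    | zero => exact ⟨0, zero_mem _, by simp⟩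
    | add g g' _ _ h h' =>
      obtain ⟨p, hp, h⟩ := h
      obtain ⟨p', hp', h'⟩ := h'
      exact ⟨p + p', add_mem hp hp', fun y hy => by simp [mul_add, h y hy, h' y hy]⟩
    | smul c g _ h =>
      obtain ⟨p, hp, h⟩ := h
      refine ⟨c • p, Submodule.smul_mem _ c hp, fun y hy => ?_⟩
      simp only [Pi.smul_apply, smul_eq_mul, ← h y hy]
      ring
  refine ⟨f, hf, hfx, r, fun k g hg => ?_⟩
  induction hg using Submodule.pow_induction_on_left' with
  | algebraMap c =>
    exact ⟨algebraMap ℂ (M → ℂ) c, by simp, fun y _ => by simp⟩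
  | add g g' i _ _ h h' =>
    obtain ⟨p, hp, h⟩ := h
    obtain ⟨p', hp', h'⟩ := h'
    exact ⟨p + p', add_mem hp hp', fun y hy => by simp [mul_add, h y hy, h' y hy]⟩
  | mem_mul m hm i g _ h =>
    obtain ⟨p, hp, h⟩ := h
    obtain ⟨q, hq, h'⟩ := h1 m hm
    refine ⟨q * p, ?_, fun y hy => ?_⟩
    · rw [Nat.succ_eq_add_one, mul_add, mul_one, add_comm, pow_add]
      exact Submodule.mul_mem_mul hq hp
    · simp only [Pi.mul_apply, ← h y hy, ← h' y hy, Nat.succ_eq_add_one]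
      ring

/-- Images under regular maps do not grow faster. -/
theorem HasGrowth.image {S : Set M} {d : ℕ} (hS : HasGrowth S d) {φ : M → N} (hφ : RegMap S φ) :
    HasGrowth (φ '' S) d := by
  obtain ⟨C, hC⟩ := hS
  choose f hf hfx r hr using fun x : S => exists_denominator hφ x.2
  obtain ⟨t, ht⟩ := exists_finset_cover hf hfx
  refine ⟨∑ x : t, C * (r x + 1) ^ d, fun k => ?_⟩
  let T (x : t) : (φ '' S → ℂ) →ₗ[ℂ] (S → ℂ) :=
    LinearMap.mulLeft ℂ (fun y : S => f x y ^ k) ∘ₗ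
      LinearMap.funLeft ℂ ℂ fun y : S => ⟨φ y, Set.mem_image_of_mem φ y.2⟩
  have h := finrank_le_sum_of_injective ((affFuns N ^ k).map (restr (φ '' S))) T
    (fun x => (affFuns M ^ (r x * k)).map (restr S)) ?_ ?_
  · refine h.trans ?_
    rw [Finset.sum_mul]
    refine Finset.sum_le_sum fun x _ => (hC _).trans ?_
    rw [mul_assoc, ← mul_pow]
    gcongr
    nlinarith
  · rintro x _ ⟨g, hg, rfl⟩
    obtain ⟨p, hp, h⟩ := hr x k g hg
    refine ⟨p, hp, funext fun y => (h y y.2).symm⟩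
  · rintro w - hw
    ext ⟨_, y, hy, rfl⟩
    obtain ⟨x, hx, hxy⟩ := ht y hy
    have := congrFun (hw ⟨x, hx⟩) ⟨y, hy⟩
    exact (mul_eq_zero.1 this).resolve_left (pow_ne_zero _ hxy)

omit [FiniteDimensional ℂ M] [FiniteDimensional ℂ N] in
theorem RegMap.continuous {S : Set M} {T : Set N} {φ : M → N} (hφ : RegMap S φ)
    (hST : Set.MapsTo φ S T) :
    @Continuous S T (subTop S) (subTop T) (hST.restrict φ S T) := by
  let _ := subTop S
  let _ := subTop T
  refine continuous_def.2 fun U hU => isOpen_subTop_of_forall fun x hx => ?_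
  obtain ⟨P, hP, hPx, h⟩ := exists_poly_of_isOpen_subTop hU _ hx
  obtain ⟨Q, hQ, hQx, h'⟩ := exists_poly_of_regFuns (hφ.comp_poly hP) x.2 hPx
  exact ⟨Q, hQ, hQx, fun y hy => h _ (h' y y.2 hy)⟩

/-- A set `S` is good of dimension `d` if its polynomial functions grow at most like `k ^ d`,
while every nonempty open subset meets the bottom of a chain of length `d` of irreducible closed
subsets. -/
structure Good (S : Set M) (d : ℕ) : Prop where
  growth : HasGrowth S d
  chains : @HasChains S (subTop S) d

theorem Good.of_iso {S : Set M} {T : Set N} {d : ℕ} (hS : Good S d) {φ : M → N} {ψ : N → M}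
    (hφ : RegMap S φ) (hψ : RegMap T ψ) (hST : Set.MapsTo φ S T) (hTS : Set.MapsTo ψ T S)
    (h1 : ∀ x ∈ S, ψ (φ x) = x) (h2 : ∀ y ∈ T, φ (ψ y) = y) : Good T d := by
  refine ⟨(hS.growth.image hφ).mono fun y hy => ⟨ψ y, hTS hy, h2 y hy⟩, ?_⟩
  let _ := subTop S
  let _ := subTop T
  let e : T ≃ₜ S :=
    { toFun := hTS.restrict ψ T S
      invFun := hST.restrict φ S T
      left_inv := fun y => Subtype.ext (h2 y y.2)
      right_inv := fun x => Subtype.ext (h1 x x.2)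
      continuous_toFun := hψ.continuous hTS
      continuous_invFun := hφ.continuous hST }
  exact hS.chains.of_openEmbedding e.isOpenEmbedding

omit [FiniteDimensional ℂ M] in
theorem isInducing_inclusion {S T : Set M} (h : S ⊆ T) :
    @IsInducing S T (subTop S) (subTop T) (Set.inclusion h) := by
  let _ := subTop S
  let _ := subTop T
  refine ⟨le_antisymm (continuous_iff_le_induced.1 ((RegMap.id S).continuous h)) ?_⟩
  intro U hU
  obtain ⟨V, hV, rfl⟩ := isOpen_subTop_iff.1 hU
  exact ⟨_, isOpen_subTop_iff.2 ⟨V, hV, rfl⟩, rfl⟩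

omit [FiniteDimensional ℂ M] in
theorem Good.of_cover {J : Type*} {S : Set M} {T : J → Set M} {d : ℕ} (hT : ∀ j, Good (T j) d)
    (hsub : ∀ j, T j ⊆ S) (hcov : ∀ x ∈ S, ∃ j, x ∈ T j) (hg : HasGrowth S d) : Good S d := by
  refine ⟨hg, ?_⟩
  let _ := subTop S
  let _ (j : J) : TopologicalSpace (T j) := subTop (T j)
  refine HasChains.of_inducing (fun j => (hT j).chains) (fun j => Set.inclusion (hsub j))
    (fun j => isInducing_inclusion (hsub j)) fun x => ?_
  obtain ⟨j, hj⟩ := hcov x x.2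
  exact ⟨j, ⟨x, hj⟩, rfl⟩

theorem Good.iUnion {J : Type*} [Finite J] {T : J → Set M} {d : ℕ} (hT : ∀ j, Good (T j) d) :
    Good (⋃ j, T j) d :=
  Good.of_cover hT (fun j => Set.subset_iUnion T j) (fun _ hx => Set.mem_iUnion.1 hx)
    (HasGrowth.iUnion fun j => (hT j).growth)

theorem Good.of_local {S : Set M} {d : ℕ} (h : ∀ x ∈ S, ∃ P ∈ regFuns S, P x ≠ 0 ∧
    Good {y | y ∈ S ∧ P y ≠ 0} d) : Good S d := by
  choose P hP hPx hG using fun x : S => h x x.2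
  refine Good.of_cover hG (fun _ _ => And.left) (fun x hx => ⟨⟨x, hx⟩, hx, hPx _⟩) ?_
  choose Q hQ hQx hQP using fun x : S => exists_poly_of_regFuns (hP x) x.2 (hPx x)
  obtain ⟨t, ht⟩ := exists_finset_cover hQ hQx
  refine (HasGrowth.iUnion fun x : t => (hG x).growth).mono fun y hy => ?_
  obtain ⟨x, hx, hxy⟩ := ht y hy
  exact Set.mem_iUnion.2 ⟨⟨x, hx⟩, hy, hQP x y hy hxy⟩

/-- Relatively open subsets of good sets are good. -/
theorem Good.of_isOpen {S T : Set M} {d : ℕ} (hS : Good S d) (hTS : T ⊆ S)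
    (hT : ∀ x ∈ T, ∃ P ∈ regFuns S, P x ≠ 0 ∧ ∀ y ∈ S, P y ≠ 0 → y ∈ T) : Good T d := by
  refine ⟨hS.growth.mono hTS, ?_⟩
  let _ := subTop S
  let _ := subTop T
  refine hS.chains.of_openEmbedding (f := Set.inclusion hTS)
    ⟨⟨isInducing_inclusion hTS, Set.inclusion_injective hTS⟩, ?_⟩
  refine isOpen_subTop_of_forall fun x hx => ?_
  rw [Set.range_inclusion] at hx
  obtain ⟨P, hP, hPx, h⟩ := hT x hx
  obtain ⟨Q, hQ, hQx, h'⟩ := exists_poly_of_regFuns hP x.2 hPx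
  refine ⟨Q, hQ, hQx, fun y hy => ?_⟩
  rw [Set.range_inclusion]
  exact h y y.2 (h' y y.2 hy)

theorem Good.inter {S : Set M} {d : ℕ} (hS : Good S d) {P : M → ℂ} (hP : P ∈ regFuns S) :
    Good {y | y ∈ S ∧ P y ≠ 0} d :=
  hS.of_isOpen (fun _ => And.left) fun _ hx => ⟨P, hP, hx.2, fun _ hy hPy => ⟨hy, hPy⟩⟩

omit [FiniteDimensional ℂ M] in
theorem Good.singleton (x : M) : Good {x} 0 := by
  refine ⟨⟨1, fun k => ?_⟩, ?_⟩
  · have := Submodule.finrank_le ((affFuns M ^ k).map (restr {x}))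
    simpa [hil] using this
  · let _ := subTop {x}
    exact HasChains.of_unique

theorem Good.zDim_eq {S : Set M} {d : ℕ} (hS : Good S d) (hne : S.Nonempty) : zDim S = d := by
  obtain ⟨C, hC⟩ := hS.growth
  have := hne.to_subtype
  exact le_antisymm (zDim_le_of_hil_le hC) (@HasChains.le_krullDim _ (subTop S) _ hS.chains _)

theorem Good.zDimC_eq {S : Set M} {d : ℕ} (hS : Good S d) {C : Set S} (hC : C ∈ zIrr S) :
    zDimC C = d := by
  obtain ⟨c, hc⟩ := hS.growth
  let _ := subTop S
  have : NoetherianSpace S := noetherianSpace_subTop S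
  exact le_antisymm (IsInducing.subtypeVal.topologicalKrullDim_le.trans (zDim_le_of_hil_le hc))
    (hS.chains.le_krullDim_component hC)


/-- Pullback of functions as an algebra homomorphism. -/
def precompAlg {X Y : Type*} (f : X → Y) : (Y → ℂ) →ₐ[ℂ] (X → ℂ) where
  toFun g := g ∘ f
  map_one' := rfl
  map_mul' _ _ := rfl
  map_zero' := rfl
  map_add' _ _ := rfl
  commutes' _ := rfl

omit [FiniteDimensional ℂ M] [FiniteDimensional ℂ N] in
theorem affFuns_prod_le : affFuns (M × N) ≤ (affFuns M).map (precompAlg Prod.fst).toLinearMap *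
    (affFuns N).map (precompAlg Prod.snd).toLinearMap := by
  have h1 : (1 : M × N → ℂ) ∈ (affFuns M).map (precompAlg (Prod.fst : M × N → M)).toLinearMap :=
    ⟨1, Submodule.one_le.1 one_le_affFuns, rfl⟩
  have h2 : (1 : M × N → ℂ) ∈ (affFuns N).map (precompAlg (Prod.snd : M × N → N)).toLinearMap :=
    ⟨1, Submodule.one_le.1 one_le_affFuns, rfl⟩
  refine sup_le (Submodule.one_le.2 ?_) ?_
  · simpa using Submodule.mul_mem_mul h1 h2
  · rintro _ ⟨l, rfl⟩
    have h3 := Submodule.mul_mem_mul (Submodule.mem_map_of_mem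
      (f := (precompAlg (Prod.fst : M × N → M)).toLinearMap)
      (dual_mem_affFuns (l ∘ₗ LinearMap.inl ℂ M N))) h2
    have h4 := Submodule.mul_mem_mul h1 (Submodule.mem_map_of_mem
      (f := (precompAlg (Prod.snd : M × N → N)).toLinearMap)
      (dual_mem_affFuns (l ∘ₗ LinearMap.inr ℂ M N)))
    convert add_mem h3 h4 using 1
    ext ⟨m, n⟩
    change l (m, n) = l (m, 0) * 1 + 1 * l (0, n)
    rw [mul_one, one_mul, ← map_add]
    simp

theorem finrank_mul_le_mul {A : Type*} [CommRing A] [Algebra ℂ A] (P Q : Submodule ℂ A)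
    [FiniteDimensional ℂ P] [FiniteDimensional ℂ Q] :
    Module.finrank ℂ (P * Q :) ≤ Module.finrank ℂ P * Module.finrank ℂ Q := by
  rw [← Submodule.mulMap_range, ← Module.finrank_tensorProduct (R := ℂ) (S := ℂ)]
  exact LinearMap.finrank_range_le _

theorem hil_prod_le (S : Set M) (T : Set N) (k : ℕ) : hil (S ×ˢ T) k ≤ hil S k * hil T k := by
  let a : (S → ℂ) →ₐ[ℂ] ((S ×ˢ T : Set (M × N)) → ℂ) := precompAlg fun x => ⟨x.1.1, x.2.1⟩
  let b : (T → ℂ) →ₐ[ℂ] ((S ×ˢ T : Set (M × N)) → ℂ) := precompAlg fun x => ⟨x.1.2, x.2.2⟩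
  let P := ((affFuns M ^ k).map (restr S)).map a.toLinearMap
  let Q := ((affFuns N ^ k).map (restr T)).map b.toLinearMap
  have hPQ : (affFuns (M × N) ^ k).map (restr (S ×ˢ T)) ≤ P * Q := by
    refine (Submodule.map_mono (pow_le_pow_left' affFuns_prod_le k)).trans ?_
    rw [mul_pow, ← Submodule.map_pow, ← Submodule.map_pow]
    change Submodule.map (precompAlg (Subtype.val : (S ×ˢ T : Set (M × N)) → M × N)).toLinearMap _ ≤ _
    rw [Submodule.map_mul, ← Submodule.map_comp, ← Submodule.map_comp]
    refine le_of_eq (congrArg₂ _ ?_ ?_)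
    · exact Submodule.map_comp (restr S) a.toLinearMap (affFuns M ^ k)
    · exact Submodule.map_comp (restr T) b.toLinearMap (affFuns N ^ k)
  have : FiniteDimensional ℂ (P * Q :) := Module.Finite.iff_fg.2
    (Submodule.FG.mul (Module.Finite.iff_fg.1 inferInstance) (Module.Finite.iff_fg.1 inferInstance))
  refine (Submodule.finrank_mono hPQ).trans ((finrank_mul_le_mul P Q).trans ?_)
  exact Nat.mul_le_mul (Submodule.finrank_map_le _ _) (Submodule.finrank_map_le _ _)

theorem Good.prod {S : Set M} {T : Set N} {d e : ℕ} (hS : Good S d) (hT : Good T e) :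
    Good (S ×ˢ T) (d + e) := by
  constructor
  · obtain ⟨C, hC⟩ := hS.growth
    obtain ⟨C', hC'⟩ := hT.growth
    refine ⟨C * C', fun k => (hil_prod_le S T k).trans ?_⟩
    refine (Nat.mul_le_mul (hC k) (hC' k)).trans_eq ?_
    ring
  · let _ := subTop S
    let _ := subTop T
    let _ := subTop (S ×ˢ T)
    refine HasChains.prod (X := S) (Y := T) (P := (S ×ˢ T : Set (M × N))) hS.chains hT.chains
      (fst := fun x => ⟨x.1.1, x.2.1⟩) (snd := fun x => ⟨x.1.2, x.2.2⟩)
      (mk := fun x y => ⟨(x, y), x.2, y.2⟩) ?_ ?_ (fun _ _ => rfl) (fun _ _ => rfl)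
      (fun _ => rfl) ?_ ?_
    · exact (RegMap.id (S ×ˢ T)).fst.continuous (T := S) fun x hx => hx.1
    · exact (RegMap.id (S ×ˢ T)).snd.continuous (T := T) fun x hx => hx.2
    · intro y
      exact ((RegMap.id S).prodMk (RegMap.const S y.1)).continuous (T := S ×ˢ T)
        fun x hx => ⟨hx, y.2⟩
    · intro x
      exact ((RegMap.const T x.1).prodMk (RegMap.id T)).continuous (T := S ×ˢ T)
        fun y hy => ⟨x.2, hy⟩

theorem Good.image_equiv {S : Set M} {d : ℕ} (hS : Good S d) (e : M ≃ₗ[ℂ] N) :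
    Good (e '' S) d :=
  hS.of_iso (RegMap.lin S e.toLinearMap) (RegMap.lin _ e.symm.toLinearMap)
    (Set.mapsTo_image _ _) (by rintro _ ⟨x, hx, rfl⟩; simpa using hx) (by simp) (by simp)

end GoodSets

theorem isIrreducible_univ_complex : @IsIrreducible ℂ (zariski ℂ) Set.univ := by
  let _ := zariski ℂ
  refine ⟨Set.univ_nonempty, ?_⟩
  have key : ∀ P ∈ polyFuns ℂ, ∃ p : Polynomial ℂ, ∀ x, P x = p.eval x := by
    intro P hP
    induction hP using Algebra.adjoin_induction with
    | mem _ hx =>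
      obtain ⟨l, rfl⟩ := hx
      refine ⟨Polynomial.C (l 1) * Polynomial.X, fun x => ?_⟩
      have := l.map_smul x 1
      rw [smul_eq_mul, smul_eq_mul, mul_one] at this
      change l x = _
      rw [this, Polynomial.eval_mul, Polynomial.eval_C, Polynomial.eval_X, mul_comm]
    | algebraMap r => exact ⟨Polynomial.C r, by simp⟩
    | add _ _ _ _ h1 h2 =>
      obtain ⟨p, hp⟩ := h1
      obtain ⟨q, hq⟩ := h2
      exact ⟨p + q, by simp [hp, hq]⟩
    | mul _ _ _ _ h1 h2 =>
      obtain ⟨p, hp⟩ := h1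
      obtain ⟨q, hq⟩ := h2
      exact ⟨p * q, by simp [hp, hq]⟩
  rintro u v hu hv ⟨x, -, hx⟩ ⟨y, -, hy⟩
  obtain ⟨P, hP, hPx, hPu⟩ := exists_poly_of_isOpen hu x hx
  obtain ⟨Q, hQ, hQy, hQv⟩ := exists_poly_of_isOpen hv y hy
  obtain ⟨p, hp⟩ := key P hP
  obtain ⟨q, hq⟩ := key Q hQ
  have h0 : p * q ≠ 0 := by
    refine mul_ne_zero ?_ ?_
    · rintro rfl
      simp [hp] at hPx
    · rintro rfl
      simp [hq] at hQy
  obtain ⟨z, hz⟩ := Polynomial.exists_eval_ne_zero_of_natDegree_lt_card (p * q) h0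
    (Cardinal.natCast_lt_aleph0.trans_le (Cardinal.aleph0_le_mk ℂ))
  rw [Polynomial.eval_mul, ← hp, ← hq] at hz
  exact ⟨z, trivial, hPu (left_ne_zero_of_mul hz), hQv (right_ne_zero_of_mul hz)⟩

open scoped Pointwise in
theorem good_univ_complex : Good (Set.univ : Set ℂ) 1 := by
  constructor
  · refine ⟨1, fun k => ?_⟩
    have key : ∀ k, Module.finrank ℂ (affFuns ℂ ^ k :) ≤ k + 1 := by
      intro k
      have hle : affFuns ℂ ≤ Submodule.span ℂ {1, ((LinearMap.id : ℂ →ₗ[ℂ] ℂ) : ℂ → ℂ)} := by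
        refine sup_le (Submodule.one_le.2 (Submodule.subset_span (by simp))) ?_
        rintro _ ⟨l, rfl⟩
        have : LinearMap.ltoFun ℂ ℂ ℂ ℂ l = l 1 • ((LinearMap.id : ℂ →ₗ[ℂ] ℂ) : ℂ → ℂ) := by
          ext x
          have := l.map_smul x 1
          simp only [smul_eq_mul, mul_one] at this
          simp [this, mul_comm]
        rw [this]
        exact Submodule.smul_mem _ _ (Submodule.subset_span (by simp))
      let v (i : Fin (k + 1)) : ℂ → ℂ := fun x => x ^ (i : ℕ)
      have hpow : affFuns ℂ ^ k ≤ Submodule.span ℂ (Set.range v) := by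
        refine (pow_le_pow_left' hle k).trans ?_
        rw [Submodule.span_pow, Submodule.span_le]
        have h2 : ∀ k, ∀ g ∈ ({1, ((LinearMap.id : ℂ →ₗ[ℂ] ℂ) : ℂ → ℂ)} : Set (ℂ → ℂ)) ^ k,
            ∃ j ≤ k, g = fun x => x ^ j := by
          intro k
          induction k with
          | zero =>
            intro g hg
            exact ⟨0, le_rfl, by rw [pow_zero, Set.mem_one] at hg; ext; simp [hg]⟩
          | succ k ih =>
            intro g hg
            rw [pow_succ] at hg
            obtain ⟨a, ha, b, hb, rfl⟩ := Set.mem_mul.1 hg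
            obtain ⟨j, hj, rfl⟩ := ih a ha
            rcases hb with rfl | hb
            · exact ⟨j, by omega, by ext; simp⟩
            · rw [Set.mem_singleton_iff] at hb
              exact ⟨j + 1, by omega, by ext; simp [hb, pow_succ]⟩
        intro g hg
        obtain ⟨j, hj, rfl⟩ := h2 k g hg
        exact Submodule.subset_span ⟨⟨j, by omega⟩, rfl⟩
      have : FiniteDimensional ℂ (Submodule.span ℂ (Set.range v)) :=
        FiniteDimensional.span_of_finite ℂ (Set.finite_range v)
      refine (Submodule.finrank_mono hpow).trans ((finrank_range_le_card v).trans ?_)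
      simp
    simpa [hil] using (Submodule.finrank_map_le _ _).trans (key k)
  · let _ := zariski ℂ
    let _ := subTop (Set.univ : Set ℂ)
    rintro U hU ⟨⟨u, hu'⟩, hu⟩
    have hcl : IsClosed ({⟨u, hu'⟩} : Set (Set.univ : Set ℂ)) := by
      refine ⟨isOpen_subTop_of_forall fun x hx => ?_⟩
      refine ⟨fun y => y - u, (polyFuns ℂ).sub_mem (dual_mem_polyFuns LinearMap.id)
        ((polyFuns ℂ).algebraMap_mem u), sub_ne_zero.2 fun h => hx (Subtype.ext h), ?_⟩
      rintro y hy rfl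
      simp at hy
    let A : IrreducibleCloseds (Set.univ : Set ℂ) := ⟨_, isIrreducible_singleton, hcl⟩
    have hirr : IsIrreducible (Set.univ : Set (Set.univ : Set ℂ)) := by
      have h := isIrreducible_univ_complex
      refine ⟨⟨⟨u, hu'⟩, trivial⟩, ?_⟩
      intro a b ha hb ⟨x, _, hx⟩ ⟨y, _, hy⟩
      obtain ⟨V, hV, rfl⟩ := isOpen_subTop_iff.1 ha
      obtain ⟨W, hW, rfl⟩ := isOpen_subTop_iff.1 hb
      obtain ⟨z, -, hz⟩ := h.isPreirreducible V W hV hW ⟨x, trivial, hx⟩ ⟨y, trivial, hy⟩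
      exact ⟨⟨z, trivial⟩, trivial, hz⟩
    let B : IrreducibleCloseds (Set.univ : Set ℂ) := ⟨_, hirr, isClosed_univ⟩
    have hAB : A < B := by
      refine lt_of_le_of_ne (fun _ _ => trivial) fun h => ?_
      have : (⟨u + 1, trivial⟩ : (Set.univ : Set ℂ)) ∈ A := h ▸ trivial
      have h2 := congrArg Subtype.val (Set.mem_singleton_iff.1 this)
      simp at h2
    exact ⟨(RelSeries.singleton _ B).cons A hAB, rfl, ⟨u, hu'⟩, rfl, hu⟩

theorem good_univ_pi (n : ℕ) : Good (Set.univ : Set (Fin n → ℂ)) n := by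
  induction n with
  | zero =>
    rw [Set.eq_singleton_iff_unique_mem (a := (0 : Fin 0 → ℂ)) |>.2
      ⟨Set.mem_univ _, fun x _ => Subsingleton.elim _ _⟩]
    exact Good.singleton _
  | succ n ih =>
    have := (good_univ_complex.prod ih).image_equiv (Fin.consLinearEquiv ℂ fun _ => ℂ)
    rw [add_comm 1 n] at this
    simpa using this

theorem good_univ (M : Type) [AddCommGroup M] [Module ℂ M] [FiniteDimensional ℂ M] :
    Good (Set.univ : Set M) (Module.finrank ℂ M) := by
  simpa using (good_univ_pi (Module.finrank ℂ M)).image_equiv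
    (LinearEquiv.ofFinrankEq (Fin (Module.finrank ℂ M) → ℂ) M (by simp))

theorem good_submodule {M : Type} [AddCommGroup M] [Module ℂ M] [FiniteDimensional ℂ M]
    (W : Submodule ℂ M) : Good (W : Set M) (Module.finrank ℂ W) := by
  obtain ⟨π, hπ⟩ := W.subtype.exists_leftInverse_of_injective W.ker_subtype
  refine (good_univ W).of_iso (RegMap.lin _ W.subtype) (RegMap.lin _ π) (fun x _ => x.2)
    (fun _ _ => trivial) (fun x _ => LinearMap.congr_fun hπ x) fun y hy => ?_
  exact congrArg Subtype.val (LinearMap.congr_fun hπ ⟨y, hy⟩)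

section KernelBundle

variable {M E F : Type} [AddCommGroup M] [Module ℂ M] [AddCommGroup E] [Module ℂ E]
  [AddCommGroup F] [Module ℂ F] [FiniteDimensional ℂ M] [FiniteDimensional ℂ E]
  [FiniteDimensional ℂ F]

/-- The kernel of a regular family of surjective linear maps is a vector bundle. -/
theorem Good.kernel {B : Set M} {d d' : ℕ} (hB : Good B d) {T : M → E →ₗ[ℂ] F} (hT : RegMap B T)
    (hsurj : ∀ b ∈ B, Function.Surjective (T b))
    (hd : d' + Module.finrank ℂ F = d + Module.finrank ℂ E) :
    Good {x : M × E | x.1 ∈ B ∧ T x.1 x.2 = 0} d' := by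
  refine Good.of_local ?_
  rintro ⟨b₀, e₀⟩ ⟨hb₀, -⟩
  obtain ⟨σ, hσ⟩ := (T b₀).exists_rightInverse_of_surjective (LinearMap.range_eq_top.2 (hsurj b₀ hb₀))
  let g (b : M) : Module.End ℂ F := T b ∘ₗ σ
  have hg : RegMap B g := hT.lcomp (RegMap.const B σ)
  let G (b : M) : Module.End ℂ F := Ring.inverse (g b)
  let B' : Set M := {b | b ∈ B ∧ LinearMap.det (g b) ≠ 0}
  have hB'B : B' ⊆ B := fun _ => And.left
  have hunit : ∀ b ∈ B', IsUnit (g b) := fun b hb =>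
    (LinearMap.isUnit_iff_isUnit_det _).2 (isUnit_iff_ne_zero.2 hb.2)
  have hG1 : ∀ b ∈ B', G b * g b = 1 := fun b hb => Ring.inverse_mul_cancel _ (hunit b hb)
  have hG2 : ∀ b ∈ B', g b * G b = 1 := fun b hb => Ring.mul_inverse_cancel _ (hunit b hb)
  have hG : RegMap B' G := RegMap.of_mul_eq_one (hg.anti hB'B) hG1
  have hgood : Good (B' ×ˢ (LinearMap.ker (T b₀) : Set E)) d' := by
    have h1 := (hB.inter hg.det).prod (good_submodule (LinearMap.ker (T b₀)))
    have h2 := (T b₀).finrank_range_add_finrank_ker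
    rw [LinearMap.range_eq_top.2 (hsurj b₀ hb₀), finrank_top] at h2
    convert h1 using 1
    omega
  let S : Set (M × E) := {x | x.1 ∈ B ∧ T x.1 x.2 = 0}
  refine ⟨fun x => LinearMap.det (g x.1), ?_, ?_, ?_⟩
  · exact (RegMap.id S).fst.comp_regFuns (fun x hx => hx.1) hg.det
  · change LinearMap.det (T b₀ ∘ₗ σ) ≠ 0
    rw [hσ]
    simp
  · have hfst : ∀ {S : Set (M × E)}, RegMap S Prod.fst := (RegMap.id _).fst
    have hsnd : ∀ {S : Set (M × E)}, RegMap S Prod.snd := (RegMap.id _).snd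
    refine hgood.of_iso (φ := fun x => (x.1, x.2 - σ (G x.1 (T x.1 x.2))))
      (ψ := fun x => (x.1, x.2 - σ (T b₀ x.2))) ?_ ?_ ?_ ?_ ?_ ?_
    · have hm : Set.MapsTo Prod.fst (B' ×ˢ (LinearMap.ker (T b₀) : Set E)) B' := fun x hx => hx.1
      exact hfst.prodMk (hsnd.sub (((hG.comp hfst hm).lapply
        (((hT.anti hB'B).comp hfst hm).lapply hsnd)).comp_lin σ))
    · exact hfst.prodMk (hsnd.sub (hsnd.comp_lin (σ ∘ₗ T b₀)))
    · rintro ⟨b, e⟩ ⟨hb, -⟩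
      refine ⟨⟨hb.1, ?_⟩, hb.2⟩
      have := LinearMap.congr_fun (hG2 b hb) (T b e)
      change T b (e - σ (G b (T b e))) = 0
      rw [map_sub, sub_eq_zero]
      exact this.symm
    · rintro ⟨b, e⟩ ⟨⟨hb, -⟩, hb'⟩
      refine ⟨⟨hb, hb'⟩, ?_⟩
      have := LinearMap.congr_fun hσ (T b₀ e)
      change T b₀ (e - σ (T b₀ e)) = 0
      rw [map_sub, sub_eq_zero]
      exact this.symm
    · rintro ⟨b, e⟩ ⟨hb, he⟩
      have h1 := LinearMap.congr_fun hσ (G b (T b e))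
      have h2 : T b₀ e = 0 := he
      simp only [LinearMap.comp_apply, LinearMap.id_apply] at h1
      simp [h1, h2]
    · rintro ⟨b, e⟩ ⟨⟨hb, he⟩, hb'⟩
      have h1 := LinearMap.congr_fun (hG1 b ⟨hb, hb'⟩) (T b₀ e)
      change G b (T b (σ (T b₀ e))) = T b₀ e at h1
      have h2 : T b e = 0 := he
      simp [h1, h2]

theorem Good.kernel_submodule {B : Set M} {d d' : ℕ} (hB : Good B d) {T : M → E →ₗ[ℂ] F}
    (hT : RegMap B T) (E₀ : Submodule ℂ E) (F₀ : Submodule ℂ F)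
    (hmaps : ∀ b ∈ B, ∀ e ∈ E₀, T b e ∈ F₀) (hsurj : ∀ b ∈ B, ∀ f ∈ F₀, ∃ e ∈ E₀, T b e = f)
    (hd : d' + Module.finrank ℂ F₀ = d + Module.finrank ℂ E₀) :
    Good {x : M × E | x.1 ∈ B ∧ x.2 ∈ E₀ ∧ T x.1 x.2 = 0} d' := by
  obtain ⟨π, hπ⟩ := F₀.subtype.exists_leftInverse_of_injective F₀.ker_subtype
  obtain ⟨π', hπ'⟩ := E₀.subtype.exists_leftInverse_of_injective E₀.ker_subtype
  replace hπ : ∀ f : F₀, π f = f := LinearMap.congr_fun hπ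
  replace hπ' : ∀ e : E₀, π' e = e := LinearMap.congr_fun hπ'
  have key : ∀ b (hb : b ∈ B) (e : E₀), π (T b e) = ⟨T b e, hmaps b hb e e.2⟩ := fun b hb e =>
    hπ ⟨T b e, hmaps b hb e e.2⟩
  have h := hB.kernel (T := fun b => π ∘ₗ T b ∘ₗ E₀.subtype)
    ((RegMap.const B π).lcomp (hT.lcomp (RegMap.const B E₀.subtype))) ?_ hd
  · refine h.of_iso (RegMap.lin _ (LinearMap.id.prodMap E₀.subtype))
      (RegMap.lin _ (LinearMap.id.prodMap π')) ?_ ?_ ?_ ?_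
    · rintro ⟨b, e⟩ ⟨hb, he⟩
      exact ⟨hb, e.2, congrArg Subtype.val ((key b hb e).symm.trans he)⟩
    · rintro ⟨b, e⟩ ⟨hb, he, hbe⟩
      refine ⟨hb, ?_⟩
      change π (T b (π' e)) = 0
      rw [hπ' ⟨e, he⟩]
      have : T b e = 0 := hbe
      simp [this]
    · rintro ⟨b, e⟩ -
      simp [hπ']
    · rintro ⟨b, e⟩ ⟨-, he, -⟩
      simpa using congrArg Subtype.val (hπ' ⟨e, he⟩)
  · intro b hb f
    obtain ⟨e, he, hef⟩ := hsurj b hb f f.2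
    exact ⟨⟨e, he⟩, (key b hb ⟨e, he⟩).trans (Subtype.ext hef)⟩

end KernelBundle

section GradedMaps

variable {I J : Type} {V W : Type} [AddCommGroup V] [Module ℂ V]
  [AddCommGroup W] [Module ℂ W]

/-- The dimension of the piece of degree `i` of a graded space. -/
def gdim (π : I → Module.End ℂ V) (i : I) : ℕ := Module.finrank ℂ (LinearMap.range (π i))

/-- Families of linear maps `V → W`, the `j`-th one being supported on the block from degree `a j`
to degree `b j`. -/
def blockFam (π : I → Module.End ℂ V) (π' : I → Module.End ℂ W) (a b : J → I) :
    Submodule ℂ (J → V →ₗ[ℂ] W) where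
  carrier := {f | ∀ j, π' (b j) ∘ₗ f j ∘ₗ π (a j) = f j}
  add_mem' {f g} hf hg j := by
    simp [LinearMap.add_comp, LinearMap.comp_add, hf j, hg j]
  zero_mem' j := by simp
  smul_mem' c f hf j := by
    simp [LinearMap.smul_comp, LinearMap.comp_smul, hf j]

/-- Graded linear maps. -/
def gHom (π : I → Module.End ℂ V) (π' : I → Module.End ℂ W) : Submodule ℂ (V →ₗ[ℂ] W) where
  carrier := {f | ∀ i, π' i ∘ₗ f = f ∘ₗ π i}
  add_mem' {f g} hf hg j := by
    simp [LinearMap.add_comp, LinearMap.comp_add, hf j, hg j]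
  zero_mem' j := by simp
  smul_mem' c f hf j := by
    simp [LinearMap.smul_comp, LinearMap.comp_smul, hf j]

variable {π : I → Module.End ℂ V} {π' : I → Module.End ℂ W}

theorem CompleteOrthogonalIdempotents.idem_apply [Fintype I] (hπ : CompleteOrthogonalIdempotents π) (i : I)
    (v : V) : π i (π i v) = π i v := LinearMap.congr_fun (hπ.idem i) v

theorem CompleteOrthogonalIdempotents.ortho_apply [Fintype I] (hπ : CompleteOrthogonalIdempotents π) {i j : I}
    (hij : i ≠ j) (v : V) : π i (π j v) = 0 := LinearMap.congr_fun (hπ.ortho hij) v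

theorem CompleteOrthogonalIdempotents.sum_apply [Fintype I] (hπ : CompleteOrthogonalIdempotents π) (v : V) :
    ∑ i, π i v = v := by
  simpa using LinearMap.congr_fun hπ.complete v

theorem finrank_blockFam [Fintype I] [Fintype J] [FiniteDimensional ℂ V] [FiniteDimensional ℂ W] (hπ : CompleteOrthogonalIdempotents π)
    (hπ' : CompleteOrthogonalIdempotents π') (a b : J → I) :
    Module.finrank ℂ (blockFam π π' a b) = ∑ j, gdim π (a j) * gdim π' (b j) := by
  let e : blockFam π π' a b ≃ₗ[ℂ]
      ∀ j, (LinearMap.range (π (a j)) →ₗ[ℂ] LinearMap.range (π' (b j))) :=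
    { toFun := fun f j => (π' (b j)).rangeRestrict ∘ₗ f.1 j ∘ₗ (LinearMap.range (π (a j))).subtype
      map_add' := fun f g => by ext; simp
      map_smul' := fun c f => by ext; simp
      invFun := fun g => ⟨fun j => (LinearMap.range (π' (b j))).subtype ∘ₗ g j ∘ₗ
        (π (a j)).rangeRestrict, fun j => by
          ext v
          have h1 : (π (a j)).rangeRestrict (π (a j) v) = (π (a j)).rangeRestrict v :=
            Subtype.ext (hπ.idem_apply _ v)
          obtain ⟨w, hw⟩ := (g j ((π (a j)).rangeRestrict v)).2
          simp [h1, ← hw, hπ'.idem_apply]⟩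
      left_inv := fun f => by
        ext j v
        exact LinearMap.congr_fun (f.2 j) v
      right_inv := fun g => by
        ext j ⟨_, v, rfl⟩
        have h1 : (π (a j)).rangeRestrict (π (a j) v) = (π (a j)).rangeRestrict v :=
          Subtype.ext (hπ.idem_apply _ v)
        obtain ⟨w, hw⟩ := (g j ((π (a j)).rangeRestrict v)).2
        have h2 : (⟨π (a j) v, LinearMap.mem_range_self _ _⟩ : LinearMap.range (π (a j))) =
          (π (a j)).rangeRestrict v := rfl
        simp [h1, h2, ← hw, hπ'.idem_apply] }
  rw [e.finrank_eq, Module.finrank_pi_fintype]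
  simp only [Module.finrank_linearMap, gdim]

theorem finrank_gHom [Fintype I] [FiniteDimensional ℂ V] [FiniteDimensional ℂ W] (hπ : CompleteOrthogonalIdempotents π)
    (hπ' : CompleteOrthogonalIdempotents π') :
    Module.finrank ℂ (gHom π π') = ∑ i, gdim π i * gdim π' i := by
  refine Eq.trans (LinearEquiv.finrank_eq (N := blockFam π π' (fun i : I => i) fun i => i) ?_)
    (finrank_blockFam hπ hπ' (fun i => i) fun i => i)
  refine
    { toFun := fun f => ⟨fun i => π' i ∘ₗ f.1 ∘ₗ π i, fun i => ?_⟩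
      map_add' := fun f g => by ext; simp
      map_smul' := fun c f => by ext; simp
      invFun := fun g => ⟨∑ i, g.1 i, fun i => ?_⟩
      left_inv := fun f => ?_
      right_inv := fun g => ?_ }
  · ext v
    simp [hπ.idem_apply, hπ'.idem_apply]
  · ext v
    have h (j : I) := fun v => (LinearMap.congr_fun (g.2 j) v).symm
    simp only [LinearMap.comp_apply] at h
    simp only [LinearMap.comp_apply, LinearMap.sum_apply, map_sum]
    refine Finset.sum_congr rfl fun j _ => ?_
    rw [h j v, h j (π i v)]
    by_cases hij : i = j
    · subst hij
      rw [hπ.idem_apply, hπ'.idem_apply]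
    · rw [hπ'.ortho_apply hij, hπ.ortho_apply (Ne.symm hij), map_zero, map_zero]
  · ext v
    have h (j : I) := fun v => LinearMap.congr_fun (f.2 j) v
    simp only [LinearMap.comp_apply] at h
    simp only [LinearMap.sum_apply, LinearMap.comp_apply, h, hπ.idem_apply]
    rw [← map_sum, hπ.sum_apply]
  · ext i v
    have h (j : I) := fun v => (LinearMap.congr_fun (g.2 j) v).symm
    simp only [LinearMap.comp_apply] at h
    simp only [LinearMap.sum_apply, LinearMap.comp_apply, map_sum]
    rw [Finset.sum_eq_single i]
    · rw [h i v]
    · intro j _ hji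
      rw [h j, hπ.ortho_apply hji]
      simp
    · simp

theorem blockFam_apply_of_ne [Fintype I] {a b : J → I} {f : J → V →ₗ[ℂ] W}
    (hπ : CompleteOrthogonalIdempotents π) (hf : f ∈ blockFam π π' a b) {j : J} {i : I}
    (hi : a j ≠ i) (v : V) : f j (π i v) = 0 := by
  rw [← hf j]
  simp [hπ.ortho_apply hi]

theorem blockFam_apply_proj [Fintype I] {a b : J → I} {f : J → V →ₗ[ℂ] W}
    (hπ : CompleteOrthogonalIdempotents π) (hf : f ∈ blockFam π π' a b) (j : J) (v : V) :
    f j (π (a j) v) = f j v := by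
  rw [← hf j]
  simp [hπ.idem_apply]

theorem proj_blockFam_apply [Fintype I] {a b : J → I} {f : J → V →ₗ[ℂ] W}
    (hπ' : CompleteOrthogonalIdempotents π') (hf : f ∈ blockFam π π' a b) (j : J) (v : V) :
    π' (b j) (f j v) = f j v := by
  rw [← hf j]
  simp [hπ'.idem_apply]

theorem proj_blockFam_apply_of_ne [Fintype I] {a b : J → I} {f : J → V →ₗ[ℂ] W}
    (hπ' : CompleteOrthogonalIdempotents π') (hf : f ∈ blockFam π π' a b) {j : J} {i : I}
    (hi : i ≠ b j) (v : V) : π' i (f j v) = 0 := by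
  rw [← hf j]
  simp [hπ'.ortho_apply hi]

theorem gHom_apply {f : V →ₗ[ℂ] W} (hf : f ∈ gHom π π') (i : I) (v : V) :
    π' i (f v) = f (π i v) := LinearMap.congr_fun (hf i) v

theorem mem_blockFam_iff {a b : J → I} {f : J → V →ₗ[ℂ] W} :
    f ∈ blockFam π π' a b ↔ ∀ j v, π' (b j) (f j (π (a j) v)) = f j v :=
  forall_congr' fun _ => LinearMap.ext_iff

theorem mem_gHom_iff {f : V →ₗ[ℂ] W} : f ∈ gHom π π' ↔ ∀ i v, π' i (f v) = f (π i v) :=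
  forall_congr' fun _ => LinearMap.ext_iff

end GradedMaps

end ZariskiGeometry

section NilpotentFamilies

variable {H A : Type*} [Monoid A] [Zero A]

/-- All sufficiently long words in the family `x` vanish. -/
def WordNilp (x : H → A) : Prop := ∃ n : ℕ, ∀ l : List H, l.length = n → (l.map x).prod = 0

end NilpotentFamilies

section Decompositions

variable {I H : Type} {V V1 V2 : Type} [AddCommGroup V] [Module ℂ V]
  [AddCommGroup V1] [Module ℂ V1] [AddCommGroup V2] [Module ℂ V2]

/-- The data identifying `V` with the direct sum of `V1` and `V2`. -/
structure Decomp (V V1 V2 : Type) [AddCommGroup V] [Module ℂ V]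
    [AddCommGroup V1] [Module ℂ V1] [AddCommGroup V2] [Module ℂ V2] where
  ι1 : V1 →ₗ[ℂ] V
  ι2 : V2 →ₗ[ℂ] V
  p1 : V →ₗ[ℂ] V1
  p2 : V →ₗ[ℂ] V2
  p1_ι1 : ∀ v, p1 (ι1 v) = v
  p2_ι2 : ∀ v, p2 (ι2 v) = v
  p1_ι2 : ∀ v, p1 (ι2 v) = 0
  p2_ι1 : ∀ v, p2 (ι1 v) = 0
  add_eq : ∀ v, ι1 (p1 v) + ι2 (p2 v) = v

namespace Decomp

attribute [simp] p1_ι1 p2_ι2 p1_ι2 p2_ι1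

variable (D : Decomp V V1 V2)

/-- A decomposition is graded if both inclusions are. -/
structure Graded (π : I → Module.End ℂ V) (π1 : I → Module.End ℂ V1)
    (π2 : I → Module.End ℂ V2) : Prop where
  ι1 : ∀ i v, π i (D.ι1 v) = D.ι1 (π1 i v)
  ι2 : ∀ i v, π i (D.ι2 v) = D.ι2 (π2 i v)

theorem hom_ext {W : Type} [AddCommGroup W] [Module ℂ W] {f g : V →ₗ[ℂ] W}
    (h1 : ∀ v, f (D.ι1 v) = g (D.ι1 v)) (h2 : ∀ v, f (D.ι2 v) = g (D.ι2 v)) : f = g := by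
  ext v
  rw [← D.add_eq v, map_add, map_add, h1, h2]

variable {D} in
theorem Graded.p1 {π : I → Module.End ℂ V} {π1 : I → Module.End ℂ V1}
    {π2 : I → Module.End ℂ V2} (hD : D.Graded π π1 π2) (i : I) (v : V) :
    D.p1 (π i v) = π1 i (D.p1 v) := by
  conv_lhs => rw [← D.add_eq v]
  simp [hD.ι1, hD.ι2]

variable {D} in
theorem Graded.p2 {π : I → Module.End ℂ V} {π1 : I → Module.End ℂ V1}
    {π2 : I → Module.End ℂ V2} (hD : D.Graded π π1 π2) (i : I) (v : V) :
    D.p2 (π i v) = π2 i (D.p2 v) := by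
  conv_lhs => rw [← D.add_eq v]
  simp [hD.ι1, hD.ι2]

/-- The block triangular endomorphism with diagonal blocks `a`, `c` and off-diagonal block `b`. -/
def blk (a : Module.End ℂ V1) (b : V1 →ₗ[ℂ] V2) (c : Module.End ℂ V2) : Module.End ℂ V :=
  D.ι1 ∘ₗ a ∘ₗ D.p1 + D.ι2 ∘ₗ b ∘ₗ D.p1 + D.ι2 ∘ₗ c ∘ₗ D.p2

variable (a a' : Module.End ℂ V1) (b b' : V1 →ₗ[ℂ] V2) (c c' : Module.End ℂ V2)

@[simp] theorem blk_ι1 (v : V1) : D.blk a b c (D.ι1 v) = D.ι1 (a v) + D.ι2 (b v) := by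
  simp [blk]

@[simp] theorem blk_ι2 (v : V2) : D.blk a b c (D.ι2 v) = D.ι2 (c v) := by
  simp [blk]

theorem p1_comp_blk_comp_ι1 : D.p1 ∘ₗ D.blk a b c ∘ₗ D.ι1 = a := by
  ext v
  simp

theorem p2_comp_blk_comp_ι1 : D.p2 ∘ₗ D.blk a b c ∘ₗ D.ι1 = b := by
  ext v
  simp

theorem p2_comp_blk_comp_ι2 : D.p2 ∘ₗ D.blk a b c ∘ₗ D.ι2 = c := by
  ext v
  simp

theorem blk_mul : D.blk a b c * D.blk a' b' c' = D.blk (a * a') (b ∘ₗ a' + c ∘ₗ b') (c * c') :=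
  D.hom_ext (fun v => by simp [add_assoc]) fun v => by simp

theorem blk_one : D.blk 1 0 1 = 1 := D.hom_ext (fun v => by simp) fun v => by simp

theorem blk_zero : D.blk 0 0 0 = 0 := by simp [blk]

theorem blk_inj {a a' : Module.End ℂ V1} {b b' : V1 →ₗ[ℂ] V2} {c c' : Module.End ℂ V2} :
    D.blk a b c = D.blk a' b' c' ↔ a = a' ∧ b = b' ∧ c = c' := by
  refine ⟨fun h => ⟨?_, ?_, ?_⟩, by rintro ⟨rfl, rfl, rfl⟩; rfl⟩
  · rw [← D.p1_comp_blk_comp_ι1 a b c, h, p1_comp_blk_comp_ι1]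
  · rw [← D.p2_comp_blk_comp_ι1 a b c, h, p2_comp_blk_comp_ι1]
  · rw [← D.p2_comp_blk_comp_ι2 a b c, h, p2_comp_blk_comp_ι2]

theorem blk_eq_zero {a : Module.End ℂ V1} {b : V1 →ₗ[ℂ] V2} {c : Module.End ℂ V2} :
    D.blk a b c = 0 ↔ a = 0 ∧ b = 0 ∧ c = 0 := by
  rw [← D.blk_zero, blk_inj]

theorem eq_blk {f : Module.End ℂ V} (hf : ∀ v, D.p1 (f (D.ι2 v)) = 0) :
    f = D.blk (D.p1 ∘ₗ f ∘ₗ D.ι1) (D.p2 ∘ₗ f ∘ₗ D.ι1) (D.p2 ∘ₗ f ∘ₗ D.ι2) := by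
  refine D.hom_ext (fun v => by simp [D.add_eq]) fun v => ?_
  have := D.add_eq (f (D.ι2 v))
  rw [hf, map_zero, zero_add] at this
  simp [this]

theorem zsmul_blk (n : ℤ) : n • D.blk a b c = D.blk (n • a) (n • b) (n • c) :=
  D.hom_ext (fun v => by simp) fun v => by simp

theorem sum_blk {s : Finset H} (a : H → Module.End ℂ V1) (b : H → V1 →ₗ[ℂ] V2)
    (c : H → Module.End ℂ V2) :
    ∑ h ∈ s, D.blk (a h) (b h) (c h) = D.blk (∑ h ∈ s, a h) (∑ h ∈ s, b h) (∑ h ∈ s, c h) :=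
  D.hom_ext (fun v => by simp [Finset.sum_add_distrib]) fun v => by simp

theorem exists_prod_blk (a : H → Module.End ℂ V1) (b : H → V1 →ₗ[ℂ] V2)
    (c : H → Module.End ℂ V2) (l : List H) :
    ∃ b', (l.map fun h => D.blk (a h) (b h) (c h)).prod = D.blk (l.map a).prod b' (l.map c).prod := by
  induction l with
  | nil => exact ⟨0, by simp [blk_one]⟩
  | cons h l ih =>
    obtain ⟨b', hb'⟩ := ih
    exact ⟨_, by simp only [List.map_cons, List.prod_cons, hb', blk_mul]; rfl⟩

theorem wordNilp_blk_iff {a : H → Module.End ℂ V1} {b : H → V1 →ₗ[ℂ] V2}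
    {c : H → Module.End ℂ V2} :
    WordNilp (fun h => D.blk (a h) (b h) (c h)) ↔ WordNilp a ∧ WordNilp c := by
  constructor
  · rintro ⟨n, hn⟩
    have key : ∀ l : List H, l.length = n → (l.map a).prod = 0 ∧ (l.map c).prod = 0 := by
      intro l hl
      obtain ⟨b', hb'⟩ := D.exists_prod_blk a b c l
      rw [hn l hl, eq_comm, blk_eq_zero] at hb'
      exact ⟨hb'.1, hb'.2.2⟩
    exact ⟨⟨n, fun l hl => (key l hl).1⟩, ⟨n, fun l hl => (key l hl).2⟩⟩
  · rintro ⟨⟨n, hn⟩, ⟨m, hm⟩⟩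
    refine ⟨m + n, fun l hl => ?_⟩
    rw [← List.take_append_drop m l, List.map_append, List.prod_append]
    obtain ⟨b1, hb1⟩ := D.exists_prod_blk a b c (l.take m)
    obtain ⟨b2, hb2⟩ := D.exists_prod_blk a b c (l.drop m)
    rw [hb1, hb2, blk_mul, hm (l.take m) (by simp; omega), hn (l.drop m) (by simp; omega)]
    simp [blk_zero]

variable {D} in
theorem Graded.blk_mem_blockFam_iff {π : I → Module.End ℂ V} {π1 : I → Module.End ℂ V1}
    {π2 : I → Module.End ℂ V2} (hD : D.Graded π π1 π2) {s t : H → I}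
    {a : H → Module.End ℂ V1} {b : H → V1 →ₗ[ℂ] V2} {c : H → Module.End ℂ V2} :
    (fun h => D.blk (a h) (b h) (c h)) ∈ blockFam π π s t ↔
      a ∈ blockFam π1 π1 s t ∧ b ∈ blockFam π1 π2 s t ∧ c ∈ blockFam π2 π2 s t := by
  have key (h : H) : π (t h) ∘ₗ D.blk (a h) (b h) (c h) ∘ₗ π (s h) =
      D.blk (π1 (t h) ∘ₗ a h ∘ₗ π1 (s h)) (π2 (t h) ∘ₗ b h ∘ₗ π1 (s h))
        (π2 (t h) ∘ₗ c h ∘ₗ π2 (s h)) :=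
    D.hom_ext (fun v => by simp [hD.ι1, hD.ι2]) fun v => by simp [hD.ι2]
  refine ⟨fun h' => ?_, fun h' h => ?_⟩
  · have := fun h => D.blk_inj.1 ((key h).symm.trans (h' h))
    exact ⟨fun h => (this h).1, fun h => (this h).2.1, fun h => (this h).2.2⟩
  · exact (key h).trans (D.blk_inj.2 ⟨h'.1 h, h'.2.1 h, h'.2.2 h⟩)

end Decomp

end Decompositions

section Quiver

variable {I H : Type} [Fintype H]

/-- The hypotheses on a double quiver with an orientation sign. -/
structure IsDouble (s t : H → I) (bar : H → H) (eps : H → ℤ) : Prop where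
  bar_bar : ∀ h, bar (bar h) = h
  s_bar : ∀ h, s (bar h) = t h
  t_bar : ∀ h, t (bar h) = s h
  loopless : ∀ h, s h ≠ t h
  eps_or : ∀ h, eps h = 1 ∨ eps h = -1
  eps_bar : ∀ h, eps h + eps (bar h) = 0

variable (s t : H → I) (bar : H → H) (eps : H → ℤ)
variable {V V1 V2 : Type} [AddCommGroup V] [Module ℂ V]
  [AddCommGroup V1] [Module ℂ V1] [AddCommGroup V2] [Module ℂ V2]

/-- The nilpotent variety of a graded space. -/
def LamSet (π : I → Module.End ℂ V) : Set (H → Module.End ℂ V) :=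
  {x | x ∈ blockFam π π s t ∧ ∑ h, eps h • (x h * x (bar h)) = 0 ∧ WordNilp x}

/-- The linear part of the moment map equation for block triangular families, as a function of the
off-diagonal blocks. -/
def mixMap (x1 : H → Module.End ℂ V1) (x2 : H → Module.End ℂ V2) :
    (H → V1 →ₗ[ℂ] V2) →ₗ[ℂ] (V1 →ₗ[ℂ] V2) :=
  ∑ h, eps h • ((LinearMap.llcomp ℂ V1 V1 V2).flip (x1 (bar h)) ∘ₗ LinearMap.proj h +
    LinearMap.llcomp ℂ V1 V2 V2 (x2 h) ∘ₗ LinearMap.proj (bar h))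

theorem mixMap_apply (x1 : H → Module.End ℂ V1) (x2 : H → Module.End ℂ V2) (x' : H → V1 →ₗ[ℂ] V2) :
    mixMap bar eps x1 x2 x' = ∑ h, eps h • (x' h ∘ₗ x1 (bar h) + x2 h ∘ₗ x' (bar h)) := by
  ext v
  simp [mixMap]

theorem RegMap.mixMap [FiniteDimensional ℂ V1] [FiniteDimensional ℂ V2]
    {M : Type} [AddCommGroup M] [Module ℂ M] {S : Set M}
    {x1 : M → H → Module.End ℂ V1} {x2 : M → H → Module.End ℂ V2} (h1 : RegMap S x1)
    (h2 : RegMap S x2) : RegMap S fun m => mixMap bar eps (x1 m) (x2 m) := by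
  refine RegMap.sum fun h _ => RegMap.zsmul (RegMap.add ?_ ?_) _
  · exact ((h1.apply (bar h)).comp_lin _).lcomp (RegMap.const S _)
  · exact ((h2.apply h).comp_lin _).lcomp (RegMap.const S _)

theorem Decomp.moment_blk (D : Decomp V V1 V2) (x1 : H → Module.End ℂ V1)
    (x' : H → V1 →ₗ[ℂ] V2) (x2 : H → Module.End ℂ V2) :
    ∑ h, eps h • (D.blk (x1 h) (x' h) (x2 h) * D.blk (x1 (bar h)) (x' (bar h)) (x2 (bar h))) =
      D.blk (∑ h, eps h • (x1 h * x1 (bar h))) (mixMap bar eps x1 x2 x')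
        (∑ h, eps h • (x2 h * x2 (bar h))) := by
  simp only [D.blk_mul, D.zsmul_blk, D.sum_blk, mixMap_apply]

theorem Decomp.Graded.blk_mem_LamSet_iff {D : Decomp V V1 V2} {π : I → Module.End ℂ V}
    {π1 : I → Module.End ℂ V1} {π2 : I → Module.End ℂ V2} (hD : D.Graded π π1 π2)
    {x1 : H → Module.End ℂ V1} {x' : H → V1 →ₗ[ℂ] V2} {x2 : H → Module.End ℂ V2} :
    (fun h => D.blk (x1 h) (x' h) (x2 h)) ∈ LamSet s t bar eps π ↔
      x1 ∈ LamSet s t bar eps π1 ∧ x2 ∈ LamSet s t bar eps π2 ∧ x' ∈ blockFam π1 π2 s t ∧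
        mixMap bar eps x1 x2 x' = 0 := by
  simp only [LamSet, Set.mem_ofPred_eq, hD.blk_mem_blockFam_iff, D.moment_blk, D.blk_eq_zero,
    D.wordNilp_blk_iff]
  tauto

variable {s t bar eps}

theorem gHom_of_block [Fintype I] {π1 : I → Module.End ℂ V1} {π2 : I → Module.End ℂ V2}
    (hπ1 : CompleteOrthogonalIdempotents π1) (hπ2 : CompleteOrthogonalIdempotents π2)
    {f : V1 →ₗ[ℂ] V2} {i : I} (hf : ∀ v, π2 i (f (π1 i v)) = f v) : f ∈ gHom π1 π2 := by
  refine mem_gHom_iff.2 fun j v => ?_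
  rw [← hf v, ← hf (π1 j v)]
  by_cases hij : i = j
  · subst hij
    rw [hπ1.idem_apply, hπ2.idem_apply]
  · rw [hπ2.ortho_apply (Ne.symm hij), hπ1.ortho_apply hij]
    simp

theorem IsDouble.mixMap_mem [Fintype I] (hQ : IsDouble s t bar eps) {π1 : I → Module.End ℂ V1}
    {π2 : I → Module.End ℂ V2}
    (hπ1 : CompleteOrthogonalIdempotents π1) (hπ2 : CompleteOrthogonalIdempotents π2)
    {x1 : H → Module.End ℂ V1} {x2 : H → Module.End ℂ V2} {x' : H → V1 →ₗ[ℂ] V2}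
    (h1 : x1 ∈ blockFam π1 π1 s t) (h2 : x2 ∈ blockFam π2 π2 s t) (h' : x' ∈ blockFam π1 π2 s t) :
    mixMap bar eps x1 x2 x' ∈ gHom π1 π2 := by
  rw [mixMap_apply]
  refine Submodule.sum_mem _ fun h _ => zsmul_mem (Submodule.add_mem _ ?_ ?_) _
  · refine gHom_of_block hπ1 hπ2 (i := t h) fun v => ?_
    have := blockFam_apply_proj hπ1 h1 (bar h) v
    rw [hQ.s_bar] at this
    simp [proj_blockFam_apply hπ2 h', this]
  · refine gHom_of_block hπ1 hπ2 (i := t h) fun v => ?_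
    have := blockFam_apply_proj hπ1 h' (bar h) v
    rw [hQ.s_bar] at this
    simp [proj_blockFam_apply hπ2 h2, this]

end Quiver

section MixSurjective

variable {I H : Type} [Fintype I] [Fintype H]
variable {V1 V2 D : Type} [AddCommGroup V1] [Module ℂ V1] [AddCommGroup V2] [Module ℂ V2]
  [AddCommGroup D] [Module ℂ D]
variable {s t : H → I} {bar : H → H} {eps : H → ℤ}
variable {π1 : I → Module.End ℂ V1} {π2 : I → Module.End ℂ V2} {δ : I → Module.End ℂ D}

/-- A graded left inverse of the joint map of a stable family. -/
theorem exists_graded_leftInverse (hπ1 : CompleteOrthogonalIdempotents π1)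
    (hδ : CompleteOrthogonalIdempotents δ) {x1 : H → Module.End ℂ V1}
    (h1 : x1 ∈ blockFam π1 π1 s t) {q1 : V1 →ₗ[ℂ] D} (hq1 : q1 ∈ gHom π1 δ)
    (hstab : ∀ v, (∀ h, x1 h v = 0) → q1 v = 0 → v = 0) :
    ∃ a ∈ blockFam π1 π1 t s, ∃ b ∈ gHom δ π1, ∀ v, ∑ h, a h (x1 h v) + b (q1 v) = v := by
  obtain ⟨L, hL⟩ := ((LinearMap.pi x1).prod q1).exists_leftInverse_of_injective (by
    refine LinearMap.ker_eq_bot'.2 fun v hv => hstab v (fun h => ?_) ?_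
    · exact congrFun (congrArg Prod.fst hv) h
    · exact congrArg Prod.snd hv)
  let A (h : H) : Module.End ℂ V1 := L ∘ₗ LinearMap.inl ℂ _ _ ∘ₗ LinearMap.single ℂ (fun _ => V1) h
  let B : D →ₗ[ℂ] V1 := L ∘ₗ LinearMap.inr ℂ _ _
  have hAB (v : V1) : ∑ h, A h (x1 h v) + B (q1 v) = v := by
    conv_rhs => rw [← LinearMap.id_apply (R := ℂ) v, ← hL]
    simp only [A, B, LinearMap.comp_apply]
    rw [← map_sum, ← map_sum, ← map_add]
    congr 1
    ext1
    · simp only [LinearMap.inl_apply, LinearMap.inr_apply, Prod.fst_add, add_zero]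
      exact LinearMap.sum_single_apply _ _
    · simp [Prod.snd_sum]
  refine ⟨fun h => π1 (s h) ∘ₗ A h ∘ₗ π1 (t h), fun h => ?_, ∑ i, π1 i ∘ₗ B ∘ₗ δ i,
    Submodule.sum_mem _ fun i _ => ?_, fun v => ?_⟩
  · ext v
    simp [hπ1.idem_apply]
  · exact gHom_of_block hδ hπ1 (i := i) fun v => by simp [hδ.idem_apply, hπ1.idem_apply]
  · have key (i : I) : π1 i v = ∑ h, π1 i (A h (x1 h (π1 i v))) + π1 i (B (δ i (q1 v))) := by
      conv_lhs => rw [← hπ1.idem_apply, ← hAB (π1 i v)]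
      rw [map_add, map_sum, gHom_apply hq1]
    conv_rhs => rw [← hπ1.sum_apply v, Finset.sum_congr rfl fun i _ => key i,
      Finset.sum_add_distrib, Finset.sum_comm]
    congr 1
    · refine Finset.sum_congr rfl fun h _ => ?_
      rw [Finset.sum_eq_single (s h)]
      · simp [blockFam_apply_proj hπ1 h1, proj_blockFam_apply hπ1 h1]
      · intro i _ hi
        simp [blockFam_apply_of_ne hπ1 h1 (Ne.symm hi)]
      · simp
    · simp

theorem IsDouble.exists_mixMap_sub_eq (hQ : IsDouble s t bar eps)
    (hπ1 : CompleteOrthogonalIdempotents π1) (hπ2 : CompleteOrthogonalIdempotents π2)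
    (hδ : CompleteOrthogonalIdempotents δ) {x1 : H → Module.End ℂ V1}
    (h1 : x1 ∈ blockFam π1 π1 s t) {q1 : V1 →ₗ[ℂ] D} (hq1 : q1 ∈ gHom π1 δ)
    (hstab : ∀ v, (∀ h, x1 h v = 0) → q1 v = 0 → v = 0) {x2 : H → Module.End ℂ V2}
    (h2 : x2 ∈ blockFam π2 π2 s t) (hnil : WordNilp x2) {f : V1 →ₗ[ℂ] V2} (hf : f ∈ gHom π1 π2) :
    ∃ x' ∈ blockFam π1 π2 s t, ∃ p ∈ gHom δ π2, mixMap bar eps x1 x2 x' - p ∘ₗ q1 = f := by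
  obtain ⟨a, ha, b, hb, hab⟩ := exists_graded_leftInverse hπ1 hδ h1 hq1 hstab
  obtain ⟨n, hn⟩ := hnil
  let N : Module.End ℂ (V1 →ₗ[ℂ] V2) :=
    ∑ h, (LinearMap.llcomp ℂ V1 V1 V2).flip (a h) ∘ₗ LinearMap.llcomp ℂ V1 V2 V2 (x2 h)
  have hN (g : V1 →ₗ[ℂ] V2) (v : V1) : N g v = ∑ h, x2 h (g (a h v)) := by
    simp [N]
  have hNmem : ∀ g ∈ gHom π1 π2, N g ∈ gHom π1 π2 := by
    intro g hg
    have : N g = ∑ h, x2 h ∘ₗ g ∘ₗ a h := by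
      ext v
      simp [hN]
    rw [this]
    refine Submodule.sum_mem _ fun h _ => gHom_of_block hπ1 hπ2 (i := t h) fun v => ?_
    simp [blockFam_apply_proj hπ1 ha, proj_blockFam_apply hπ2 h2]
  have hpow (k : ℕ) : (N ^ k) f ∈ gHom π1 π2 := by
    induction k with
    | zero => exact hf
    | succ k ih =>
      rw [pow_succ']
      exact hNmem _ ih
  have hword (k : ℕ) : ∀ l : List H, l.length + k = n → (l.map x2).prod ∘ₗ (N ^ k) f = 0 := by
    induction k with
    | zero =>
      intro l hl
      rw [hn l hl, LinearMap.zero_comp]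
    | succ k ih =>
      intro l hl
      ext v
      rw [pow_succ', LinearMap.comp_apply, Module.End.mul_apply, hN, map_sum]
      refine Finset.sum_eq_zero fun h _ => ?_
      have := LinearMap.congr_fun (ih (l ++ [h]) (by simp; omega)) (a h v)
      simpa using this
  have hNn : (N ^ n) f = 0 := by
    simpa [Module.End.one_eq_id] using hword n [] (by simp)
  let g := (∑ k ∈ Finset.range n, N ^ k) f
  have hg : g ∈ gHom π1 π2 := by
    simp only [g, LinearMap.sum_apply]
    exact Submodule.sum_mem _ fun k _ => hpow k
  have hgN : g - N g = f := by
    have := LinearMap.congr_fun (mul_neg_geom_sum N n) f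
    simpa only [LinearMap.sub_apply, Module.End.mul_apply, Module.End.one_apply, hNn,
      sub_zero] using this
  have heps (h : H) : eps h * eps h = 1 := by
    rcases hQ.eps_or h with h | h <;> simp [h]
  refine ⟨fun h => eps h • (g ∘ₗ a (bar h)), mem_blockFam_iff.2 fun h v => ?_, -(g ∘ₗ b),
    Submodule.neg_mem _ (mem_gHom_iff.2 fun i v => ?_), ?_⟩
  · have e1 := blockFam_apply_proj hπ1 ha (bar h) v
    have e2 := proj_blockFam_apply hπ1 ha (bar h) v
    rw [hQ.t_bar] at e1
    rw [hQ.s_bar] at e2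
    simp [e1, gHom_apply hg, e2]
  · simp [gHom_apply hg, gHom_apply hb]
  · rw [← hgN]
    ext v
    rw [mixMap_apply]
    have e1 (h : H) : (eps h • ((eps h • (g ∘ₗ a (bar h))) ∘ₗ x1 (bar h) +
        x2 h ∘ₗ (eps (bar h) • (g ∘ₗ a (bar (bar h)))))) v =
        g (a (bar h) (x1 (bar h) v)) - x2 h (g (a h v)) := by
      have e2 : eps h * eps (bar h) = -1 := by
        rw [eq_neg_of_add_eq_zero_right (hQ.eps_bar h), mul_neg, heps]
      simp only [hQ.bar_bar, LinearMap.smul_apply, LinearMap.add_apply, LinearMap.comp_apply,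
        smul_add, smul_smul, heps, one_smul, map_zsmul, e2, neg_smul]
      abel
    have e3 : ∑ h, g (a (bar h) (x1 (bar h) v)) = ∑ h, g (a h (x1 h v)) :=
      Equiv.sum_comp (Function.Involutive.toPerm bar hQ.bar_bar) fun h => g (a h (x1 h v))
    rw [LinearMap.sub_apply, LinearMap.sum_apply, Finset.sum_congr rfl fun h _ => e1 h,
      Finset.sum_sub_distrib, e3, ← map_sum, LinearMap.sub_apply, hN]
    have e4 : g v = g (∑ h, a h (x1 h v)) + g (b (q1 v)) := by rw [← map_add, hab]
    rw [e4]
    simp only [LinearMap.neg_apply, LinearMap.comp_apply]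
    abel

end MixSurjective

section InjectiveLocus

variable {M A B C : Type} [AddCommGroup M] [Module ℂ M] [AddCommGroup A] [Module ℂ A]
  [AddCommGroup B] [Module ℂ B] [AddCommGroup C] [Module ℂ C]
  [FiniteDimensional ℂ A] [FiniteDimensional ℂ B] [FiniteDimensional ℂ C]

theorem isUnit_of_det_ne_zero {f : Module.End ℂ A} (h : LinearMap.det f ≠ 0) : IsUnit f :=
  (LinearMap.isUnit_iff_isUnit_det f).2 (isUnit_iff_ne_zero.2 h)

/-- Injectivity is an open condition, witnessed by a left inverse at the given point. -/
theorem RegMap.exists_det {S : Set M} {Ψ : M → A →ₗ[ℂ] B} (hΨ : RegMap S Ψ) {x : M}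
    (h : ∀ v, Ψ x v = 0 → v = 0) : ∃ τ : B →ₗ[ℂ] A,
      (fun y => LinearMap.det (τ ∘ₗ Ψ y)) ∈ regFuns S ∧ LinearMap.det (τ ∘ₗ Ψ x) ≠ 0 := by
  obtain ⟨τ, hτ⟩ := (Ψ x).exists_leftInverse_of_injective (LinearMap.ker_eq_bot'.2 h)
  exact ⟨τ, ((RegMap.const S τ).lcomp hΨ).det, by simp [hτ]⟩

omit [FiniteDimensional ℂ B] in
theorem eq_zero_of_det_ne_zero {τ : B →ₗ[ℂ] A} {f : A →ₗ[ℂ] B}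
    (h : LinearMap.det (τ ∘ₗ f) ≠ 0) (v : A) (hv : f v = 0) : v = 0 := by
  obtain ⟨u, hu⟩ := isUnit_of_det_ne_zero h
  have e := LinearMap.congr_fun (Units.inv_mul u) v
  rw [hu] at e
  rw [← Module.End.one_apply (R := ℂ) v, ← e]
  simp [hv]

theorem Good.injective_locus [FiniteDimensional ℂ M] {S : Set M} {d : ℕ} (hS : Good S d) {Ψ : M → A →ₗ[ℂ] B}
    (hΨ : RegMap S Ψ) : Good {x | x ∈ S ∧ ∀ v, Ψ x v = 0 → v = 0} d := by
  refine hS.of_isOpen (fun x hx => hx.1) fun x hx => ?_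
  obtain ⟨τ, hτ, h0⟩ := hΨ.exists_det hx.2
  exact ⟨_, hτ, h0, fun y hy hy0 => ⟨hy, eq_zero_of_det_ne_zero hy0⟩⟩

/-- The solution of a linear equation with injective coefficients depends regularly on them. -/
theorem RegMap.of_injective_comp {S : Set M} {Ψ : M → B →ₗ[ℂ] C} {R : M → A →ₗ[ℂ] C}
    {X : M → A →ₗ[ℂ] B} (hΨ : RegMap S Ψ) (hR : RegMap S R)
    (hinj : ∀ x ∈ S, ∀ v, Ψ x v = 0 → v = 0) (hX : ∀ x ∈ S, ∀ v, Ψ x (X x v) = R x v) :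
    RegMap S X := by
  refine RegMap.of_open fun x hx => ?_
  obtain ⟨τ, hτ, h0⟩ := hΨ.exists_det (hinj x hx)
  refine ⟨_, hτ, h0, ?_⟩
  have hsub : {y | y ∈ S ∧ LinearMap.det (τ ∘ₗ Ψ y) ≠ 0} ⊆ S := fun y hy => hy.1
  let G (y : M) : Module.End ℂ B := Ring.inverse (τ ∘ₗ Ψ y)
  have hG : RegMap {y | y ∈ S ∧ LinearMap.det (τ ∘ₗ Ψ y) ≠ 0} G :=
    RegMap.of_mul_eq_one ((RegMap.const _ τ).lcomp (hΨ.anti hsub)) fun y hy =>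
      Ring.inverse_mul_cancel _ (isUnit_of_det_ne_zero hy.2)
  refine (hG.lcomp ((RegMap.const _ τ).lcomp (hR.anti hsub))).congr fun y hy => ?_
  ext v
  have e := LinearMap.congr_fun (Ring.inverse_mul_cancel _ (isUnit_of_det_ne_zero hy.2)) (X y v)
  simp only [Module.End.mul_apply, LinearMap.comp_apply, hX y hy.1, Module.End.one_apply] at e
  exact e

end InjectiveLocus

section Symmetry

variable {I H : Type} [Fintype H] {s t : H → I} {bar : H → H} {eps : H → ℤ}

theorem IsDouble.sum_comm (hQ : IsDouble s t bar eps) (a b : I → ℕ) :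
    ∑ h, a (s h) * b (t h) = ∑ h, b (s h) * a (t h) := by
  refine Finset.sum_nbij' bar bar ?_ ?_ ?_ ?_ ?_ <;>
    simp [hQ.bar_bar, hQ.s_bar, hQ.t_bar, mul_comm]

theorem IsDouble.exists_two_mul (hQ : IsDouble s t bar eps) (a : I → ℕ) :
    ∃ d, 2 * d = ∑ h, a (s h) * a (t h) := by
  refine ⟨∑ h with eps h = 1, a (s h) * a (t h), ?_⟩
  rw [← Finset.sum_filter_add_sum_filter_not Finset.univ (fun h => eps h = 1), two_mul,
    add_right_inj]
  refine Finset.sum_nbij' bar bar ?_ ?_ ?_ ?_ ?_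
  · intro h
    have := hQ.eps_bar h
    simp only [Finset.mem_filter, Finset.mem_univ, true_and]
    omega
  · intro h
    have := hQ.eps_bar h
    have := hQ.eps_or h
    simp only [Finset.mem_filter, Finset.mem_univ, true_and]
    omega
  · simp [hQ.bar_bar]
  · simp [hQ.bar_bar]
  · simp [hQ.s_bar, hQ.t_bar, mul_comm]

end Symmetry

section GradedDimension

variable {I V V1 V2 : Type} [AddCommGroup V] [Module ℂ V] [FiniteDimensional ℂ V]
  [AddCommGroup V1] [Module ℂ V1] [FiniteDimensional ℂ V1]
  [AddCommGroup V2] [Module ℂ V2] [FiniteDimensional ℂ V2]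
  {π : I → Module.End ℂ V} {π1 : I → Module.End ℂ V1} {π2 : I → Module.End ℂ V2}

theorem CompleteOrthogonalIdempotents.trace_eq [Fintype I] (hπ : CompleteOrthogonalIdempotents π)
    (i : I) : LinearMap.trace ℂ V (π i) = gdim π i :=
  LinearMap.IsProj.trace ⟨fun v => LinearMap.mem_range_self _ v, by
    rintro _ ⟨v, rfl⟩
    exact hπ.idem_apply i v⟩

theorem Decomp.Graded.gdim_add [Fintype I] {D : Decomp V V1 V2} (hD : D.Graded π π1 π2)
    (hπ : CompleteOrthogonalIdempotents π) (hπ1 : CompleteOrthogonalIdempotents π1)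
    (hπ2 : CompleteOrthogonalIdempotents π2) (i : I) : gdim π i = gdim π1 i + gdim π2 i := by
  have e : π i = D.ι1 ∘ₗ (π1 i ∘ₗ D.p1) + D.ι2 ∘ₗ (π2 i ∘ₗ D.p2) :=
    D.hom_ext (fun v => by simp [hD.ι1]) fun v => by simp [hD.ι2]
  have h := congrArg (LinearMap.trace ℂ V) e
  rw [map_add, LinearMap.trace_comp_comm' (π1 i ∘ₗ D.p1), LinearMap.trace_comp_comm' (π2 i ∘ₗ D.p2)] at h
  have e1 : (π1 i ∘ₗ D.p1) ∘ₗ D.ι1 = π1 i := by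
    ext v
    simp
  have e2 : (π2 i ∘ₗ D.p2) ∘ₗ D.ι2 = π2 i := by
    ext v
    simp
  rw [e1, e2, hπ.trace_eq, hπ1.trace_eq, hπ2.trace_eq] at h
  exact_mod_cast h

end GradedDimension

section JointMap

variable {I H : Type} [Fintype H] {V : Type} [AddCommGroup V] [Module ℂ V]

/-- The map whose kernel consists of the vectors of degree `i` killed by the family `x`. -/
def jointMap (π : I → Module.End ℂ V) (i : I) (x : H → Module.End ℂ V) : V →ₗ[ℂ] (H → V) × V :=
  LinearMap.inl ℂ _ _ ∘ₗ (∑ h, LinearMap.single ℂ (fun _ => V) h ∘ₗ x h) +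
    LinearMap.inr ℂ _ _ ∘ₗ (1 - π i)

theorem jointMap_eq_zero_iff {π : I → Module.End ℂ V} {i : I} {x : H → Module.End ℂ V} {v : V} :
    jointMap π i x v = 0 ↔ (∀ h, x h v = 0) ∧ π i v = v := by
  have e : (∑ h, LinearMap.single ℂ (fun _ => V) h ∘ₗ x h) v = fun h => x h v := by
    rw [LinearMap.sum_apply]
    exact LinearMap.sum_single_apply _ _
  simp only [jointMap, LinearMap.add_apply, LinearMap.comp_apply, e, LinearMap.inl_apply,
    LinearMap.inr_apply, Prod.mk_add_mk, add_zero, zero_add, Prod.mk_eq_zero, LinearMap.sub_apply,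
    Module.End.one_apply, sub_eq_zero, funext_iff, Pi.zero_apply, eq_comm (a := v)]

theorem RegMap.jointMap [FiniteDimensional ℂ V] {M : Type} [AddCommGroup M] [Module ℂ M] {S : Set M}
    {x : M → H → Module.End ℂ V} (hx : RegMap S x) (π : I → Module.End ℂ V) (i : I) :
    RegMap S fun m => jointMap π i (x m) :=
  RegMap.add (RegMap.lcomp (RegMap.const S _) (RegMap.sum fun h _ =>
    RegMap.lcomp (RegMap.const S _) (hx.apply h))) (RegMap.const S _)

variable {s t : H → I} {bar : H → H} {eps : H → ℤ}

theorem exists_jointMap_eq_zero [Fintype I] [Nontrivial V] {π : I → Module.End ℂ V}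
    (hπ : CompleteOrthogonalIdempotents π) {x : H → Module.End ℂ V}
    (hx : x ∈ LamSet s t bar eps π) : ∃ i, ∃ v, v ≠ 0 ∧ jointMap π i x v = 0 := by
  obtain ⟨v, hv, hxv⟩ : ∃ v : V, v ≠ 0 ∧ ∀ h, x h v = 0 := by
    by_contra! hcon
    obtain ⟨n, hn⟩ := hx.2.2
    obtain ⟨v, hv⟩ := exists_ne (0 : V)
    have key (k : ℕ) : ∃ l : List H, l.length = k ∧ (l.map x).prod v ≠ 0 := by
      induction k with
      | zero => exact ⟨[], rfl, by simpa using hv⟩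
      | succ k ih =>
        obtain ⟨l, hl, hlv⟩ := ih
        obtain ⟨h, hh⟩ := hcon _ hlv
        exact ⟨h :: l, by simp [hl], by simpa using hh⟩
    obtain ⟨l, hl, hlv⟩ := key n
    exact hlv (by simp [hn l hl])
  obtain ⟨i, hi⟩ : ∃ i, π i v ≠ 0 := by
    by_contra! hcon
    exact hv (by rw [← hπ.sum_apply v]; simp [hcon])
  refine ⟨i, π i v, hi, jointMap_eq_zero_iff.2 ⟨fun h => ?_, hπ.idem_apply _ _⟩⟩
  by_cases hs : s h = i
  · rw [← hs, blockFam_apply_proj hπ hx.1, hxv]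
  · exact blockFam_apply_of_ne hπ hx.1 hs v

omit [Fintype H] in
theorem prod_map_conj {A : Type*} [Monoid A] {u u' : A} (h1 : u * u' = 1) (h2 : u' * u = 1)
    (x : H → A) (l : List H) :
    (l.map fun h => u * x h * u').prod = u * (l.map x).prod * u' := by
  induction l with
  | nil => simp [h1]
  | cons h l ih =>
    simp only [List.map_cons, List.prod_cons, ih]
    calc u * x h * u' * (u * (l.map x).prod * u') = u * x h * (u' * u) * (l.map x).prod * u' := by
          simp only [mul_assoc]
      _ = u * (x h * (l.map x).prod) * u' := by simp only [h2, mul_one, mul_assoc]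

theorem conj_mem_LamSet {π : I → Module.End ℂ V} {u u' : Module.End ℂ V} (h1 : u * u' = 1)
    (h2 : u' * u = 1) (hu : ∀ i v, π i (u v) = u (π i v)) (hu' : ∀ i v, π i (u' v) = u' (π i v))
    {x : H → Module.End ℂ V} (hx : x ∈ LamSet s t bar eps π) :
    (fun h => u * x h * u') ∈ LamSet s t bar eps π := by
  obtain ⟨hb, hm, n, hn⟩ := hx
  refine ⟨mem_blockFam_iff.2 fun h v => ?_, ?_, n, fun l hl => ?_⟩
  · simp only [Module.End.mul_apply, hu, ← hu']
    rw [← mem_blockFam_iff.1 hb h (u' v), hu']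
  · have e (h : H) : eps h • (u * x h * u' * (u * x (bar h) * u')) =
        u * (eps h • (x h * x (bar h))) * u' := by
      calc eps h • (u * x h * u' * (u * x (bar h) * u'))
          = eps h • (u * x h * (u' * u) * x (bar h) * u') := by simp only [mul_assoc]
        _ = _ := by simp only [h2, mul_one, mul_assoc, mul_smul_comm, smul_mul_assoc]
    rw [Finset.sum_congr rfl fun h _ => e h, ← Finset.sum_mul, ← Finset.mul_sum, hm]
    simp
  · rw [prod_map_conj h1 h2, hn l hl]
    simp

end JointMap

section Shear

variable {V V1 V2 : Type} [AddCommGroup V] [Module ℂ V]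
  [AddCommGroup V1] [Module ℂ V1] [AddCommGroup V2] [Module ℂ V2] (D : Decomp V V1 V2)

/-- The unipotent automorphism sending `V2` to the graph of `A`. -/
def Decomp.shear (A : V2 →ₗ[ℂ] V1) : Module.End ℂ V := 1 + D.ι1 ∘ₗ A ∘ₗ D.p2

theorem Decomp.shear_apply (A : V2 →ₗ[ℂ] V1) (v : V) : D.shear A v = v + D.ι1 (A (D.p2 v)) := rfl

theorem Decomp.shear_mul_shear_neg (A : V2 →ₗ[ℂ] V1) : D.shear A * D.shear (-A) = 1 := by
  ext v
  simp [shear_apply]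

theorem Decomp.shear_neg_mul_shear (A : V2 →ₗ[ℂ] V1) : D.shear (-A) * D.shear A = 1 := by
  simpa using D.shear_mul_shear_neg (-A)

theorem Decomp.Graded.shear_comm {I : Type} {D : Decomp V V1 V2} {π : I → Module.End ℂ V}
    {π1 : I → Module.End ℂ V1} {π2 : I → Module.End ℂ V2} (hD : D.Graded π π1 π2)
    {A : V2 →ₗ[ℂ] V1} (hA : A ∈ gHom π2 π1) (i : I) (v : V) :
    π i (D.shear A v) = D.shear A (π i v) := by
  simp [shear_apply, hD.ι1, gHom_apply hA, hD.p2]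

theorem RegMap.shear [FiniteDimensional ℂ V] [FiniteDimensional ℂ V1] [FiniteDimensional ℂ V2]
    {M : Type} [AddCommGroup M] [Module ℂ M] {S : Set M}
    {A : M → V2 →ₗ[ℂ] V1} (hA : RegMap S A) : RegMap S fun m => D.shear (A m) :=
  RegMap.add (RegMap.const S _) ((RegMap.const S _).lcomp (hA.lcomp (RegMap.const S _)))

theorem RegMap.blk [FiniteDimensional ℂ V] [FiniteDimensional ℂ V1] [FiniteDimensional ℂ V2]
    {M : Type} [AddCommGroup M] [Module ℂ M] {S : Set M} {a : M → Module.End ℂ V1}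
    {b : M → V1 →ₗ[ℂ] V2} {c : M → Module.End ℂ V2} (ha : RegMap S a) (hb : RegMap S b)
    (hc : RegMap S c) : RegMap S fun m => D.blk (a m) (b m) (c m) :=
  RegMap.add (RegMap.add ((RegMap.const S _).lcomp (ha.lcomp (RegMap.const S _)))
    ((RegMap.const S _).lcomp (hb.lcomp (RegMap.const S _))))
    ((RegMap.const S _).lcomp (hc.lcomp (RegMap.const S _)))

end Shear

section Stratum

variable {I H : Type} [Fintype I] [Fintype H] {s t : H → I} {bar : H → H} {eps : H → ℤ}
  {V V1 V2 : Type} [AddCommGroup V] [Module ℂ V] [FiniteDimensional ℂ V]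
  [AddCommGroup V1] [Module ℂ V1] [FiniteDimensional ℂ V1]
  [AddCommGroup V2] [Module ℂ V2] [FiniteDimensional ℂ V2]
  {π : I → Module.End ℂ V} {π1 : I → Module.End ℂ V1} {π2 : I → Module.End ℂ V2}

omit [FiniteDimensional ℂ V1] in
theorem Decomp.exists_graph (D : Decomp V V1 V2) {W : Type} [AddCommGroup W] [Module ℂ W]
    {Φ : V →ₗ[ℂ] W} (hrank : Module.finrank ℂ (LinearMap.ker Φ) = Module.finrank ℂ V2)
    (hinj : ∀ v, Φ (D.ι1 v) = 0 → v = 0) :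
    ∃ A : V2 →ₗ[ℂ] V1, ∀ v, Φ (D.ι2 v + D.ι1 (A v)) = 0 := by
  let K := LinearMap.ker Φ
  have hr : Function.Injective (D.p2 ∘ₗ K.subtype) := by
    refine (injective_iff_map_eq_zero _).2 fun v hv => ?_
    have hv' : D.p2 v = 0 := hv
    have e := D.add_eq v
    rw [hv', map_zero, add_zero] at e
    have h0 : Φ (D.ι1 (D.p1 v)) = 0 := by rw [e]; exact v.2
    rw [hinj _ h0, map_zero] at e
    exact Subtype.ext e.symm
  let r := LinearMap.linearEquivOfInjective _ hr hrank
  refine ⟨D.p1 ∘ₗ K.subtype ∘ₗ r.symm, fun v => ?_⟩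
  have e : D.p2 (r.symm v : V) = v := r.apply_symm_apply v
  have e' : D.ι2 v + D.ι1 (D.p1 (r.symm v : V)) = r.symm v := by
    have h := D.add_eq (r.symm v : V)
    rwa [e, add_comm] at h
  exact (congrArg Φ e').trans (r.symm v).2

theorem IsDouble.good_kernel_stratum (hQ : IsDouble s t bar eps)
    (hπ1 : CompleteOrthogonalIdempotents π1)
    (hπ2 : CompleteOrthogonalIdempotents π2) {i : I} (hi : ∀ v, π2 i v = v) {d1 d : ℕ}
    (hΛ : Good (LamSet s t bar eps π1) d1)
    (hd : d = d1 + ∑ h, gdim π1 (s h) * gdim π2 (t h)) :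
    Good ({A | A ∈ gHom π2 π1} ×ˢ
      {x : (H → Module.End ℂ V1) × (H → V1 →ₗ[ℂ] V2) |
        x.1 ∈ {x1 | x1 ∈ LamSet s t bar eps π1 ∧ ∀ v, jointMap π1 i x1 v = 0 → v = 0} ∧
          x.2 ∈ blockFam π1 π2 s t ∧ mixMap bar eps x.1 0 x.2 = 0}) d := by
  have hB := hΛ.injective_locus ((RegMap.id (LamSet s t bar eps π1)).jointMap π1 i)
  have hgg : Module.finrank ℂ (gHom π2 π1) = Module.finrank ℂ (gHom π1 π2) := by
    simp only [finrank_gHom, hπ1, hπ2, mul_comm]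
  have hsurj (x1) (hx1 : x1 ∈ {x1 | x1 ∈ LamSet s t bar eps π1 ∧
      ∀ v, jointMap π1 i x1 v = 0 → v = 0}) (f) (hf : f ∈ gHom π1 π2) :
      ∃ x' ∈ blockFam π1 π2 s t, mixMap bar eps x1 0 x' = f := by
    have hq : (1 - π1 i) ∈ gHom π1 π1 := by
      refine mem_gHom_iff.2 fun j v => ?_
      have : π1 j (π1 i v) = π1 i (π1 j v) := by
        by_cases hij : i = j
        · rw [hij]
        · rw [hπ1.ortho_apply hij, hπ1.ortho_apply (Ne.symm hij)]
      simp [this]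
    obtain ⟨x', hx', p, hp, h⟩ := hQ.exists_mixMap_sub_eq hπ1 hπ2 hπ1 hx1.1.1 hq
      (fun v hv hv' => hx1.2 v (jointMap_eq_zero_iff.2 ⟨hv, (sub_eq_zero.1 hv').symm⟩))
      (Submodule.zero_mem (blockFam π2 π2 s t)) ⟨1, fun l hl => by
        obtain ⟨h, rfl⟩ := List.length_eq_one_iff.1 hl
        simp⟩ hf
    refine ⟨x', hx', ?_⟩
    rw [← h, eq_comm]
    have : p ∘ₗ (1 - π1 i) = 0 := by
      ext v
      simp [← gHom_apply hp, hi]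
    change _ - p ∘ₗ (1 - π1 i) = _
    rw [this, sub_zero]
  rcases Set.eq_empty_or_nonempty {x1 | x1 ∈ LamSet s t bar eps π1 ∧
    ∀ v, jointMap π1 i x1 v = 0 → v = 0} with hemp | ⟨x1, hx1⟩
  · refine Good.of_local fun x hx => ?_
    have := hx.2.1
    rw [hemp] at this
    exact this.elim
  have hle : Module.finrank ℂ (gHom π1 π2) ≤ Module.finrank ℂ (blockFam π1 π2 s t) := by
    refine (Submodule.finrank_mono (t := (blockFam π1 π2 s t).map (mixMap bar eps x1 0))
      fun f hf => ?_).trans (Submodule.finrank_map_le _ _)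
    obtain ⟨x', hx', h⟩ := hsurj x1 hx1 f hf
    exact ⟨x', hx', h⟩
  have hT := hB.kernel_submodule (T := fun x1 => mixMap bar eps x1 (0 : H → Module.End ℂ V2))
    (d' := d1 + Module.finrank ℂ (blockFam π1 π2 s t) - Module.finrank ℂ (gHom π1 π2))
    (RegMap.mixMap bar eps (RegMap.id _) (RegMap.const _ 0))
    (blockFam π1 π2 s t) (gHom π1 π2)
    (fun x1 hx1 x' hx' => hQ.mixMap_mem hπ1 hπ2 hx1.1.1 (Submodule.zero_mem _) hx')
    hsurj (Nat.sub_add_cancel (by omega))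
  have hfin := (good_submodule (gHom π2 π1)).prod hT
  rw [hgg, Nat.add_sub_cancel' (by omega), finrank_blockFam hπ1 hπ2, ← hd] at hfin
  exact hfin

theorem IsDouble.good_stratum (hQ : IsDouble s t bar eps) {D : Decomp V V1 V2}
    (hD : D.Graded π π1 π2) (hπ1 : CompleteOrthogonalIdempotents π1)
    (hπ2 : CompleteOrthogonalIdempotents π2) {i : I} (hi : ∀ v, π2 i v = v) {d1 d : ℕ}
    (hΛ : Good (LamSet s t bar eps π1) d1)
    (hd : d = d1 + ∑ h, gdim π1 (s h) * gdim π2 (t h)) :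
    Good {y | y ∈ LamSet s t bar eps π ∧
      Module.finrank ℂ (LinearMap.ker (jointMap π i y)) = Module.finrank ℂ V2 ∧
      ∀ v, jointMap π i y (D.ι1 v) = 0 → v = 0} d := by
  set S := {y | y ∈ LamSet s t bar eps π ∧
      Module.finrank ℂ (LinearMap.ker (jointMap π i y)) = Module.finrank ℂ V2 ∧
      ∀ v, jointMap π i y (D.ι1 v) = 0 → v = 0} with hS
  have hgood := hQ.good_kernel_stratum hπ1 hπ2 hi hΛ hd
  set T := {A | A ∈ gHom π2 π1} ×ˢ
      {x : (H → Module.End ℂ V1) × (H → V1 →ₗ[ℂ] V2) |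
        x.1 ∈ {x1 | x1 ∈ LamSet s t bar eps π1 ∧ ∀ v, jointMap π1 i x1 v = 0 → v = 0} ∧
          x.2 ∈ blockFam π1 π2 s t ∧ mixMap bar eps x.1 0 x.2 = 0} with hT
  have hex (y) (hy : y ∈ S) : ∃ A : V2 →ₗ[ℂ] V1, ∀ v, jointMap π i y (D.ι2 v + D.ι1 (A v)) = 0 :=
    D.exists_graph hy.2.1 hy.2.2
  let G (y : H → Module.End ℂ V) : V2 →ₗ[ℂ] V1 :=
    if h : y ∈ S then (hex y h).choose else 0
  have hG (y) (hy : y ∈ S) (v) : jointMap π i y (D.ι2 v + D.ι1 (G y v)) = 0 := by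
    simp only [G, dif_pos hy]
    exact (hex y hy).choose_spec v
  have hGuniq (y) (hy : y ∈ S) (A : V2 →ₗ[ℂ] V1)
      (hA : ∀ v, jointMap π i y (D.ι2 v + D.ι1 (A v)) = 0) : G y = A := by
    ext v
    have h := hA v
    have h' := hG y hy v
    rw [map_add] at h h'
    exact sub_eq_zero.1 (hy.2.2 _ (by
      rw [map_sub, map_sub, sub_eq_zero]
      exact add_left_cancel (h'.trans h.symm)))
  have hGmem (y) (hy : y ∈ S) : G y ∈ gHom π2 π1 := by
    refine gHom_of_block hπ2 hπ1 (i := i) fun v => ?_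
    have h := congrArg D.p1 (jointMap_eq_zero_iff.1 (hG y hy v)).2
    rw [hD.p1] at h
    simpa [hi] using h
  have hGreg : RegMap S G := by
    refine RegMap.of_injective_comp (Ψ := fun y => jointMap π i y ∘ₗ D.ι1)
      (R := fun y => -(jointMap π i y ∘ₗ D.ι2))
      (((RegMap.id S).jointMap π i).lcomp (RegMap.const S _))
      (((RegMap.id S).jointMap π i).lcomp (RegMap.const S _)).neg
      (fun y hy v hv => hy.2.2 v hv) fun y hy v => ?_
    have h := hG y hy v
    rw [map_add, add_comm] at h
    exact eq_neg_of_add_eq_zero_left h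
  let z (y : H → Module.End ℂ V) (h : H) : Module.End ℂ V :=
    D.shear (-G y) * y h * D.shear (G y)
  have hz (y) (hy : y ∈ S) (h) : z y h = D.blk (D.p1 ∘ₗ z y h ∘ₗ D.ι1) (D.p2 ∘ₗ z y h ∘ₗ D.ι1) 0 := by
    have h0 (v) : z y h (D.ι2 v) = 0 := by
      have := (jointMap_eq_zero_iff.1 (hG y hy v)).1 h
      simp only [z, Module.End.mul_apply, D.shear_apply (G y), D.p2_ι2, this, map_zero]
    conv_lhs => rw [D.eq_blk (f := z y h) fun v => by rw [h0, map_zero]]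
    congr 1
    ext v
    simp [h0]
  have hzmem (y) (hy : y ∈ S) : z y ∈ LamSet s t bar eps π :=
    conj_mem_LamSet (D.shear_neg_mul_shear _) (D.shear_mul_shear_neg _)
      (hD.shear_comm (Submodule.neg_mem _ (hGmem y hy))) (hD.shear_comm (hGmem y hy)) hy.1
  have hzreg : RegMap S z := RegMap.pi fun h =>
    ((RegMap.shear D hGreg.neg).lcomp ((RegMap.id S).apply h)).lcomp (RegMap.shear D hGreg)
  let φ (x : (V2 →ₗ[ℂ] V1) × (H → Module.End ℂ V1) × (H → V1 →ₗ[ℂ] V2)) (h : H) :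
      Module.End ℂ V :=
    D.shear x.1 * D.blk (x.2.1 h) (x.2.2 h) 0 * D.shear (-x.1)
  have hφ : RegMap T φ := RegMap.pi fun h =>
    ((RegMap.shear D (RegMap.id T).fst).lcomp (RegMap.blk D ((RegMap.id T).snd.fst.apply h)
      ((RegMap.id T).snd.snd.apply h) (RegMap.const T _))).lcomp
        (RegMap.shear D (RegMap.id T).fst.neg)
  have hcancel (A : V2 →ₗ[ℂ] V1) (y : Module.End ℂ V) :
      D.shear (-A) * (D.shear A * y * D.shear (-A)) * D.shear A = y := by
    calc _ = D.shear (-A) * D.shear A * y * (D.shear (-A) * D.shear A) := by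
          simp only [mul_assoc]
      _ = y := by rw [D.shear_neg_mul_shear, one_mul, mul_one]
  have hcancel' (A : V2 →ₗ[ℂ] V1) (y : Module.End ℂ V) :
      D.shear A * (D.shear (-A) * y * D.shear A) * D.shear (-A) = y := by
    simpa using hcancel (-A) y
  have hφker (x) (hx : x ∈ T) (v : V) : jointMap π i (φ x) v = 0 ↔
      v = D.ι2 (D.p2 v) + D.ι1 (x.1 (D.p2 v)) := by
    have hw : v = D.shear x.1 (D.shear (-x.1) v) := by
      rw [← Module.End.mul_apply, D.shear_mul_shear_neg, Module.End.one_apply]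
    rw [jointMap_eq_zero_iff]
    constructor
    · rintro ⟨h1, h2⟩
      set w := D.shear (-x.1) v with hwdef
      have h0 (h) : D.blk (x.2.1 h) (x.2.2 h) 0 w = 0 := by
        have := congrArg (D.shear (-x.1)) (h1 h)
        rwa [map_zero, ← Module.End.mul_apply, ← mul_assoc, ← mul_assoc,
          D.shear_neg_mul_shear, one_mul] at this
      have hpw : D.p1 w = 0 := by
        refine hx.2.1.2 _ (jointMap_eq_zero_iff.2 ⟨fun h => ?_, ?_⟩)
        · have := congrArg D.p1 (h0 h)
          rw [← D.add_eq w] at this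
          simpa using this
        · rw [← hD.p1, hwdef, hD.shear_comm (Submodule.neg_mem _ hx.1), h2]
      have hw2 : w = D.ι2 (D.p2 w) := by
        conv_lhs => rw [← D.add_eq w, hpw, map_zero, zero_add]
      have hp2 : D.p2 w = D.p2 v := by simp [hwdef, D.shear_apply]
      conv_lhs => rw [hw, D.shear_apply, hw2, hp2]
      simp
    · intro hv
      have hw2 : D.shear (-x.1) v = D.ι2 (D.p2 v) := by
        rw [D.shear_apply]
        nth_rewrite 1 [hv]
        simp
      refine ⟨fun h => ?_, ?_⟩
      · simp only [φ, Module.End.mul_apply, hw2]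
        simp
      · have hA : π1 i (x.1 (D.p2 v)) = x.1 (D.p2 v) := by rw [gHom_apply hx.1, hi]
        rw [hv, map_add, hD.ι2, hD.ι1, hi, hA]
  have hφS : Set.MapsTo φ T S := by
    intro x hx
    refine ⟨?_, ?_, fun v hv => ?_⟩
    · refine conj_mem_LamSet (D.shear_mul_shear_neg _) (D.shear_neg_mul_shear _)
        (hD.shear_comm hx.1) (hD.shear_comm (Submodule.neg_mem _ hx.1)) ?_
      refine (hD.blk_mem_LamSet_iff s t bar eps (x1 := x.2.1) (x' := x.2.2) (x2 := 0)).2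
        ⟨hx.2.1.1, ⟨Submodule.zero_mem _, by simp, 1, fun l hl => ?_⟩, hx.2.2.1, hx.2.2.2⟩
      obtain ⟨h, rfl⟩ := List.length_eq_one_iff.1 hl
      simp
    · have : LinearMap.ker (jointMap π i (φ x)) = LinearMap.range (D.ι2 + D.ι1 ∘ₗ x.1) := by
        ext v
        rw [LinearMap.mem_ker, hφker x hx, LinearMap.mem_range]
        refine ⟨fun h => ⟨D.p2 v, h.symm⟩, ?_⟩
        rintro ⟨u, rfl⟩
        simp
      rw [this]
      refine LinearMap.finrank_range_of_inj fun u u' huu => ?_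
      simpa using congrArg D.p2 huu
    · have := (hφker x hx _).1 hv
      simpa using congrArg D.p1 this
  refine hgood.of_iso (φ := φ) (ψ := fun y => (G y, fun h => D.p1 ∘ₗ z y h ∘ₗ D.ι1,
    fun h => D.p2 ∘ₗ z y h ∘ₗ D.ι1)) hφ ?_ hφS ?_ ?_ ?_
  · exact hGreg.prodMk ((RegMap.pi fun h => (RegMap.const S _).lcomp ((hzreg.apply h).lcomp
      (RegMap.const S _))).prodMk (RegMap.pi fun h => (RegMap.const S _).lcomp ((hzreg.apply h).lcomp
      (RegMap.const S _))))
  · intro y hy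
    have hzy : z y = fun h => D.blk (D.p1 ∘ₗ z y h ∘ₗ D.ι1) (D.p2 ∘ₗ z y h ∘ₗ D.ι1) 0 :=
      funext (hz y hy)
    have hm := (hD.blk_mem_LamSet_iff s t bar eps (x1 := fun h => D.p1 ∘ₗ z y h ∘ₗ D.ι1)
      (x' := fun h => D.p2 ∘ₗ z y h ∘ₗ D.ι1) (x2 := 0)).1
        (by
          have h := hzmem y hy
          rwa [hzy] at h)
    refine ⟨hGmem y hy, ⟨hm.1, fun v hv => hy.2.2 v ?_⟩, hm.2.2.1, hm.2.2.2⟩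
    rw [jointMap_eq_zero_iff] at hv ⊢
    refine ⟨fun h => ?_, by rw [hD.ι1, hv.2]⟩
    have h2 : D.p2 (z y h (D.ι1 v)) = 0 := by
      by_cases hs : s h = i
      · have ht : i ≠ t h := hs ▸ hQ.loopless h
        rw [← hi (D.p2 (z y h (D.ι1 v)))]
        exact proj_blockFam_apply_of_ne hπ2 hm.2.2.1 ht v
      · rw [← hv.2]
        exact blockFam_apply_of_ne hπ1 hm.2.2.1 hs v
    have hz0 : z y h (D.ι1 v) = 0 := by
      rw [← D.add_eq (z y h (D.ι1 v)), h2, show D.p1 (z y h (D.ι1 v)) = 0 from hv.1 h]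
      simp
    rw [← hcancel' (G y) (y h)]
    change D.shear (G y) (z y h (D.shear (-G y) (D.ι1 v))) = 0
    have : D.shear (-G y) (D.ι1 v) = D.ι1 v := by simp [D.shear_apply]
    rw [this, hz0, map_zero]
  · intro x hx
    have hGx : G (φ x) = x.1 := hGuniq _ (hφS hx) _ fun v => (hφker x hx _).2 (by simp)
    have hzx (h) : z (φ x) h = D.blk (x.2.1 h) (x.2.2 h) 0 := by
      simp only [z, hGx, φ, hcancel]
    refine Prod.ext hGx (Prod.ext (funext fun h => ?_) (funext fun h => ?_))
    · simp only [hzx, D.p1_comp_blk_comp_ι1]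
    · simp only [hzx, D.p2_comp_blk_comp_ι1]
  · intro y hy
    funext h
    simp only [φ]
    rw [← hz y hy h]
    exact hcancel' (G y) (y h)

end Stratum

section GradedComplements

variable {I : Type} {V : Type} [AddCommGroup V] [Module ℂ V] {π : I → Module.End ℂ V}

theorem exists_graded_isCompl [Fintype I] (hπ : CompleteOrthogonalIdempotents π) {i : I}
    {K : Submodule ℂ V} (hK : ∀ v ∈ K, π i v = v) :
    ∃ W, IsCompl W K ∧ ∀ j, ∀ v ∈ W, π j v ∈ W := by
  have hdisj : Disjoint (LinearMap.ker (π i)) K :=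
    Submodule.disjoint_def.2 fun v hv hvK => by rw [← hK v hvK]; exact hv
  obtain ⟨W, hW, hWK⟩ := hdisj.exists_isCompl
  refine ⟨W, hWK, fun j v hv => ?_⟩
  by_cases hij : i = j
  · subst hij
    have : v - π i v ∈ W := hW (by simp [hπ.idem_apply])
    simpa using W.sub_mem hv this
  · exact hW (hπ.ortho_apply hij v)

/-- The decomposition given by two complementary subspaces. -/
def Decomp.ofIsCompl {W K : Submodule ℂ V} (h : IsCompl W K) : Decomp V W K where
  ι1 := W.subtype
  ι2 := K.subtype
  p1 := Submodule.projectionOnto W K h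
  p2 := Submodule.projectionOnto K W h.symm
  p1_ι1 v := by simp
  p2_ι2 v := by simp
  p1_ι2 v := by simp
  p2_ι1 v := by simp
  add_eq v := Submodule.projection_add_projection_eq_self h v

theorem CompleteOrthogonalIdempotents.restrict [Fintype I] (hπ : CompleteOrthogonalIdempotents π)
    {W : Submodule ℂ V} (hW : ∀ j, ∀ v ∈ W, π j v ∈ W) :
    CompleteOrthogonalIdempotents fun j => (π j).restrict (hW j) where
  idem j := LinearMap.ext fun v => Subtype.ext (hπ.idem_apply j v)
  ortho j k hjk := LinearMap.ext fun v => Subtype.ext (hπ.ortho_apply hjk v)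
  complete := LinearMap.ext fun v => Subtype.ext (by
    simpa using hπ.sum_apply (v : V))

/-- The grading concentrated in degree `i`. -/
def constGrading (V : Type) [AddCommGroup V] [Module ℂ V] (i j : I) : Module.End ℂ V :=
  if j = i then 1 else 0

theorem completeOrthogonalIdempotents_constGrading [Fintype I] (i : I) :
    CompleteOrthogonalIdempotents (constGrading V i) where
  idem j := by
    unfold constGrading IsIdempotentElem
    split_ifs <;> simp
  ortho j k hjk := by
    change constGrading V i j * constGrading V i k = 0
    unfold constGrading
    split_ifs with h1 h2
    · exact (hjk (h1.trans h2.symm)).elim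
    all_goals simp
  complete := by simp [constGrading]

theorem gdim_constGrading_of_ne {i j : I} (h : j ≠ i) : gdim (constGrading V i) j = 0 := by
  rw [gdim, constGrading, if_neg h, LinearMap.range_zero, finrank_bot]

end GradedComplements

section LamSet

variable {I H : Type} [Fintype I] [Fintype H] {s t : H → I} {bar : H → H} {eps : H → ℤ}

omit [Fintype I] in
theorem IsDouble.eq_add_of_graded (hQ : IsDouble s t bar eps) {a b c : I → ℕ}
    (hc : ∀ i, c i = a i + b i) {i : I} (hb : ∀ j, j ≠ i → b j = 0) {d d1 : ℕ}
    (hd : 2 * d = ∑ h, c (s h) * c (t h)) (hd1 : 2 * d1 = ∑ h, a (s h) * a (t h)) :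
    d = d1 + ∑ h, a (s h) * b (t h) := by
  have h0 : ∑ h, b (s h) * b (t h) = 0 := Finset.sum_eq_zero fun h _ => by
    by_cases hs : s h = i
    · rw [hb (t h) (hs ▸ (hQ.loopless h).symm), mul_zero]
    · rw [hb _ hs, zero_mul]
  have h1 : ∑ h, c (s h) * c (t h) = ∑ h, a (s h) * a (t h) + ∑ h, a (s h) * b (t h) +
      (∑ h, b (s h) * a (t h) + ∑ h, b (s h) * b (t h)) := by
    simp only [hc, add_mul, mul_add, Finset.sum_add_distrib]
    ring
  rw [h0, ← hQ.sum_comm a b] at h1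
  omega

/-- The nilpotent variety is equidimensional, of half the dimension of the space of all
representations of the double quiver. -/
theorem IsDouble.good_LamSet (hQ : IsDouble s t bar eps) (n : ℕ) :
    ∀ {V : Type} [AddCommGroup V] [Module ℂ V] [FiniteDimensional ℂ V] {π : I → Module.End ℂ V},
      CompleteOrthogonalIdempotents π → Module.finrank ℂ V = n → ∀ d : ℕ,
        2 * d = ∑ h, gdim π (s h) * gdim π (t h) → Good (LamSet s t bar eps π) d := by
  induction n using Nat.strong_induction_on with
  | _ n ih =>
  intro V _ _ _ π hπ hn d hd
  rcases subsingleton_or_nontrivial V with hV | hV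
  · have hd0 : d = 0 := by
      have h0 (i : I) : gdim π i = 0 := Module.finrank_zero_of_subsingleton
      simpa [h0] using hd
    have e : LamSet s t bar eps π = {0} := by
      refine Set.eq_singleton_iff_unique_mem.2 ⟨⟨Submodule.zero_mem _, by simp, 1, fun l hl => ?_⟩,
        fun x hx => Subsingleton.elim _ _⟩
      exact Subsingleton.elim _ _
    rw [e, hd0]
    exact Good.singleton 0
  have hcov : LamSet s t bar eps π = ⋃ j : I × Fin n, {x | x ∈ LamSet s t bar eps π ∧
      Module.finrank ℂ (LinearMap.ker (jointMap π j.1 x)) = j.2 + 1} := by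
    ext x
    simp only [Set.mem_iUnion, Set.mem_ofPred_eq]
    refine ⟨fun hx => ?_, fun ⟨_, hx, _⟩ => hx⟩
    obtain ⟨i, v, hv, hxv⟩ := exists_jointMap_eq_zero hπ hx
    have hpos : 0 < Module.finrank ℂ (LinearMap.ker (jointMap π i x)) :=
      Module.finrank_pos_iff_exists_ne_zero.2 ⟨⟨v, hxv⟩, fun h => hv (congrArg Subtype.val h)⟩
    have hle := Submodule.finrank_le (LinearMap.ker (jointMap π i x))
    refine ⟨(i, ⟨Module.finrank ℂ (LinearMap.ker (jointMap π i x)) - 1, by omega⟩), hx, ?_⟩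
    simp only
    omega
  rw [hcov]
  refine Good.iUnion fun ⟨i, l, hl⟩ => Good.of_local fun x hx => ?_
  simp only [Set.mem_ofPred_eq] at hx ⊢
  set K := LinearMap.ker (jointMap π i x) with hK
  have hKi (v) (hv : v ∈ K) : π i v = v := (jointMap_eq_zero_iff.1 hv).2
  obtain ⟨W, hWK, hW⟩ := exists_graded_isCompl hπ hKi
  have hπ1 := hπ.restrict hW
  have hπ2 := completeOrthogonalIdempotents_constGrading (V := K) i
  have hD : (Decomp.ofIsCompl hWK).Graded π (fun j => (π j).restrict (hW j))
      (constGrading K i) := by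
    refine ⟨fun j v => rfl, fun j v => ?_⟩
    change π j v = (constGrading K i j v : V)
    by_cases hj : j = i
    · subst hj
      simp [constGrading, hKi]
    · rw [← hKi v v.2, hπ.ortho_apply hj]
      simp [constGrading, hj]
  have hfin := Submodule.finrank_add_eq_of_isCompl hWK
  obtain ⟨d1, hd1⟩ := hQ.exists_two_mul (gdim fun j => (π j).restrict (hW j))
  have hΛ := ih (Module.finrank ℂ W) (by omega) hπ1 rfl d1 hd1
  have hstr := hQ.good_stratum hD hπ1 hπ2 (i := i) (fun v => by simp [constGrading]) hΛ
    (hQ.eq_add_of_graded (hD.gdim_add hπ hπ1 hπ2) (fun j hj => gdim_constGrading_of_ne hj) hd hd1)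
  have hreg (S : Set (H → Module.End ℂ V)) :
      RegMap S fun y => jointMap π i y ∘ₗ (Decomp.ofIsCompl hWK).ι1 :=
    ((RegMap.id S).jointMap π i).lcomp (RegMap.const S _)
  obtain ⟨τ, hτ, h0⟩ := (hreg {y | y ∈ LamSet s t bar eps π ∧
    Module.finrank ℂ (LinearMap.ker (jointMap π i y)) = l + 1}).exists_det (x := x) fun v hv =>
      Subtype.ext (Submodule.disjoint_def.1 hWK.disjoint _ v.2 hv)
  refine ⟨_, hτ, h0, ?_⟩
  have hres := hstr.inter (((RegMap.const _ τ).lcomp (hreg _)).det)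
  convert hres using 1
  ext y
  simp only [Set.mem_ofPred_eq]
  rw [← hx.2]
  exact ⟨fun h => ⟨⟨h.1.1, h.1.2, eq_zero_of_det_ne_zero h.2⟩, h.2⟩,
    fun h => ⟨⟨h.1.1, h.1.2.1⟩, h.2⟩⟩

end LamSet

section Standard

variable {I H : Type} [Fintype I] [DecidableEq I] [Fintype H]

omit [Fintype I] in
theorem pr_apply_same (ν : I → ℕ) (i : I) (v : Vec ν) : pr ν i v i = v i := by
  simp [pr]

omit [Fintype I] in
theorem pr_apply_of_ne (ν : I → ℕ) {i j : I} (h : j ≠ i) (v : Vec ν) : pr ν i v j = 0 := by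
  simp [pr, h]

theorem completeOrthogonalIdempotents_pr (ν : I → ℕ) : CompleteOrthogonalIdempotents (pr ν) where
  idem i := by
    refine LinearMap.ext fun v => funext fun j => ?_
    by_cases h : j = i
    · subst h
      simp [pr_apply_same]
    · simp [pr_apply_of_ne _ h]
  ortho i k hik := by
    refine LinearMap.ext fun v => funext fun j => ?_
    by_cases h : j = i
    · subst h
      simp [pr_apply_same, pr_apply_of_ne _ hik]
    · simp [pr_apply_of_ne _ h]
  complete := by
    refine LinearMap.ext fun v => funext fun j => ?_
    rw [LinearMap.sum_apply, Finset.sum_apply, Finset.sum_eq_single j]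
    · simp [pr_apply_same]
    · intro i _ hi
      exact pr_apply_of_ne _ hi.symm _
    · simp

omit [Fintype I] in
theorem gdim_pr (ν : I → ℕ) (i : I) : gdim (pr ν) i = ν i := by
  have h : LinearMap.range (pr ν i) =
      LinearMap.range (LinearMap.single ℂ (fun j => Fin (ν j) → ℂ) i) :=
    LinearMap.range_comp_of_range_eq_top _ (LinearMap.range_eq_top.2 fun v =>
      ⟨Pi.single i v, by simp⟩)
  rw [gdim, h, LinearMap.finrank_range_of_inj fun a b hab => by simpa using congrFun hab i]
  simp

/-- The decomposition of `V` into its first and last coordinates. -/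
def stdDecomp (ν1 ν2 : I → ℕ) : Decomp (Vec fun i => ν1 i + ν2 i) (Vec ν1) (Vec ν2) where
  ι1 := emb1 ν1 ν2
  ι2 := emb2 ν1 ν2
  p1 := proj1 ν1 ν2
  p2 := proj2 ν1 ν2
  p1_ι1 v := by
    funext i k
    simp [proj1, emb1]
  p2_ι2 v := by
    funext i k
    simp [proj2, emb2]
  p1_ι2 v := by
    funext i k
    simp [proj1, emb2]
  p2_ι1 v := by
    funext i k
    simp [proj2, emb1]
  add_eq v := by
    funext i k
    by_cases h : (k : ℕ) < ν1 i
    · simp [proj1, emb1, emb2, h, Nat.not_le.2 h]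
    · have h' := Nat.not_lt.1 h
      simp only [emb1, emb2, proj2, LinearMap.coe_mk, AddHom.coe_mk, Pi.add_apply, h, h', dite_false,
        dite_true, zero_add]
      congr 1
      ext
      simp [h']

omit [Fintype I] in
theorem stdDecomp_graded (ν1 ν2 : I → ℕ) :
    (stdDecomp ν1 ν2).Graded (pr fun i => ν1 i + ν2 i) (pr ν1) (pr ν2) := by
  constructor
  all_goals
    intro i v
    funext j k
    by_cases h : j = i
    · subst h
      simp [stdDecomp, emb1, emb2, pr_apply_same]
    · simp [stdDecomp, emb1, emb2, pr_apply_of_ne _ h]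

omit [Fintype I] [DecidableEq I] in
theorem mem_V2sub_iff {ν1 ν2 : I → ℕ} {v : Vec fun i => ν1 i + ν2 i} :
    v ∈ V2sub ν1 ν2 ↔ (stdDecomp ν1 ν2).p1 v = 0 := by
  refine ⟨fun h => funext fun i => funext fun k => h i _ k.2, fun h i k hk => ?_⟩
  exact congrFun (congrFun h i) ⟨k, hk⟩

variable {s t : H → I} {bar : H → H} {eps : H → ℤ}

omit [Fintype I] in
theorem LSet_eq (ν μ : I → ℕ) : LSet s t bar eps ν μ =
    LamSet s t bar eps (pr ν) ×ˢ (gHom (pr ν) (pr μ) : Set (Vec ν →ₗ[ℂ] Vec μ)) := rfl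

theorem IsDouble.good_LSet (hQ : IsDouble s t bar eps) (ν μ : I → ℕ) {d : ℕ}
    (hd : 2 * d = ∑ h, ν (s h) * ν (t h)) :
    Good (LSet s t bar eps ν μ) (d + ∑ i, ν i * μ i) := by
  have h := (hQ.good_LamSet _ (completeOrthogonalIdempotents_pr ν) rfl d
    (by simpa [gdim_pr] using hd)).prod (good_submodule (gHom (pr ν) (pr μ)))
  rw [finrank_gHom (completeOrthogonalIdempotents_pr ν)
    (completeOrthogonalIdempotents_pr μ)] at h
  simp only [gdim_pr] at h
  exact h

theorem mem_LsSet_iff {ν μ : I → ℕ} {X : (H → Module.End ℂ (Vec ν)) × (Vec ν →ₗ[ℂ] Vec μ)} :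
    X ∈ LsSet s t bar eps ν μ ↔
      X ∈ LSet s t bar eps ν μ ∧ ∀ v, (∀ h, X.1 h v = 0) → X.2 v = 0 → v = 0 := by
  refine and_congr_right fun hX => ⟨fun hst v hx hq => ?_, fun hst i u hu hq hx => hst u ?_ hq⟩
  · have hπ := completeOrthogonalIdempotents_pr ν
    have h0 (i) : pr ν i v = 0 := by
      refine hst i _ (hπ.idem_apply i v) ?_ fun h hs => ?_
      · rw [← gHom_apply hX.2, hq, map_zero]
      · rw [← hs, blockFam_apply_proj hπ hX.1.1, hx]
    rw [← hπ.sum_apply v]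
    exact Finset.sum_eq_zero fun i _ => h0 i
  · intro h
    by_cases hs : s h = i
    · exact hx h hs
    · rw [← hu]
      exact blockFam_apply_of_ne (completeOrthogonalIdempotents_pr ν) hX.1.1 hs u

theorem IsDouble.good_LsSet (hQ : IsDouble s t bar eps) (ν μ : I → ℕ) {d : ℕ}
    (hd : 2 * d = ∑ h, ν (s h) * ν (t h)) :
    Good (LsSet s t bar eps ν μ) (d + ∑ i, ν i * μ i) := by
  let Ψ (X : (H → Module.End ℂ (Vec ν)) × (Vec ν →ₗ[ℂ] Vec μ)) :
      Vec ν →ₗ[ℂ] (H → Vec ν) × Vec μ :=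
    LinearMap.inl ℂ _ _ ∘ₗ (∑ h, LinearMap.single ℂ (fun _ => Vec ν) h ∘ₗ X.1 h) +
      LinearMap.inr ℂ _ _ ∘ₗ X.2
  have hΨ : RegMap (LSet s t bar eps ν μ) Ψ :=
    RegMap.add (RegMap.lcomp (RegMap.const _ _) (RegMap.sum fun h _ =>
      RegMap.lcomp (RegMap.const _ _) ((RegMap.id _).fst.apply h)))
        (RegMap.lcomp (RegMap.const _ _) (RegMap.id _).snd)
  have h := (hQ.good_LSet ν μ hd).injective_locus hΨ
  convert h using 1
  ext X
  rw [mem_LsSet_iff]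
  refine and_congr_right fun _ => forall_congr' fun v => ?_
  have e : (∑ h, LinearMap.single ℂ (fun _ => Vec ν) h ∘ₗ X.1 h) v = fun h => X.1 h v := by
    rw [LinearMap.sum_apply]
    exact LinearMap.sum_single_apply _ _
  rw [← and_imp]
  simp only [Ψ, LinearMap.add_apply, LinearMap.comp_apply, e, LinearMap.inl_apply,
    LinearMap.inr_apply, Prod.mk_add_mk, add_zero, zero_add, Prod.mk_eq_zero, funext_iff,
    Pi.zero_apply]

end Standard

section Words

variable {E H : Type} {W U : Type} [AddCommGroup W] [Module ℂ W] [AddCommGroup U] [Module ℂ U]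

/-- All words of length `n` in the family `y` map `F` into `G`. -/
def Carries (y : E → Module.End ℂ W) (n : ℕ) (F G : Submodule ℂ W) : Prop :=
  ∀ l : List E, l.length = n → ∀ w ∈ F, (l.map y).prod w ∈ G

theorem Carries.trans {y : E → Module.End ℂ W} {m n : ℕ} {F G K : Submodule ℂ W}
    (h : Carries y n F G) (h' : Carries y m G K) : Carries y (m + n) F K := by
  intro l hl w hw
  rw [← List.take_append_drop m l, List.map_append, List.prod_append]
  exact h' _ (by simp; omega) _ (h _ (by simp; omega) _ hw)

theorem carries_one {y : E → Module.End ℂ W} {F G : Submodule ℂ W}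
    (h : ∀ e, ∀ w ∈ F, y e w ∈ G) : Carries y 1 F G := by
  intro l hl w hw
  obtain ⟨e, rfl⟩ := List.length_eq_one_iff.1 hl
  simpa using h e w hw

theorem Carries.of_wordNilp {y : E → Module.End ℂ W} {z : E → Module.End ℂ U} (hz : WordNilp z)
    {g : W →ₗ[ℂ] U} {F : Submodule ℂ W} (hF : ∀ e, ∀ w ∈ F, y e w ∈ F)
    (hg : ∀ e, ∀ w ∈ F, g (y e w) = z e (g w)) : ∃ n, Carries y n F (F ⊓ LinearMap.ker g) := by
  obtain ⟨n, hn⟩ := hz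
  have key (l : List E) : ∀ w ∈ F, (l.map y).prod w ∈ F ∧
      g ((l.map y).prod w) = (l.map z).prod (g w) := by
    induction l with
    | nil => simp
    | cons e l ih =>
      intro w hw
      obtain ⟨h1, h2⟩ := ih w hw
      simp only [List.map_cons, List.prod_cons, Module.End.mul_apply]
      exact ⟨hF e _ h1, by rw [hg e _ h1, h2]⟩
  refine ⟨n, fun l hl w hw => ⟨(key l w hw).1, ?_⟩⟩
  change g _ = 0
  rw [(key l w hw).2, hn l hl, LinearMap.zero_apply]

theorem wordNilp_sum_elim_zero {x : H → Module.End ℂ U} (hx : WordNilp x) :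
    WordNilp (Sum.elim x fun _ : E => 0) := by
  obtain ⟨n, hn⟩ := hx
  refine ⟨n, fun l hl => ?_⟩
  by_cases h : ∃ e, Sum.inr e ∈ l
  · obtain ⟨e, he⟩ := h
    exact List.prod_eq_zero (List.mem_map.2 ⟨_, he, rfl⟩)
  · have : ∃ l' : List H, l'.map Sum.inl = l := by
      clear hl
      induction l with
      | nil => exact ⟨[], rfl⟩
      | cons a l ih =>
        obtain ⟨l', hl'⟩ := ih fun ⟨e, he⟩ => h ⟨e, List.mem_cons_of_mem _ he⟩
        rcases a with a | a
        · exact ⟨a :: l', by simp [hl']⟩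
        · exact (h ⟨a, by simp⟩).elim
    obtain ⟨l', rfl⟩ := this
    rw [List.map_map]
    exact hn l' (by simpa using hl)

end Words

section Framed

variable {I H : Type}

theorem mem_D2sub_iff {μ2 μ1 : I → ℕ} {d : Dsp μ2 μ1} : d ∈ D2sub μ2 μ1 ↔ d.2 = 0 := by
  refine ⟨?_, fun h => ⟨d.1, Prod.ext rfl h.symm⟩⟩
  rintro ⟨a, rfl⟩
  rfl

theorem invCore_le {ν : I → ℕ} (x : H → Module.End ℂ (Vec ν)) (S : Submodule ℂ (Vec ν)) :
    invCore x S ≤ S := sSup_le fun _ hU => hU.1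

theorem xInv_invCore {ν : I → ℕ} (x : H → Module.End ℂ (Vec ν)) (S : Submodule ℂ (Vec ν)) :
    xInv x (invCore x S) := by
  intro h v hv
  have : invCore x S ≤ (invCore x S).comap (x h) :=
    sSup_le fun U hU v hv => (le_sSup hU : U ≤ invCore x S) (hU.2 h v hv)
  exact this hv

theorem le_invClosure {ν : I → ℕ} (x : H → Module.End ℂ (Vec ν)) (S : Submodule ℂ (Vec ν)) :
    S ≤ invClosure x S := le_sInf fun _ hU => hU.1

theorem NilpFramed.wordNilp [DecidableEq I] {ν μ2 μ1 : I → ℕ} {X : Msp (H := H) ν μ2 μ1}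
    (hX : NilpFramed X) : WordNilp X.1 := by
  obtain ⟨n, hn⟩ := hX
  refine ⟨n, fun l hl => ?_⟩
  have key (l : List H) (w) :
      (((l.map Sum.inl).map (edgeMap X)).prod w).1 = (l.map X.1).prod w.1 := by
    induction l with
    | nil => simp
    | cons a l ih =>
      simp only [List.map_cons, List.prod_cons, Module.End.mul_apply, ← ih]
      rfl
  ext1 v
  rw [← key l (v, 0), hn _ (by simpa using hl)]
  rfl

end Framed

section Assemble

variable (H : Type) {I : Type} (ν1 ν2 μ2 μ1 : I → ℕ)

/-- The space of the diagonal blocks of framed representations. -/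
abbrev DiagBlocks : Type :=
  ((H → Module.End ℂ (Vec ν1)) × (Vec ν1 →ₗ[ℂ] Vec μ1)) ×
    ((H → Module.End ℂ (Vec ν2)) × (Vec ν2 →ₗ[ℂ] Vec μ2))

/-- The space of the off-diagonal blocks of framed representations. -/
abbrev OffBlocks : Type :=
  (H → Vec ν1 →ₗ[ℂ] Vec ν2) × (Vec μ1 →ₗ[ℂ] Vec ν2) × (Vec ν1 →ₗ[ℂ] Vec μ2)

variable {H ν1 ν2 μ2 μ1}

/-- The framed representation with given diagonal and off-diagonal blocks. -/
def assemble (z : DiagBlocks H ν1 ν2 μ2 μ1 × OffBlocks H ν1 ν2 μ2 μ1) :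
    Msp (H := H) (fun i => ν1 i + ν2 i) μ2 μ1 :=
  (fun h => (stdDecomp ν1 ν2).blk (z.1.1.1 h) (z.2.1 h) (z.1.2.1 h),
    (stdDecomp ν1 ν2).ι2 ∘ₗ z.2.2.1 ∘ₗ LinearMap.snd ℂ _ _,
    LinearMap.inl ℂ _ _ ∘ₗ
        (z.2.2.2 ∘ₗ (stdDecomp ν1 ν2).p1 + z.1.2.2 ∘ₗ (stdDecomp ν1 ν2).p2) +
      LinearMap.inr ℂ _ _ ∘ₗ z.1.1.2 ∘ₗ (stdDecomp ν1 ν2).p1)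

/-- The off-diagonal blocks of a framed representation. -/
def offDiag (X : Msp (H := H) (fun i => ν1 i + ν2 i) μ2 μ1) : OffBlocks H ν1 ν2 μ2 μ1 :=
  (fun h => (stdDecomp ν1 ν2).p2 ∘ₗ X.1 h ∘ₗ (stdDecomp ν1 ν2).ι1,
    (stdDecomp ν1 ν2).p2 ∘ₗ X.2.1 ∘ₗ LinearMap.inr ℂ _ _,
    LinearMap.fst ℂ _ _ ∘ₗ X.2.2 ∘ₗ (stdDecomp ν1 ν2).ι1)

variable (z : DiagBlocks H ν1 ν2 μ2 μ1 × OffBlocks H ν1 ν2 μ2 μ1)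

theorem assemble_p (d : Dsp μ2 μ1) :
    (assemble z).2.1 d = (stdDecomp ν1 ν2).ι2 (z.2.2.1 d.2) := rfl

theorem assemble_q (v) : (assemble z).2.2 v =
    (z.2.2.2 ((stdDecomp ν1 ν2).p1 v) + z.1.2.2 ((stdDecomp ν1 ν2).p2 v),
      z.1.1.2 ((stdDecomp ν1 ν2).p1 v)) := by
  simp [assemble]

theorem ρmap_assemble : ρmap ν1 ν2 μ2 μ1 (assemble z) = z.1 := by
  refine Prod.ext (Prod.ext (funext fun h => ?_) ?_) (Prod.ext (funext fun h => ?_) ?_)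
  · exact (stdDecomp ν1 ν2).p1_comp_blk_comp_ι1 _ _ _
  · refine LinearMap.ext fun v => ?_
    change ((assemble z).2.2 ((stdDecomp ν1 ν2).ι1 v)).2 = _
    simp [assemble_q]
  · exact (stdDecomp ν1 ν2).p2_comp_blk_comp_ι2 _ _ _
  · refine LinearMap.ext fun v => ?_
    change ((assemble z).2.2 ((stdDecomp ν1 ν2).ι2 v)).1 = _
    simp [assemble_q]

theorem offDiag_assemble : offDiag (assemble z) = z.2 := by
  refine Prod.ext (funext fun h => ?_) (Prod.ext ?_ ?_)
  · exact (stdDecomp ν1 ν2).p2_comp_blk_comp_ι1 _ _ _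
  · refine LinearMap.ext fun v => ?_
    simp [offDiag, assemble_p]
  · refine LinearMap.ext fun v => ?_
    simp [offDiag, assemble_q]

theorem V2sub_le_invCore_assemble : V2sub ν1 ν2 ≤
    invCore (assemble z).1 (Submodule.comap (assemble z).2.2 (D2sub μ2 μ1)) := by
  refine le_sSup ⟨fun v hv => ?_, fun h v hv => ?_⟩
  · rw [mem_V2sub_iff] at hv
    rw [Submodule.mem_comap, mem_D2sub_iff, assemble_q]
    simp [hv]
  · rw [mem_V2sub_iff] at hv ⊢
    change (stdDecomp ν1 ν2).p1 ((stdDecomp ν1 ν2).blk _ _ _ v) = 0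
    simp [Decomp.blk, hv]

theorem p1_assemble (h : H) (v) : (stdDecomp ν1 ν2).p1 ((assemble z).1 h v) =
    z.1.1.1 h ((stdDecomp ν1 ν2).p1 v) := by
  simp [assemble, Decomp.blk]

theorem invCore_assemble_le_iff (hnil : WordNilp z.1.1.1) :
    invCore (assemble z).1 (Submodule.comap (assemble z).2.2 (D2sub μ2 μ1)) ≤ V2sub ν1 ν2 ↔
      ∀ v, (∀ h, z.1.1.1 h v = 0) → z.1.1.2 v = 0 → v = 0 := by
  constructor
  · intro hle v hx hq
    let K : Submodule ℂ (Vec ν1) :=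
      (⨅ h, LinearMap.ker (z.1.1.1 h)) ⊓ LinearMap.ker z.1.1.2
    have hK {u} : u ∈ K ↔ (∀ h, z.1.1.1 h u = 0) ∧ z.1.1.2 u = 0 := by
      simp [K, Submodule.mem_iInf]
    have hKcore : K.comap (stdDecomp ν1 ν2).p1 ≤
        invCore (assemble z).1 (Submodule.comap (assemble z).2.2 (D2sub μ2 μ1)) := by
      refine le_sSup ⟨fun u hu => ?_, fun h u hu => ?_⟩
      · rw [Submodule.mem_comap, mem_D2sub_iff, assemble_q]
        exact (hK.1 hu).2
      · rw [Submodule.mem_comap, p1_assemble, (hK.1 hu).1 h]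
        exact K.zero_mem
    have h : (stdDecomp ν1 ν2).ι1 v ∈ V2sub ν1 ν2 :=
      hle (hKcore (by simpa using hK.2 ⟨hx, hq⟩))
    rw [mem_V2sub_iff] at h
    simpa using h
  · intro hst
    obtain ⟨n, hn⟩ := hnil
    refine sSup_le fun U hU => ?_
    have key (k : ℕ) : ∀ v ∈ U, (∀ l : List H, l.length = k →
        (l.map z.1.1.1).prod ((stdDecomp ν1 ν2).p1 v) = 0) → (stdDecomp ν1 ν2).p1 v = 0 := by
      induction k with
      | zero => exact fun v _ h => by simpa using h [] rfl
      | succ k ih =>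
        intro v hv h
        refine hst _ (fun a => ?_) ?_
        · rw [← p1_assemble]
          refine ih _ (hU.2 a v hv) fun l hl => ?_
          have := h (l ++ [a]) (by simp [hl])
          rw [p1_assemble]
          simpa using this
        · have := hU.1 hv
          rw [Submodule.mem_comap, mem_D2sub_iff, assemble_q] at this
          exact this
    intro v hv
    rw [mem_V2sub_iff]
    exact key n v hv fun l hl => by rw [hn l hl, LinearMap.zero_apply]

theorem invClosure_assemble_le :
    invClosure (assemble z).1 (LinearMap.range (assemble z).2.1) ≤ V2sub ν1 ν2 := by
  refine sInf_le ⟨?_, fun h v hv => ?_⟩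
  · rintro _ ⟨d, rfl⟩
    rw [mem_V2sub_iff, assemble_p]
    simp
  · rw [mem_V2sub_iff] at hv ⊢
    rw [p1_assemble, hv, map_zero]

theorem nilpFramed_assemble_iff [DecidableEq I] :
    NilpFramed (assemble z) ↔ WordNilp z.1.1.1 ∧ WordNilp z.1.2.1 := by
  refine ⟨fun h => (stdDecomp ν1 ν2).wordNilp_blk_iff.1 h.wordNilp, fun ⟨h1, h2⟩ => ?_⟩
  let D := stdDecomp ν1 ν2
  have hp1ι2 (v) : D.p1 (D.ι2 v) = 0 := D.p1_ι2 v
  let W : Type := Vec (fun i => ν1 i + ν2 i) × Dsp μ2 μ1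
  let g1 : W →ₗ[ℂ] Vec ν1 := D.p1 ∘ₗ LinearMap.fst ℂ _ _
  let g2 : W →ₗ[ℂ] Vec ν2 := D.p2 ∘ₗ LinearMap.fst ℂ _ _
  let g3 : W →ₗ[ℂ] Vec μ1 := LinearMap.snd ℂ _ _ ∘ₗ LinearMap.snd ℂ _ _
  have e1 (e) (w : W) : g1 (edgeMap (assemble z) e w) =
      Sum.elim z.1.1.1 (fun _ : I ⊕ I => 0) e (g1 w) := by
    rcases e with h | i | i
    · exact p1_assemble z h w.1
    · change D.p1 (D.ι2 _) = 0
      exact hp1ι2 _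
    · exact map_zero D.p1
  have e2 (e) (w : W) (hw : g1 w = 0) (hw' : g3 w = 0) : g2 (edgeMap (assemble z) e w) =
      Sum.elim z.1.2.1 (fun _ : I ⊕ I => 0) e (g2 w) := by
    have hw1 : (stdDecomp ν1 ν2).p1 w.1 = 0 := hw
    have hw2 : w.2.2 = 0 := hw'
    rcases e with h | i | i
    · change D.p2 (D.blk _ _ _ w.1) = z.1.2.1 h (D.p2 w.1)
      simp [Decomp.blk, D, hw1]
    · change D.p2 ((assemble z).2.1 (pr μ2 i w.2.1, pr μ1 i w.2.2)) = 0
      rw [assemble_p, hw2]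
      simp
    · exact map_zero D.p2
  have e3 (e) (w : W) (hw : g1 w = 0) : g3 (edgeMap (assemble z) e w) = 0 := by
    have hw1 : (stdDecomp ν1 ν2).p1 w.1 = 0 := hw
    rcases e with h | i | i
    · rfl
    · rfl
    · change pr μ1 i ((assemble z).2.2 w.1).2 = 0
      rw [assemble_q, hw1, map_zero, map_zero]
      exact map_zero (pr μ1 i)
  have e4 (e) (w : W) (hw : g1 w = 0) (hw2 : g2 w = 0) (hw' : g3 w = 0) :
      edgeMap (assemble z) e w = 0 := by
    have hw0 : w.1 = 0 := by
      rw [← D.add_eq w.1, show D.p1 w.1 = 0 from hw, show D.p2 w.1 = 0 from hw2]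
      simp
    have hw3 : w.2.2 = 0 := hw'
    rcases e with h | i | i
    · change ((assemble z).1 h w.1, (0 : Dsp μ2 μ1)) = 0
      rw [hw0, map_zero]
      rfl
    · change ((assemble z).2.1 (pr μ2 i w.2.1, pr μ1 i w.2.2), (0 : Dsp μ2 μ1)) = 0
      rw [assemble_p, hw3]
      simp
    · change ((0 : Vec fun i => ν1 i + ν2 i), eD μ2 μ1 i ((assemble z).2.2 w.1)) = 0
      rw [hw0, map_zero, map_zero]
      rfl
  obtain ⟨n1, c1⟩ := Carries.of_wordNilp (y := edgeMap (assemble z))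
    (wordNilp_sum_elim_zero (E := I ⊕ I) h1) (g := g1) (F := ⊤) (fun _ _ _ => trivial)
      fun e w _ => e1 e w
  have c2 : Carries (edgeMap (assemble z)) 1 (⊤ ⊓ LinearMap.ker g1)
      (LinearMap.ker g1 ⊓ LinearMap.ker g3) := carries_one fun e w hw =>
    ⟨by change g1 _ = 0; rw [e1, show g1 w = 0 from hw.2, map_zero], e3 e w hw.2⟩
  obtain ⟨n3, c3⟩ := Carries.of_wordNilp (y := edgeMap (assemble z))
    (wordNilp_sum_elim_zero (E := I ⊕ I) h2) (g := g2)
      (F := LinearMap.ker g1 ⊓ LinearMap.ker g3)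
      (fun e w hw => ⟨by change g1 _ = 0; rw [e1, show g1 w = 0 from hw.1, map_zero],
        e3 e w hw.1⟩)
      fun e w hw => e2 e w hw.1 hw.2
  have c4 : Carries (edgeMap (assemble z)) 1 (LinearMap.ker g1 ⊓ LinearMap.ker g3 ⊓
      LinearMap.ker g2) ⊥ := carries_one fun e w hw => e4 e w hw.1.1 hw.2 hw.1.2
  exact ⟨n1 + 1 + n3 + 1, fun l hl => LinearMap.ext fun w =>
    (((c1.trans c2).trans c3).trans c4) l (hl.trans (by omega)) w trivial⟩

end Assemble

section Bundle

variable {I H : Type} [Fintype I] [DecidableEq I] [Fintype H] {ν1 ν2 μ2 μ1 : I → ℕ}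
  {s t : H → I} {bar : H → H} {eps : H → ℤ}

variable (s t ν1 ν2 μ2 μ1) in
/-- The graded off-diagonal blocks. -/
def gradedOffBlocks : Submodule ℂ (OffBlocks H ν1 ν2 μ2 μ1) :=
  (blockFam (pr ν1) (pr ν2) s t).prod ((gHom (pr μ1) (pr ν2)).prod (gHom (pr ν1) (pr μ2)))

theorem finrank_submodule_prod {M N : Type} [AddCommGroup M] [Module ℂ M] [FiniteDimensional ℂ M]
    [AddCommGroup N] [Module ℂ N] [FiniteDimensional ℂ N] (p : Submodule ℂ M)
    (q : Submodule ℂ N) :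
    Module.finrank ℂ (p.prod q) = Module.finrank ℂ p + Module.finrank ℂ q := by
  rw [← Module.finrank_prod]
  exact LinearEquiv.finrank_eq
    { toFun := fun x => (⟨x.1.1, x.2.1⟩, ⟨x.1.2, x.2.2⟩)
      invFun := fun x => ⟨(x.1.1, x.2.1), x.1.2, x.2.2⟩
      map_add' := fun _ _ => rfl
      map_smul' := fun _ _ => rfl
      left_inv := fun _ => rfl
      right_inv := fun _ => rfl }

theorem finrank_gradedOffBlocks : Module.finrank ℂ (gradedOffBlocks ν1 ν2 μ2 μ1 s t) =
    (∑ h, ν1 (s h) * ν2 (t h)) + (∑ i, μ1 i * ν2 i) + ∑ i, ν1 i * μ2 i := by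
  have h := completeOrthogonalIdempotents_pr (I := I)
  rw [gradedOffBlocks, finrank_submodule_prod, finrank_submodule_prod,
    finrank_blockFam (h ν1) (h ν2), finrank_gHom (h μ1) (h ν2), finrank_gHom (h ν1) (h μ2)]
  simp only [gdim_pr, add_assoc]

variable (bar eps) in
/-- The linear part of the moment map equation for framed representations, as a function of the
off-diagonal blocks. -/
def offMoment (y : DiagBlocks H ν1 ν2 μ2 μ1) :
    OffBlocks H ν1 ν2 μ2 μ1 →ₗ[ℂ] (Vec ν1 →ₗ[ℂ] Vec ν2) :=
  mixMap bar eps y.1.1 y.2.1 ∘ₗ LinearMap.fst ℂ _ _ -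
    (LinearMap.llcomp ℂ (Vec ν1) (Vec μ1) (Vec ν2)).flip y.1.2 ∘ₗ
      LinearMap.fst ℂ _ _ ∘ₗ LinearMap.snd ℂ _ _

omit [Fintype I] [DecidableEq I] in
theorem offMoment_apply (y : DiagBlocks H ν1 ν2 μ2 μ1) (e : OffBlocks H ν1 ν2 μ2 μ1) :
    offMoment bar eps y e = mixMap bar eps y.1.1 y.2.1 e.1 - e.2.1 ∘ₗ y.1.2 := rfl

omit [Fintype I] [DecidableEq I] in
theorem moment_assemble_iff (z : DiagBlocks H ν1 ν2 μ2 μ1 × OffBlocks H ν1 ν2 μ2 μ1) :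
    ∑ h, eps h • ((assemble z).1 h * (assemble z).1 (bar h)) =
        (assemble z).2.1 ∘ₗ (assemble z).2.2 ↔
      ∑ h, eps h • (z.1.1.1 h * z.1.1.1 (bar h)) = 0 ∧
        ∑ h, eps h • (z.1.2.1 h * z.1.2.1 (bar h)) = 0 ∧ offMoment bar eps z.1 z.2 = 0 := by
  have e : (assemble z).2.1 ∘ₗ (assemble z).2.2 =
      (stdDecomp ν1 ν2).blk 0 (z.2.2.1 ∘ₗ z.1.1.2) 0 := by
    refine (stdDecomp ν1 ν2).hom_ext (fun v => ?_) fun v => ?_ <;>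
      simp [assemble_p, assemble_q]
  rw [e]
  change ∑ h, eps h • ((stdDecomp ν1 ν2).blk _ _ _ * (stdDecomp ν1 ν2).blk _ _ _) = _ ↔ _
  rw [Decomp.moment_blk, Decomp.blk_inj, offMoment_apply, sub_eq_zero]
  tauto

omit [Fintype I] [Fintype H] in
theorem p_assemble_graded_iff (z : DiagBlocks H ν1 ν2 μ2 μ1 × OffBlocks H ν1 ν2 μ2 μ1) :
    (∀ i, pr (fun i => ν1 i + ν2 i) i ∘ₗ (assemble z).2.1 = (assemble z).2.1 ∘ₗ eD μ2 μ1 i) ↔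
      z.2.2.1 ∈ gHom (pr μ1) (pr ν2) := by
  have hD := stdDecomp_graded ν1 ν2
  rw [mem_gHom_iff]
  refine forall_congr' fun i => ⟨fun h v => ?_, fun h => LinearMap.ext fun d => ?_⟩
  · have := congrArg (stdDecomp ν1 ν2).p2 (LinearMap.congr_fun h (0, v))
    simpa [assemble_p, hD.ι2, eD] using this
  · simp [assemble_p, hD.ι2, eD, h]

omit [Fintype I] [Fintype H] in
theorem q_assemble_graded_iff (z : DiagBlocks H ν1 ν2 μ2 μ1 × OffBlocks H ν1 ν2 μ2 μ1) :
    (∀ i, eD μ2 μ1 i ∘ₗ (assemble z).2.2 = (assemble z).2.2 ∘ₗ pr (fun i => ν1 i + ν2 i) i) ↔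
      z.2.2.2 ∈ gHom (pr ν1) (pr μ2) ∧ z.1.1.2 ∈ gHom (pr ν1) (pr μ1) ∧
        z.1.2.2 ∈ gHom (pr ν2) (pr μ2) := by
  have hD := stdDecomp_graded ν1 ν2
  simp only [mem_gHom_iff, ← forall_and]
  refine forall_congr' fun i => ⟨fun h => ?_, fun h => ?_⟩
  · have key (v) := LinearMap.congr_fun h v
    simp only [LinearMap.comp_apply, assemble_q, eD, LinearMap.prodMap_apply, Prod.mk.injEq] at key
    refine ⟨fun v => ?_, fun v => ?_, fun v => ?_⟩
    · simpa [hD.ι1] using (key ((stdDecomp ν1 ν2).ι1 v)).1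
    · simpa [hD.ι1] using (key ((stdDecomp ν1 ν2).ι1 v)).2
    · simpa [hD.ι2] using (key ((stdDecomp ν1 ν2).ι2 v)).1
  · refine LinearMap.ext fun v => ?_
    simp [assemble_q, eD, h.1, h.2.1, h.2.2, hD.p1, hD.p2]

theorem assemble_mem_iff (z : DiagBlocks H ν1 ν2 μ2 μ1 × OffBlocks H ν1 ν2 μ2 μ1) :
    assemble z ∈ PiSetV2 s t bar eps ν1 ν2 μ2 μ1 ↔
      z.1 ∈ LsSet s t bar eps ν1 μ1 ×ˢ LSet s t bar eps ν2 μ2 ∧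
        z.2 ∈ gradedOffBlocks ν1 ν2 μ2 μ1 s t ∧ offMoment bar eps z.1 z.2 = 0 := by
  have hx : gradedX s t (fun i => ν1 i + ν2 i) (assemble z).1 ↔ _ :=
    (stdDecomp_graded ν1 ν2).blk_mem_blockFam_iff (s := s) (t := t)
  rw [Set.mem_prod, mem_LsSet_iff, LSet_eq, LSet_eq]
  constructor
  · rintro ⟨⟨h1, h2, h3, h4, h5, -, -⟩, hc⟩
    rw [hx] at h1
    rw [p_assemble_graded_iff] at h2
    rw [q_assemble_graded_iff] at h3
    rw [moment_assemble_iff] at h4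
    rw [nilpFramed_assemble_iff] at h5
    exact ⟨⟨⟨⟨⟨h1.1, h4.1, h5.1⟩, h3.2.1⟩, (invCore_assemble_le_iff z h5.1).1 hc.le⟩,
      ⟨h1.2.2, h4.2.1, h5.2⟩, h3.2.2⟩, ⟨h1.2.1, h2, h3.1⟩, h4.2.2⟩
  · rintro ⟨⟨⟨⟨⟨h1, h2, h3⟩, h4⟩, h5⟩, ⟨h6, h7, h8⟩, h9⟩, ⟨h10, h11, h12⟩, h13⟩
    have hc := le_antisymm ((invCore_assemble_le_iff z h3).2 h5) (V2sub_le_invCore_assemble z)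
    refine ⟨⟨hx.2 ⟨h1, h10, h6⟩, (p_assemble_graded_iff z).2 h11,
      (q_assemble_graded_iff z).2 ⟨h12, h4, h9⟩, (moment_assemble_iff z).2 ⟨h2, h7, h13⟩,
      (nilpFramed_assemble_iff z).2 ⟨h3, h8⟩, ?_, fun d hd => ?_⟩, hc⟩
    · rw [hc]
      exact invClosure_assemble_le z
    · rw [assemble_p, mem_D2sub_iff.1 hd, map_zero, map_zero]

omit [Fintype I] in
theorem assemble_blocks {X : Msp (H := H) (fun i => ν1 i + ν2 i) μ2 μ1}
    (hX : X ∈ PiSetV2 s t bar eps ν1 ν2 μ2 μ1) :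
    assemble (ρmap ν1 ν2 μ2 μ1 X, offDiag X) = X := by
  obtain ⟨⟨-, -, -, -, -, hcl, hp⟩, hc⟩ := hX
  let D := stdDecomp ν1 ν2
  have hinv : xInv X.1 (V2sub ν1 ν2) := hc ▸ xInv_invCore _ _
  have hq : V2sub ν1 ν2 ≤ Submodule.comap X.2.2 (D2sub μ2 μ1) := hc ▸ invCore_le _ _
  have hι2 (v) : D.ι2 v ∈ V2sub ν1 ν2 := mem_V2sub_iff.2 (D.p1_ι2 v)
  have hrange (d) : D.p1 (X.2.1 d) = 0 :=
    mem_V2sub_iff.1 (hc ▸ hcl (le_invClosure _ _ ⟨d, rfl⟩))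
  refine Prod.ext (funext fun h => ?_) (Prod.ext ?_ ?_)
  · exact (D.eq_blk fun v => mem_V2sub_iff.1 (hinv h _ (hι2 v))).symm
  · refine LinearMap.ext fun d => ?_
    have h1 : X.2.1 d = X.2.1 (0, d.2) := by
      have := hp (d.1, 0) (mem_D2sub_iff.2 rfl)
      rw [← zero_add (X.2.1 (0, d.2)), ← this, ← map_add]
      simp
    have h2 := D.add_eq (X.2.1 (0, d.2))
    rw [hrange, map_zero, zero_add] at h2
    rw [h1, ← h2, assemble_p]
    rfl
  · have h2 (v) : (X.2.2 (D.ι2 v)).2 = 0 := mem_D2sub_iff.1 (hq (hι2 v))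
    refine D.hom_ext (fun v => ?_) fun v => ?_
    · rw [assemble_q, D.p1_ι1, D.p2_ι1, map_zero, add_zero]
      rfl
    · rw [assemble_q, D.p1_ι2, D.p2_ι2, map_zero, map_zero, zero_add]
      exact Prod.ext rfl (h2 v).symm

theorem blocks_mem {X : Msp (H := H) (fun i => ν1 i + ν2 i) μ2 μ1}
    (hX : X ∈ PiSetV2 s t bar eps ν1 ν2 μ2 μ1) :
    ρmap ν1 ν2 μ2 μ1 X ∈ LsSet s t bar eps ν1 μ1 ×ˢ LSet s t bar eps ν2 μ2 ∧
      offDiag X ∈ gradedOffBlocks ν1 ν2 μ2 μ1 s t ∧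
        offMoment bar eps (ρmap ν1 ν2 μ2 μ1 X) (offDiag X) = 0 :=
  (assemble_mem_iff (ρmap ν1 ν2 μ2 μ1 X, offDiag X)).1 (by rwa [assemble_blocks hX])

theorem IsDouble.offMoment_mem (hQ : IsDouble s t bar eps) {y : DiagBlocks H ν1 ν2 μ2 μ1}
    (hy : y ∈ LsSet s t bar eps ν1 μ1 ×ˢ LSet s t bar eps ν2 μ2) {e : OffBlocks H ν1 ν2 μ2 μ1}
    (he : e ∈ gradedOffBlocks ν1 ν2 μ2 μ1 s t) :
    offMoment bar eps y e ∈ gHom (pr ν1) (pr ν2) := by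
  have h := completeOrthogonalIdempotents_pr (I := I)
  rw [offMoment_apply]
  refine Submodule.sub_mem _ (hQ.mixMap_mem (h _) (h _) hy.1.1.1.1 hy.2.1.1 he.1)
    (mem_gHom_iff.2 fun i v => ?_)
  rw [LinearMap.comp_apply, LinearMap.comp_apply, gHom_apply he.2.1, gHom_apply hy.1.1.2]

theorem IsDouble.exists_offMoment_eq (hQ : IsDouble s t bar eps)
    {y : DiagBlocks H ν1 ν2 μ2 μ1}
    (hy : y ∈ LsSet s t bar eps ν1 μ1 ×ˢ LSet s t bar eps ν2 μ2) {f : Vec ν1 →ₗ[ℂ] Vec ν2}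
    (hf : f ∈ gHom (pr ν1) (pr ν2)) :
    ∃ e ∈ gradedOffBlocks ν1 ν2 μ2 μ1 s t, offMoment bar eps y e = f := by
  have h := completeOrthogonalIdempotents_pr (I := I)
  obtain ⟨x', hx', p, hp, e⟩ := hQ.exists_mixMap_sub_eq (h _) (h _) (h _) hy.1.1.1.1 hy.1.1.2
    (mem_LsSet_iff.1 hy.1).2 hy.2.1.1 hy.2.1.2.2 hf
  exact ⟨(x', p, 0), ⟨hx', hp, Submodule.zero_mem _⟩, e⟩

theorem IsDouble.finrank_le (hQ : IsDouble s t bar eps)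
    {y : DiagBlocks H ν1 ν2 μ2 μ1}
    (hy : y ∈ LsSet s t bar eps ν1 μ1 ×ˢ LSet s t bar eps ν2 μ2) :
    Module.finrank ℂ (gHom (pr ν1) (pr ν2)) ≤
      Module.finrank ℂ (gradedOffBlocks ν1 ν2 μ2 μ1 s t) := by
  refine (Submodule.finrank_mono
    (t := (gradedOffBlocks ν1 ν2 μ2 μ1 s t).map (offMoment bar eps y)) fun f hf => ?_).trans
      (Submodule.finrank_map_le _ _)
  obtain ⟨e, he, h⟩ := hQ.exists_offMoment_eq hy hf
  exact ⟨e, he, h⟩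

omit [DecidableEq I] in
theorem RegMap.assemble {M : Type} [AddCommGroup M] [Module ℂ M] [FiniteDimensional ℂ M]
    {S : Set M} {f : M → DiagBlocks H ν1 ν2 μ2 μ1 × OffBlocks H ν1 ν2 μ2 μ1} (hf : RegMap S f) :
    RegMap S fun m => assemble (f m) := by
  have c {N : Type} [AddCommGroup N] [Module ℂ N] (n : N) := RegMap.const S n
  refine (RegMap.pi fun h => RegMap.blk _ (hf.fst.fst.fst.apply h) (hf.snd.fst.apply h)
    (hf.fst.snd.fst.apply h)).prodMk (RegMap.prodMk ?_ ?_)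
  · exact (c _).lcomp (hf.snd.snd.fst.lcomp (c _))
  · exact ((c _).lcomp ((hf.snd.snd.snd.lcomp (c _)).add (hf.fst.snd.snd.lcomp (c _)))).add
      ((c _).lcomp (hf.fst.fst.snd.lcomp (c _)))

omit [DecidableEq I] in
theorem RegMap.blocks {S : Set (Msp (H := H) (fun i => ν1 i + ν2 i) μ2 μ1)} :
    RegMap S fun X => (ρmap ν1 ν2 μ2 μ1 X, offDiag X) := by
  have c {N : Type} [AddCommGroup N] [Module ℂ N] (n : N) := RegMap.const S n
  have hx (h : H) := (RegMap.id S).fst.apply h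
  have hp := (RegMap.id S).snd.fst
  have hq := (RegMap.id S).snd.snd
  refine RegMap.prodMk (RegMap.prodMk (RegMap.prodMk (RegMap.pi fun h => ?_) ?_)
    (RegMap.prodMk (RegMap.pi fun h => ?_) ?_))
    (RegMap.prodMk (RegMap.pi fun h => ?_) (RegMap.prodMk ?_ ?_))
  · exact (c _).lcomp ((hx h).lcomp (c _))
  · exact (c _).lcomp (hq.lcomp (c _))
  · exact (c _).lcomp ((hx h).lcomp (c _))
  · exact (c _).lcomp (hq.lcomp (c _))
  · exact (c _).lcomp ((hx h).lcomp (c _))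
  · exact (c _).lcomp (hp.lcomp (c _))
  · exact (c _).lcomp (hq.lcomp (c _))

theorem IsDouble.good_preimage (hQ : IsDouble s t bar eps) {B : Set (DiagBlocks H ν1 ν2 μ2 μ1)}
    (hBL : B ⊆ LsSet s t bar eps ν1 μ1 ×ˢ LSet s t bar eps ν2 μ2) {d d' : ℕ} (hB : Good B d)
    (hd : d' + ∑ i, ν1 i * ν2 i = d +
      ((∑ h, ν1 (s h) * ν2 (t h)) + (∑ i, μ1 i * ν2 i) + ∑ i, ν1 i * μ2 i)) :
    Good {X | X ∈ PiSetV2 s t bar eps ν1 ν2 μ2 μ1 ∧ ρmap ν1 ν2 μ2 μ1 X ∈ B} d' := by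
  have hπ := completeOrthogonalIdempotents_pr (I := I)
  have : FiniteDimensional ℂ (DiagBlocks H ν1 ν2 μ2 μ1) := Module.Finite.prod
  have : FiniteDimensional ℂ (OffBlocks H ν1 ν2 μ2 μ1) := Module.Finite.prod
  have hT : RegMap B fun y => offMoment bar eps y :=
    ((RegMap.mixMap bar eps (RegMap.id B).fst.fst (RegMap.id B).snd.fst).lcomp
      (RegMap.const B _)).sub (((RegMap.id B).fst.snd.comp_lin _).lcomp (RegMap.const B _))
  have h := hB.kernel_submodule hT (gradedOffBlocks ν1 ν2 μ2 μ1 s t) (gHom (pr ν1) (pr ν2))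
    (d' := d') (fun b hb e he => hQ.offMoment_mem (hBL hb) he)
    (fun b hb f hf => hQ.exists_offMoment_eq (hBL hb) hf) (by
      rw [finrank_gradedOffBlocks, finrank_gHom (hπ _) (hπ _)]
      simpa only [gdim_pr] using hd)
  refine h.of_iso (φ := assemble) (ψ := fun X => (ρmap ν1 ν2 μ2 μ1 X, offDiag X))
    (RegMap.id _).assemble RegMap.blocks (fun z hz => ?_) (fun X hX => ?_) (fun z _ => ?_)
    fun X hX => assemble_blocks hX.1
  · exact ⟨(assemble_mem_iff z).2 ⟨hBL hz.1, hz.2⟩, by rw [ρmap_assemble]; exact hz.1⟩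
  · exact ⟨hX.2, (blocks_mem hX.1).2⟩
  · exact Prod.ext (ρmap_assemble z) (offDiag_assemble z)

end Bundle

/-- The fibers of the vector bundle `ρ : Π_{V,D•;V²} → L^s_{V¹,D¹} × L_{V²,D²}`
have dimension `Σ_{h∈H} ν¹_{h'}ν²_{h''} + Σ_i d¹_i ν²_i + Σ_i ν¹_i d²_i − Σ_i ν¹_i ν²_i`;
consequently `Π_{V,D•;V²}` is pure-dimensional of dimension
`(1/2)·dim E(V,D) − Σ_i ν¹_i ν²_i`. -/
theorem rho_fiber_dim_and_purity
    (hbarbar : ∀ h, bar (bar h) = h)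
    (hsbar : ∀ h, s (bar h) = t h) (htbar : ∀ h, t (bar h) = s h)
    (hloopless : ∀ h, s h ≠ t h)
    (heps : ∀ h, eps h = 1 ∨ eps h = -1)
    (hepsbar : ∀ h, eps h + eps (bar h) = 0)
    (ν1 ν2 μ2 μ1 : I → ℕ) :
    (∀ y1 ∈ LsSet s t bar eps ν1 μ1, ∀ y2 ∈ LSet s t bar eps ν2 μ2,
      zDim {X | X ∈ PiSetV2 s t bar eps ν1 ν2 μ2 μ1 ∧
          ρmap ν1 ν2 μ2 μ1 X = (y1, y2)} +
        ((∑ i : I, ν1 i * ν2 i : ℕ) : WithBot ℕ∞) =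
      (((∑ h : H, ν1 (s h) * ν2 (t h)) + (∑ i : I, μ1 i * ν2 i) +
          (∑ i : I, ν1 i * μ2 i) : ℕ) : WithBot ℕ∞)) ∧
    (∃ e : ℕ,
      2 * e = (∑ h : H, (ν1 (s h) + ν2 (s h)) * (ν1 (t h) + ν2 (t h))) +
          2 * ∑ i : I, (ν1 i + ν2 i) * (μ2 i + μ1 i) ∧
      ∀ C ∈ zIrr (PiSetV2 s t bar eps ν1 ν2 μ2 μ1),
        zDimC C + ((∑ i : I, ν1 i * ν2 i : ℕ) : WithBot ℕ∞) = (e : WithBot ℕ∞)) := by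
  have hQ : IsDouble s t bar eps := ⟨hbarbar, hsbar, htbar, hloopless, heps, hepsbar⟩
  have hπ := completeOrthogonalIdempotents_pr (I := I)
  have hle (y : DiagBlocks H ν1 ν2 μ2 μ1)
      (hy : y ∈ LsSet s t bar eps ν1 μ1 ×ˢ LSet s t bar eps ν2 μ2) :
      ∑ i, ν1 i * ν2 i ≤
        (∑ h, ν1 (s h) * ν2 (t h)) + (∑ i, μ1 i * ν2 i) + ∑ i, ν1 i * μ2 i := by
    have h := hQ.finrank_le hy
    rw [finrank_gradedOffBlocks, finrank_gHom (hπ _) (hπ _)] at h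
    simpa only [gdim_pr] using h
  refine ⟨fun y1 hy1 y2 hy2 => ?_, ?_⟩
  · obtain ⟨k, hk⟩ := Nat.exists_eq_add_of_le (hle (y1, y2) ⟨hy1, hy2⟩)
    have hgood := hQ.good_preimage (B := {(y1, y2)}) (d' := k)
      (Set.singleton_subset_iff.2 ⟨hy1, hy2⟩) (Good.singleton _) (by omega)
    have hX : assemble ((y1, y2), 0) ∈ PiSetV2 s t bar eps ν1 ν2 μ2 μ1 :=
      (assemble_mem_iff _).2 ⟨⟨hy1, hy2⟩, Submodule.zero_mem _, map_zero _⟩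
    rw [show {X | X ∈ PiSetV2 s t bar eps ν1 ν2 μ2 μ1 ∧ ρmap ν1 ν2 μ2 μ1 X = (y1, y2)} =
      {X | X ∈ PiSetV2 s t bar eps ν1 ν2 μ2 μ1 ∧ ρmap ν1 ν2 μ2 μ1 X ∈ ({(y1, y2)} : Set _)}
        from rfl, hgood.zDim_eq ⟨_, hX, ρmap_assemble _⟩, hk, add_comm (∑ i, ν1 i * ν2 i)]
    norm_cast
  · obtain ⟨d1, hd1⟩ := hQ.exists_two_mul ν1
    obtain ⟨d2, hd2⟩ := hQ.exists_two_mul ν2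
    refine ⟨d1 + (∑ i, ν1 i * μ1 i) + (d2 + ∑ i, ν2 i * μ2 i) +
      ((∑ h, ν1 (s h) * ν2 (t h)) + (∑ i, μ1 i * ν2 i) + ∑ i, ν1 i * μ2 i), ?_, fun C hC => ?_⟩
    · have h1 : ∑ h, (ν1 (s h) + ν2 (s h)) * (ν1 (t h) + ν2 (t h)) =
          2 * d1 + 2 * d2 + 2 * ∑ h, ν1 (s h) * ν2 (t h) := by
        rw [two_mul (∑ h, ν1 (s h) * ν2 (t h))]
        nth_rewrite 2 [hQ.sum_comm ν1 ν2]
        rw [hd1, hd2]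
        simp only [← Finset.sum_add_distrib]
        exact Finset.sum_congr rfl fun h _ => by ring
      have h2 : ∑ i, (ν1 i + ν2 i) * (μ2 i + μ1 i) = (∑ i, ν1 i * μ1 i) + (∑ i, ν2 i * μ2 i) +
          (∑ i, μ1 i * ν2 i) + ∑ i, ν1 i * μ2 i := by
        simp only [← Finset.sum_add_distrib]
        exact Finset.sum_congr rfl fun i _ => by ring
      rw [h1, h2]
      ring
    · obtain ⟨X, -⟩ := hC.1.1
      obtain ⟨k, hk⟩ := Nat.exists_eq_add_of_le (hle _ (blocks_mem X.2).1)
      have hgood := hQ.good_preimage (B := LsSet s t bar eps ν1 μ1 ×ˢ LSet s t bar eps ν2 μ2)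
        (d' := d1 + (∑ i, ν1 i * μ1 i) + (d2 + ∑ i, ν2 i * μ2 i) + k) subset_rfl
        ((hQ.good_LsSet ν1 μ1 hd1).prod (hQ.good_LSet ν2 μ2 hd2)) (by omega)
      have e : {X | X ∈ PiSetV2 s t bar eps ν1 ν2 μ2 μ1 ∧ ρmap ν1 ν2 μ2 μ1 X ∈
          LsSet s t bar eps ν1 μ1 ×ˢ LSet s t bar eps ν2 μ2} =
            PiSetV2 s t bar eps ν1 ν2 μ2 μ1 :=
        Set.ext fun X => and_iff_left_of_imp fun hX => (blocks_mem hX).1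
      rw [e] at hgood
      rw [hgood.zDimC_eq hC, hk, add_comm (∑ i, ν1 i * ν2 i), ← add_assoc]
      norm_cast
      ring
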